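/- Let H be a graph with wpn(H) ≥ 2 and write r = wpn(H). There exists δ_0 > 0 such that for every δ with 0 < δ < δ_0 there exist γ > 0 and positive integers b and k with the following property. Among all H-free graphs G with vertex set {1,…,n}, the proportion of those for which there exist a partition of {1,…,n} into sets X_1,…,X_r, Z_1,…,Z_r and a set B of at most b vertices such that each induced subgraph G[X_i] is U(k)-free and (I) there is a really canonical H-freeness witnessing r-sequence (F_1,…,F_r) with G[X_i] ∈ F_i for every i, (II) |Z_1 ∪ ⋯ ∪ Z_r| ≤ n^{1-γ}, (III) for every vertex v ∈ X_i ∪ Z_i there is a vertex a ∈ B with |(N(v) Δ N(a)) ∩ (X_i ∪ Z_i)| < δn, and (IV) for every i, ||X_i ∪ Z_i| − n/r| ≤ n^{1−γ/4}, tends to 1 as n tends to infinity. -/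

import Mathlib

open SimpleGraph Filter

/-- `G` contains no induced copy of `H`. -/
def IndFree {W V : Type*} (H : SimpleGraph W) (G : SimpleGraph V) : Prop :=
  ¬ Nonempty (H ↪g G)

/-- A class of finite graphs: a predicate on graphs over every finite vertex type. -/
abbrev GraphClass : Type 1 := ∀ (V : Type) [Finite V], SimpleGraph V → Prop

/-- A class of finite graphs is hereditary if it is closed under isomorphism and
under taking induced subgraphs (equivalently, closed under induced-subgraph
embeddings). -/
def GraphClass.Hereditary (F : GraphClass) : Prop :=
  ∀ (V W : Type) [Finite V] [Finite W] (G : SimpleGraph V) (L : SimpleGraph W),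
    Nonempty (L ↪g G) → F V G → F W L

/-- The class contains all complete graphs. -/
def GraphClass.ContainsAllCliques (F : GraphClass) : Prop :=
  ∀ (V : Type) [Finite V], F V ⊤

/-- The class contains all edgeless graphs. -/
def GraphClass.ContainsAllStables (F : GraphClass) : Prop :=
  ∀ (V : Type) [Finite V], F V ⊥

/-- `(F 0, …, F (k-1))` is an `H`-freeness witnessing `k`-sequence: a sequence of
hereditary classes such that for every partition of `V(H)` into `k` parts some part
induces a graph outside the corresponding class. -/
def IsWitnessingSeq {VH : Type} [Finite VH] (H : SimpleGraph VH) (k : ℕ)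
    (F : Fin k → GraphClass) : Prop :=
  (∀ i, (F i).Hereditary) ∧
  ∀ X : VH → Fin k, ∃ i, ¬ F i ↥{v | X v = i} (H.induce {v | X v = i})

/-- `F` is canonical for `H`: there is a set `J` of induced subgraphs of `H` such that
`F` is exactly the class of graphs containing no induced copy of a member of `J`. -/
def IsCanonicalFor {VH : Type} [Finite VH] (H : SimpleGraph VH) (F : GraphClass) : Prop :=
  ∃ J : GraphClass,
    (∀ (W : Type) [Finite W] (L : SimpleGraph W), J W L → Nonempty (L ↪g H)) ∧
    ∀ (V : Type) [Finite V] (G : SimpleGraph V),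
      F V G ↔ ∀ (W : Type) [Finite W] (L : SimpleGraph W), J W L → IndFree L G

/-- A really canonical `H`-freeness witnessing `k`-sequence: a witnessing sequence in
which each class is canonical and contains all cliques or all stable sets. -/
def IsReallyCanonicalSeq {VH : Type} [Finite VH] (H : SimpleGraph VH) (k : ℕ)
    (F : Fin k → GraphClass) : Prop :=
  IsWitnessingSeq H k F ∧
  ∀ i, IsCanonicalFor H (F i) ∧
    ((F i).ContainsAllCliques ∨ (F i).ContainsAllStables)

/-- `V(H)` can be partitioned into `c` cliques and `s` stable sets. -/
def HasCSPartition {VH : Type} (H : SimpleGraph VH) (c s : ℕ) : Prop :=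
  ∃ f : VH → (Fin c ⊕ Fin s),
    (∀ i : Fin c, H.IsClique {v | f v = Sum.inl i}) ∧
    (∀ j : Fin s, ∀ a, f a = Sum.inr j → ∀ b, f b = Sum.inr j → ¬ H.Adj a b)

/-- `r` is the witnessing partition number of `H`: the greatest `m` such that for some
`c + s = m` there is no partition of `V(H)` into `c` cliques and `s` stable sets. -/
def IsWpn {VH : Type} (H : SimpleGraph VH) (r : ℕ) : Prop :=
  IsGreatest {m | ∃ c s : ℕ, c + s = m ∧ ¬ HasCSPartition H c s} r

/-- `G` is `U(k)`-free: there are no disjoint vertex sets `S`, `T` such that the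
bipartite graph formed by the edges of `G` between `S` and `T` is a copy of `U(k)`,
the bipartite graph with parts of size `k` and `2^k` in which the neighbourhoods of
the second part enumerate all subsets of the first. -/
def UkFree {V : Type*} (k : ℕ) (G : SimpleGraph V) : Prop :=
  ¬ ∃ (f : Fin k ↪ V) (g : Finset (Fin k) ↪ V),
      (∀ (a : Fin k) (s : Finset (Fin k)), f a ≠ g s) ∧
      ∀ (a : Fin k) (s : Finset (Fin k)), G.Adj (f a) (g s) ↔ a ∈ s

namespace WPN
section Ramsey
open Finset Classical

theorem ramsey_aux (κ : Type) [Fintype κ] (N : ℕ) : ∃ R : ℕ, 0 < R ∧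
    ∀ (V : Type) (s : Finset V), R ≤ #s → ∀ c : V → V → κ, (∀ x y, c x y = c y x) →
      ∀ a : κ → ℕ, (∑ k, a k ≤ N) → ∃ k, ∃ t ⊆ s, #t = a k ∧
        ∀ x ∈ t, ∀ y ∈ t, x ≠ y → c x y = k := by
  induction N with
  | zero =>
    refine ⟨1, one_pos, fun V s hs c _ a ha => ?_⟩
    obtain ⟨x, _⟩ := Finset.card_pos.1 (by omega : 0 < #s)
    have : a (c x x) = 0 := by
      have := Finset.single_le_sum (f := a) (fun i _ => Nat.zero_le _) (mem_univ (c x x))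
      omega
    exact ⟨c x x, ∅, by simp, by simp [this], by simp⟩
  | succ N ih =>
    obtain ⟨R, hR0, hR⟩ := ih
    refine ⟨Fintype.card κ * R + 1, by omega, fun V s hs c hc a ha => ?_⟩
    obtain ⟨x, hx⟩ := Finset.card_pos.1 (by omega : 0 < #s)
    by_cases h0 : ∃ k, a k = 0
    · obtain ⟨k, hk⟩ := h0
      exact ⟨k, ∅, by simp, by simp [hk], by simp⟩
    push Not at h0
    have hcard : #(s.erase x) = #s - 1 := card_erase_of_mem hx
    have : ∃ k ∈ (univ : Finset κ), R ≤ #{y ∈ s.erase x | c x y = k} := by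
      apply Finset.exists_le_card_fiber_of_mul_le_card_of_maps_to
      · simp
      · exact ⟨c x x, mem_univ _⟩
      · rw [hcard, Finset.card_univ]; omega
    obtain ⟨k, -, hk⟩ := this
    have hsum : ∑ j, (Function.update a k (a k - 1)) j ≤ N := by
      rw [Finset.sum_update_of_mem (mem_univ k)]
      have h1 : ∑ j, a j = a k + ∑ j ∈ univ \ {k}, a j := by
        rw [← Finset.sum_update_of_mem (mem_univ k)]; simp
      have := h0 k
      omega
    obtain ⟨j, t, hts, htc, ht⟩ := hR V _ hk c hc _ hsum
    by_cases hj : j = k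
    · subst hj
      refine ⟨j, insert x t, ?_, ?_, ?_⟩
      · intro y hy
        rcases mem_insert.1 hy with rfl | hy
        · exact hx
        · exact mem_of_mem_erase (mem_filter.1 (hts hy)).1
      · rw [card_insert_of_notMem, htc]
        · simp; have := h0 j; omega
        · intro h; have := (mem_filter.1 (hts h)).1; simp at this
      · intro y hy z hz hyz
        rcases mem_insert.1 hy with hy | hy <;> rcases mem_insert.1 hz with hz | hz
        · exact absurd (hy.trans hz.symm) hyz
        · rw [hy]; exact (mem_filter.1 (hts hz)).2
        · rw [hc, hz]; exact (mem_filter.1 (hts hy)).2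
        · exact ht y hy z hz hyz
    · refine ⟨j, t, ?_, ?_, ht⟩
      · intro y hy
        exact mem_of_mem_erase (mem_filter.1 (hts hy)).1
      · rw [htc]; simp [hj]

theorem ramsey_multi (κ : Type) [Fintype κ] (m : ℕ) : ∃ R : ℕ, 0 < R ∧
    ∀ (V : Type) (s : Finset V), R ≤ #s → ∀ c : V → V → κ, (∀ x y, c x y = c y x) →
      ∃ k, ∃ t ⊆ s, #t = m ∧ ∀ x ∈ t, ∀ y ∈ t, x ≠ y → c x y = k := by
  obtain ⟨R, hR0, hR⟩ := ramsey_aux κ (Fintype.card κ * m)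
  exact ⟨R, hR0, fun V s hs c hc => hR V s hs c hc (fun _ => m) (by simp)⟩

/-- homogeneous tuple of type `τ` (`True` = clique, `False` = stable). -/
def Homog {VH V : Type} (G : SimpleGraph V) (τ : Prop) (z : VH → V) : Prop :=
  Function.Injective z ∧ ∀ x y, x ≠ y → (G.Adj (z x) (z y) ↔ τ)

theorem ramsey_homog (VH : Type) [Fintype VH] : ∃ R : ℕ, 0 < R ∧
    ∀ (V : Type) (G : SimpleGraph V) (s : Finset V), R ≤ #s →
      ∃ (τ : Prop) (z : VH → V), (∀ x, z x ∈ s) ∧ Homog G τ z := by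
  obtain ⟨R, hR0, hR⟩ := ramsey_multi Prop (Fintype.card VH)
  refine ⟨R, hR0, fun V G s hs => ?_⟩
  obtain ⟨k, t, hts, htc, ht⟩ := hR V s hs (fun x y => G.Adj x y)
    (fun x y => propext (G.adj_comm x y))
  have e : VH ≃ t := Fintype.equivOfCardEq (by simp [htc])
  refine ⟨k, fun x => e x, fun x => hts (e x).2, ?_, ?_⟩
  · intro x y hxy
    exact e.injective (Subtype.ext hxy)
  · intro x y hxy
    rw [ht _ (e x).2 _ (e y).2 (fun h => hxy (e.injective (Subtype.ext h)))]

theorem Homog.comp {VH VH' V : Type} {G : SimpleGraph V} {τ : Prop} {z : VH → V}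
    (hz : Homog G τ z) {e : VH' → VH} (he : Function.Injective e) : Homog G τ (z ∘ e) :=
  ⟨hz.1.comp he, fun x y hxy => hz.2 _ _ (fun h => hxy (he h))⟩

end Ramsey

section Template
open Classical

/-- any assignment of types to more than `wpn` classes yields a partition of `H`. -/
theorem cs_types {VH : Type} (H : SimpleGraph VH) (r : ℕ)
    (hr : IsWpn H r) (ι : Type) [Fintype ι] (hι : r < Fintype.card ι) (τ : ι → Prop) :
    ∃ f : VH → ι, ∀ x y, x ≠ y → f x = f y → (H.Adj x y ↔ τ (f x)) := by
  have h1 : HasCSPartition H (Fintype.card {i // τ i}) (Fintype.card {i // ¬ τ i}) := by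
    by_contra hcon
    have := hr.2 ⟨_, _, rfl, hcon⟩
    have h2 := Fintype.card_congr (Equiv.sumCompl τ)
    rw [Fintype.card_sum] at h2
    omega
  obtain ⟨f, hf1, hf2⟩ := h1
  let e1 := Fintype.equivFin {i // τ i}
  let e2 := Fintype.equivFin {i // ¬ τ i}
  refine ⟨fun x => Sum.elim (fun i => (e1.symm i : ι)) (fun i => (e2.symm i : ι)) (f x), ?_⟩
  intro x y hxy hfxy
  rcases hx : f x with i | i <;> rcases hy : f y with j | j <;> simp only [hx, hy, Sum.elim_inl, Sum.elim_inr] at hfxy ⊢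
  · have : i = j := e1.symm.injective (Subtype.ext hfxy)
    subst this
    have := hf1 i (show x ∈ {v | f v = Sum.inl i} from hx) (show y ∈ {v | f v = Sum.inl i} from hy) hxy
    simp [this, (e1.symm i).2]
  · exact absurd (e1.symm i).2 (hfxy ▸ (e2.symm j).2)
  · exact absurd (e1.symm j).2 (hfxy ▸ (e2.symm i).2)
  · have : i = j := e2.symm.injective (Subtype.ext hfxy)
    subst this
    have := hf2 i x hx y hy
    simp [this, (e2.symm i).2]

theorem template {VH : Type} (H : SimpleGraph VH) (r : ℕ)
    (hr : IsWpn H r) (ι : Type) [Fintype ι] (hι : r < Fintype.card ι) (τ : ι → Prop)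
    {V : Type} (G : SimpleGraph V) (z : ι → VH → V) (hz : ∀ i, Homog G (τ i) (z i))
    (hne : ∀ i j, i ≠ j → ∀ x y, z i x ≠ z j y)
    (hadj : ∀ i j, i ≠ j → ∀ x y, x ≠ y → (G.Adj (z i x) (z j y) ↔ H.Adj x y)) : ¬ IndFree H G := by
  obtain ⟨f, hf⟩ := cs_types H r hr ι hι τ
  simp only [IndFree, not_not]
  refine ⟨⟨⟨fun x => z (f x) x, ?_⟩, ?_⟩⟩
  · intro x y hxy
    change z (f x) x = z (f y) y at hxy
    by_cases hfe : f x = f y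
    · rw [hfe] at hxy
      exact (hz _).1 hxy
    · exact absurd hxy (hne _ _ hfe _ _)
  · intro x y
    change G.Adj (z (f x) x) (z (f y) y) ↔ H.Adj x y
    by_cases hxy : x = y
    · subst hxy; simp
    by_cases hfe : f x = f y
    · rw [hf x y hxy hfe, hfe]
      exact (hz _).2 _ _ hxy
    · exact hadj _ _ hfe _ _ hxy
end Template
end WPN

namespace WPN
section Counting
open Finset Classical

/-- classical filter. -/
noncomputable def fil {α : Type*} (s : Finset α) (p : α → Prop) : Finset α := s.filter p

theorem mem_fil {α : Type*} {s : Finset α} {p : α → Prop} {x : α} : x ∈ fil s p ↔ x ∈ s ∧ p x := by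
  simp [fil]

theorem fil_subset {α : Type*} {s : Finset α} {p : α → Prop} : fil s p ⊆ s := fun x hx => (mem_fil.1 hx).1

/-- indicator. -/
noncomputable def ind (p : Prop) : ℝ := if p then 1 else 0

theorem ind_and (p q : Prop) : ind (p ∧ q) = ind p * ind q := by
  unfold ind; by_cases h : p <;> by_cases h' : q <;> simp [h, h']

theorem card_fil {α : Type*} (s : Finset α) (p : α → Prop) :
    (#(fil s p) : ℝ) = ∑ x ∈ s, ind (p x) := by
  unfold ind; rw [fil, Finset.card_filter]; push_cast; rfl

theorem fil_congr {α : Type*} {s : Finset α} {p q : α → Prop} (h : ∀ x ∈ s, p x ↔ q x) :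
    fil s p = fil s q := by
  ext x; simp only [mem_fil]; constructor
  · rintro ⟨a, b⟩; exact ⟨a, (h x a).1 b⟩
  · rintro ⟨a, b⟩; exact ⟨a, (h x a).2 b⟩

theorem avg_update {S V : Type} [Fintype S] [DecidableEq S] (C : S → Finset V) (p : S) (F : (S → V) → ℝ) :
    (#(C p) : ℝ) * ∑ x ∈ Fintype.piFinset C, F x
      = ∑ x ∈ Fintype.piFinset C, ∑ a ∈ C p, F (Function.update x p a) := by
  rw [← Finset.sum_product', mul_comm, Finset.sum_mul]
  have : ∀ x ∈ Fintype.piFinset C, F x * (#(C p) : ℝ) = ∑ a ∈ C p, F x := by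
    intro x _; simp [mul_comm]
  rw [Finset.sum_congr rfl this, ← Finset.sum_product']
  refine Finset.sum_nbij' (fun q => (Function.update q.1 p q.2, q.1 p))
    (fun q => (Function.update q.1 p q.2, q.1 p)) ?_ ?_ ?_ ?_ ?_
  · rintro ⟨x, a⟩ hq
    simp only [mem_product, Fintype.mem_piFinset] at hq ⊢
    refine ⟨fun s => ?_, hq.1 p⟩
    by_cases h : s = p
    · subst h; simpa using hq.2
    · simpa [h] using hq.1 s
  · rintro ⟨x, a⟩ hq
    simp only [mem_product, Fintype.mem_piFinset] at hq ⊢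
    refine ⟨fun s => ?_, hq.1 p⟩
    by_cases h : s = p
    · subst h; simpa using hq.2
    · simpa [h] using hq.1 s
  · rintro ⟨x, a⟩ hq; simp
  · rintro ⟨x, a⟩ hq; simp
  · rintro ⟨x, a⟩ hq; simp

def LowReg {V : Type} (ψ : V → V → Prop) (A B : Finset V) (η ε : ℝ) : Prop :=
  ∀ A' ⊆ A, ∀ B' ⊆ B, η * #A' * #B' - ε * #A * #B ≤ (#(fil (A' ×ˢ B') (fun q => ψ q.1 q.2)) : ℝ)

def Rect {S V : Type} [DecidableEq S] (Φ : (S → V) → Prop) (s s' : S) : Prop :=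
  ∀ x, ∃ α β : V → Prop, ∀ a b, Φ (Function.update (Function.update x s a) s' b) ↔ α a ∧ β b

theorem Rect.and {S V : Type} [DecidableEq S] {Φ Ψ : (S → V) → Prop} {s s' : S} (h1 : Rect Φ s s')
    (h2 : Rect Ψ s s') : Rect (fun x => Φ x ∧ Ψ x) s s' := by
  intro x
  obtain ⟨α, β, h⟩ := h1 x
  obtain ⟨α', β', h'⟩ := h2 x
  exact ⟨fun a => α a ∧ α' a, fun b => β b ∧ β' b, fun a b => by
    have h1 := h a b
    have h2 := h' a b
    tauto⟩

theorem rect_pair {S V : Type} [DecidableEq S] {ψ : V → V → Prop} {s s' u u' : S} (hs : s ≠ s')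
    (h1 : ¬ (u = s ∧ u' = s')) (h2 : ¬ (u = s' ∧ u' = s)) (huu : u ≠ u') :
    Rect (fun x : S → V => ψ (x u) (x u')) s s' := by
  intro x
  by_cases hus : u = s
  · subst hus
    have : u' ≠ s' := fun h => h1 ⟨rfl, h⟩
    exact ⟨fun a => ψ a (x u'), fun _ => True, fun a b => by simp [hs, this, huu.symm]⟩
  by_cases hus' : u = s'
  · subst hus'
    have : u' ≠ s := fun h => h2 ⟨rfl, h⟩
    exact ⟨fun a => True, fun b => ψ b (x u'), fun a b => by simp [this, huu.symm]⟩
  by_cases hv : u' = s'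
  · subst hv
    exact ⟨fun a => True, fun b => ψ (x u) b, fun a b => by simp [hus, hus']⟩
  by_cases hv' : u' = s
  · subst hv'
    exact ⟨fun a => ψ (x u) a, fun b => True, fun a b => by simp [hus, hus', hv]⟩
  exact ⟨fun a => ψ (x u) (x u'), fun b => True, fun a b => by simp [hus, hus', hv, hv']⟩

theorem count_step {S V : Type} [Fintype S] [DecidableEq S] (C : S → Finset V) (Φ : (S → V) → Prop)
    (ψ : V → V → Prop) (s s' : S) (hs : s ≠ s') (η ε : ℝ) (hΦ : Rect Φ s s')
    (hψ : LowReg ψ (C s) (C s') η ε) :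
    η * (#(fil (Fintype.piFinset C) (fun x => Φ x)) : ℝ) - ε * ∏ u, (#(C u) : ℝ)
      ≤ (#(fil (Fintype.piFinset C) (fun x => Φ x ∧ ψ (x s) (x s'))) : ℝ) := by
  have key : ∀ F : (S → V) → ℝ, (#(C s) : ℝ) * (#(C s') : ℝ) * ∑ x ∈ Fintype.piFinset C, F x
      = ∑ x ∈ Fintype.piFinset C, ∑ a ∈ C s, ∑ b ∈ C s',
          F (Function.update (Function.update x s a) s' b) := by
    intro F
    rw [mul_assoc, avg_update C s' F, avg_update C s]
  have hpi : (∏ u, (#(C u) : ℝ)) = #(Fintype.piFinset C) := by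
    rw [Fintype.card_piFinset]; push_cast; rfl
  by_cases h0 : (#(C s) : ℝ) * (#(C s') : ℝ) = 0
  · have hP : #(Fintype.piFinset C) = 0 := by
      rw [Fintype.card_piFinset]
      rcases mul_eq_zero.1 h0 with h | h
      · exact Finset.prod_eq_zero (mem_univ s) (by exact_mod_cast h)
      · exact Finset.prod_eq_zero (mem_univ s') (by exact_mod_cast h)
    rw [hpi, hP]
    rw [Finset.card_eq_zero] at hP
    simp [hP, fil]
  have hpos : 0 < (#(C s) : ℝ) * (#(C s') : ℝ) := lt_of_le_of_ne (by positivity) (Ne.symm h0)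
  have e1 : ∀ (Ψ : (S → V) → Prop), (#(fil (Fintype.piFinset C) (fun x => Ψ x)) : ℝ)
      = ∑ x ∈ Fintype.piFinset C, ind (Ψ x) := by
    intro Ψ; exact card_fil _ _
  have main : (#(C s) : ℝ) * (#(C s') : ℝ) * (η * (#(fil (Fintype.piFinset C) (fun x => Φ x)) : ℝ) - ε * ∏ u, (#(C u) : ℝ))
      ≤ (#(C s) : ℝ) * (#(C s') : ℝ) * (#(fil (Fintype.piFinset C) (fun x => Φ x ∧ ψ (x s) (x s'))) : ℝ) := by
    have l1 : (#(C s) : ℝ) * (#(C s') : ℝ) * (η * (#(fil (Fintype.piFinset C) (fun x => Φ x)) : ℝ) - ε * ∏ u, (#(C u) : ℝ))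
      = η * ((#(C s) : ℝ) * (#(C s') : ℝ) * (#(fil (Fintype.piFinset C) (fun x => Φ x)) : ℝ))
        - (#(Fintype.piFinset C) : ℝ) * (ε * #(C s) * #(C s')) := by
      rw [hpi]; ring
    rw [l1, e1, e1, key, key, Finset.mul_sum, ← nsmul_eq_mul, ← Finset.sum_const,
      ← Finset.sum_sub_distrib]
    apply Finset.sum_le_sum
    intro x _
    obtain ⟨α, β, h⟩ := hΦ x
    have h1 := hψ (fil (C s) α) fil_subset (fil (C s') β) fil_subset
    have e2 : ∑ a ∈ C s, ∑ b ∈ C s', ind (Φ (Function.update (Function.update x s a) s' b))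
        = #(fil (C s) (fun a => α a)) * #(fil (C s') (fun b => β b)) := by
      rw [card_fil, card_fil, Finset.sum_mul_sum]
      refine sum_congr rfl fun a _ => sum_congr rfl fun b _ => ?_
      rw [h, ind_and]
    have e3 : ∑ a ∈ C s, ∑ b ∈ C s', ind (Φ (Function.update (Function.update x s a) s' b) ∧
          ψ (Function.update (Function.update x s a) s' b s) (Function.update (Function.update x s a) s' b s'))
        = #(fil (fil (C s) α ×ˢ fil (C s') β) (fun q => ψ q.1 q.2)) := by
      have hre : fil (fil (C s) α ×ˢ fil (C s') β) (fun q => ψ q.1 q.2)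
          = fil (C s ×ˢ C s') (fun q => (α q.1 ∧ β q.2) ∧ ψ q.1 q.2) := by
        ext q; simp only [mem_fil, mem_product]; tauto
      rw [hre, card_fil, Finset.sum_product]
      refine sum_congr rfl fun a _ => sum_congr rfl fun b _ => ?_
      simp only [h]
      simp [hs]
    rw [e2, e3]
    linarith
  exact le_of_mul_le_mul_left main hpos

theorem arith_step (η A B X : ℝ) (k : ℕ) (hη : 0 ≤ η) (hη1 : η ≤ 1)
    (hX : 0 ≤ X) (h : η ^ k * A - k * X ≤ B) :
    η ^ (k + 1) * A - ((k + 1 : ℕ) : ℝ) * X ≤ η * B - X := by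
  have hc : 0 ≤ (k : ℝ) * X := by positivity
  rw [pow_succ]
  push_cast
  nlinarith [mul_le_mul_of_nonneg_left h hη, mul_nonneg (sub_nonneg.2 hη1) hc]

theorem count_iter {S V : Type} [Fintype S] [DecidableEq S] (C : S → Finset V) (Φ : (S → V) → Prop)
    (ψ : S → S → V → V → Prop) (η ε : ℝ) (hη : 0 ≤ η) (hη1 : η ≤ 1) (hε : 0 ≤ ε)
    (E : Finset (S × S)) (hE : ∀ e ∈ E, e.1 ≠ e.2) (hE2 : ∀ e ∈ E, (e.2, e.1) ∉ E)
    (hΦ : ∀ e ∈ E, Rect Φ e.1 e.2)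
    (hψ : ∀ e ∈ E, LowReg (ψ e.1 e.2) (C e.1) (C e.2) η ε) :
    η ^ #E * (#(fil (Fintype.piFinset C) (fun x => Φ x)) : ℝ) - #E * (ε * ∏ u, (#(C u) : ℝ))
      ≤ (#(fil (Fintype.piFinset C) (fun x => Φ x ∧ ∀ e ∈ E, ψ e.1 e.2 (x e.1) (x e.2))) : ℝ) := by
  have hgen : ∀ E' : Finset (S × S), E' ⊆ E → ((∀ e ∈ E, e ∉ E' →
      Rect (fun x => Φ x ∧ ∀ e ∈ E', ψ e.1 e.2 (x e.1) (x e.2)) e.1 e.2) ∧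
      η ^ #E' * (#(fil (Fintype.piFinset C) (fun x => Φ x)) : ℝ) - #E' * (ε * ∏ u, (#(C u) : ℝ))
      ≤ (#(fil (Fintype.piFinset C) (fun x => Φ x ∧ ∀ e ∈ E', ψ e.1 e.2 (x e.1) (x e.2))) : ℝ)) := by
    intro E'
    induction E' using Finset.induction_on with
    | empty =>
      intro _
      constructor
      · intro e he _
        simpa using hΦ e he
      · simp
    | insert e0 E' he0 ih =>
      intro hsub
      have he0E : e0 ∈ E := hsub (mem_insert_self _ _)
      obtain ⟨ih1, ih2⟩ := ih (fun e he => hsub (mem_insert_of_mem he))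
      have heq : ∀ x : S → V, (Φ x ∧ ∀ e ∈ insert e0 E', ψ e.1 e.2 (x e.1) (x e.2)) ↔
          ((Φ x ∧ ∀ e ∈ E', ψ e.1 e.2 (x e.1) (x e.2)) ∧ ψ e0.1 e0.2 (x e0.1) (x e0.2)) := by
        intro x; simp only [Finset.forall_mem_insert]; tauto
      constructor
      · intro e he hen
        simp only [heq]
        refine Rect.and (ih1 e he (fun h => hen (mem_insert_of_mem h))) ?_
        refine rect_pair (hE e he) ?_ ?_ (hE e0 he0E)
        · rintro ⟨h1, h2⟩
          exact hen (by rw [show e = e0 from (Prod.ext h1.symm h2.symm)]; exact mem_insert_self _ _)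
        · rintro ⟨h1, h2⟩
          apply hE2 e0 he0E
          rw [h1, h2]; exact he
      · have hstep := count_step C _ (ψ e0.1 e0.2) e0.1 e0.2 (hE e0 he0E) η ε (ih1 e0 he0E he0) (hψ e0 he0E)
        have hce : (#(fil (Fintype.piFinset C) (fun x => Φ x ∧ ∀ e ∈ insert e0 E', ψ e.1 e.2 (x e.1) (x e.2))) : ℝ)
            = #(fil (Fintype.piFinset C) (fun x => (Φ x ∧ ∀ e ∈ E', ψ e.1 e.2 (x e.1) (x e.2)) ∧ ψ e0.1 e0.2 (x e0.1) (x e0.2))) := by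
          congr 2; exact fil_congr (fun x _ => heq x)
        rw [hce]
        refine le_trans ?_ hstep
        rw [card_insert_of_notMem he0]
        have hX : 0 ≤ ε * ∏ u, (#(C u) : ℝ) :=
          mul_nonneg hε (Finset.prod_nonneg fun _ _ => Nat.cast_nonneg _)
        exact arith_step η _ _ _ _ hη hη1 hX ih2
  exact (hgen E Subset.rfl).2

theorem count_exists {S V : Type} [Fintype S] [DecidableEq S] (C : S → Finset V) (Φ : (S → V) → Prop)
    (Act : S → S → Prop) (hAct : ∀ s s', Act s s' → Act s' s) (hirr : ∀ s, ¬ Act s s)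
    (ψ : S → S → V → V → Prop) (hsym : ∀ s s' a b, ψ s s' a b → ψ s' s b a)
    (η ε c : ℝ) (hη : 0 ≤ η) (hη1 : η ≤ 1) (hε : 0 ≤ ε) (hc : 0 ≤ c)
    (hΦ : ∀ s s', Act s s' → Rect Φ s s')
    (hψ : ∀ s s', Act s s' → LowReg (ψ s s') (C s) (C s') η ε)
    (hpos : ∀ s, (C s).Nonempty)
    (hcard : c * ∏ u, (#(C u) : ℝ) ≤ (#(fil (Fintype.piFinset C) (fun x => Φ x)) : ℝ))
    (hnum : (Fintype.card S : ℝ) ^ 2 * ε < η ^ (Fintype.card S ^ 2) * c) :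
    ∃ x, (∀ s, x s ∈ C s) ∧ Φ x ∧ ∀ s s', Act s s' → ψ s s' (x s) (x s') := by
  let ord := Fintype.equivFin S
  let E : Finset (S × S) := {e | Act e.1 e.2 ∧ ord e.1 < ord e.2}
  have hmem : ∀ e, e ∈ E ↔ Act e.1 e.2 ∧ ord e.1 < ord e.2 := by intro e; simp [E]
  have h := count_iter C Φ ψ η ε hη hη1 hε E (fun e he h => by
      have := ((hmem e).1 he).1; rw [h] at this; exact hirr _ this)
    (fun e he h => by
      have h1 := ((hmem e).1 he).2; have h2 := ((hmem _).1 h).2; exact absurd h1 (lt_asymm h2))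
    (fun e he => hΦ _ _ ((hmem e).1 he).1) (fun e he => hψ _ _ ((hmem e).1 he).1)
  have hEc : #E ≤ Fintype.card S ^ 2 := by
    calc #E ≤ #(univ : Finset (S × S)) := card_le_univ _
      _ = _ := by rw [card_univ, Fintype.card_prod, sq]
  have hP : 0 < ∏ u, (#(C u) : ℝ) := Finset.prod_pos (fun s _ => by exact_mod_cast (hpos s).card_pos)
  have h2 : 0 < η ^ #E * (#(fil (Fintype.piFinset C) (fun x => Φ x)) : ℝ) - #E * (ε * ∏ u, (#(C u) : ℝ)) := by
    have a1 : η ^ (Fintype.card S ^ 2) * (c * ∏ u, (#(C u) : ℝ)) ≤ η ^ #E * (#(fil (Fintype.piFinset C) (fun x => Φ x)) : ℝ) :=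
      mul_le_mul (pow_le_pow_of_le_one hη hη1 hEc) hcard (by positivity) (by positivity)
    have a2 : (#E : ℝ) * (ε * ∏ u, (#(C u) : ℝ)) ≤ (Fintype.card S : ℝ) ^ 2 * (ε * ∏ u, (#(C u) : ℝ)) := by
      apply mul_le_mul_of_nonneg_right _ (by positivity)
      exact_mod_cast hEc
    nlinarith [mul_lt_mul_of_pos_right hnum hP]
  have h3 := lt_of_lt_of_le h2 h
  have h4 : 0 < #(fil (Fintype.piFinset C) (fun x => Φ x ∧ ∀ e ∈ E, ψ e.1 e.2 (x e.1) (x e.2))) := by exact_mod_cast h3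
  obtain ⟨x, hx⟩ := card_pos.1 h4
  simp only [mem_fil, Fintype.mem_piFinset] at hx
  refine ⟨x, hx.1, hx.2.1, fun s s' ha => ?_⟩
  rcases lt_trichotomy (ord s) (ord s') with hl | hl | hl
  · exact hx.2.2 (s, s') ((hmem _).2 ⟨ha, hl⟩)
  · have := ord.injective hl; subst this; exact absurd ha (hirr s)
  · exact hsym _ _ _ _ (hx.2.2 (s', s) ((hmem _).2 ⟨hAct _ _ ha, hl⟩))

end Counting
end WPN

namespace WPN
section Supersat
open Finset Classical

theorem supersat (VH : Type) [Fintype VH] : ∃ c : ℝ, 0 < c ∧ ∃ n0 : ℕ, 0 < n0 ∧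
    ∀ (V : Type) (G : SimpleGraph V) (C : Finset V), n0 ≤ #C →
    ∃ τ : Prop, c * (#C : ℝ) ^ (Fintype.card VH)
      ≤ #(fil (Fintype.piFinset fun _ : VH => C) (Homog G τ)) := by
  obtain ⟨R, hR0, hR⟩ := ramsey_homog VH
  set h := Fintype.card VH with hh
  refine ⟨1 / (2 ^ (R + 1) * R ^ h), by positivity, 2 * R, by omega, ?_⟩
  intro V G C hC
  set N := #C with hN
  have hN0 : 0 < N := by omega
  -- choice for each embedding
  have hch : ∀ y : Fin R ↪ C, ∃ p : Bool × (VH → Fin R), Function.Injective p.2 ∧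
      Homog G (p.1 = true) (fun x => (y (p.2 x) : V)) := by
    intro y
    have hs : R ≤ #((univ : Finset (Fin R)).image (fun j => (y j : V))) := by
      rw [card_image_of_injective _ (fun a b hab => y.injective (Subtype.val_injective hab))]; simp
    obtain ⟨τ, z, hz, hzh⟩ := hR V G _ hs
    have : ∀ x, ∃ j, (y j : V) = z x := by
      intro x
      have := hz x
      simpa using this
    choose ι hι using this
    refine ⟨(decide τ, ι), ?_, ?_⟩
    · intro a b hab
      apply hzh.1
      have : ι a = ι b := hab
      rw [← hι, ← hι, this]
    · have : (fun x => (y (ι x) : V)) = z := funext hι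
      simpa [this] using hzh
  choose p hp1 hp2 using hch
  let Hc : Bool → ℕ := fun τ => #(fil (Fintype.piFinset fun _ : VH => C) (Homog G (τ = true)))
  have hfib : ∀ q : Bool × (VH → Fin R), #{y : Fin R ↪ C | p y = q} ≤ Hc q.1 * N ^ (R - h) := by
    rintro ⟨τ, ι⟩
    by_cases hne : ({y : Fin R ↪ C | p y = (τ, ι)} : Finset _).Nonempty
    swap
    · rw [not_nonempty_iff_eq_empty.1 hne]; simp
    obtain ⟨y0, hy0⟩ := hne
    have hy0' : p y0 = (τ, ι) := by simpa using hy0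
    have hinj : Function.Injective ι := by have := hp1 y0; rw [hy0'] at this; exact this
    have hcc : Fintype.card {j : Fin R // j ∉ Set.range ι} = R - h := by
      rw [Fintype.card_subtype_compl]
      have : Fintype.card {x // x ∈ Set.range ι} = h := by
        exact (Fintype.card_congr (Equiv.ofInjective ι hinj)).symm
      rw [this, Fintype.card_fin]
    let T := (fil (Fintype.piFinset fun _ : VH => C) (Homog G (τ = true))) ×ˢ
      (univ : Finset ({j : Fin R // j ∉ Set.range ι} → C))
    have hT : #T = Hc τ * N ^ (R - h) := by
      simp only [T, card_product, card_univ, Fintype.card_fun, hcc, Fintype.card_coe]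
      rfl
    rw [← hT]
    apply card_le_card_of_injOn (fun y => (fun x => (y (ι x) : V), fun j => y j.1))
    · intro y hy
      have hy' : p y = (τ, ι) := by simpa using hy
      simp only [T, coe_product, Set.mem_prod, mem_coe, mem_fil, Fintype.mem_piFinset, mem_univ, and_true]
      refine ⟨fun x => (y (ι x)).2, ?_⟩
      have := hp2 y
      rw [hy'] at this
      exact this
    · intro y hy y' hy' hyy
      simp only [Prod.mk.injEq] at hyy
      ext j
      by_cases hj : j ∈ Set.range ι
      · obtain ⟨x, rfl⟩ := hj
        exact congrFun hyy.1 x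
      · exact congrArg Subtype.val (congrFun hyy.2 ⟨j, hj⟩)
  have htot : N.descFactorial R ≤ R ^ h * ((Hc true + Hc false) * N ^ (R - h)) := by
    have e1 : Fintype.card (Fin R ↪ C) = N.descFactorial R := by
      rw [Fintype.card_embedding_eq]; simp [hN]
    rw [← e1, ← card_univ, card_eq_sum_card_fiberwise (f := p) (t := univ) (fun _ _ => mem_univ _)]
    refine (sum_le_sum (fun q _ => hfib q)).trans ?_
    rw [Fintype.sum_prod_type]
    simp [Finset.sum_const, ← hh]
    apply le_of_eq; ring
  have hRN : h ≤ R ∨ (Hc true + Hc false) * N ^ (R - h) = 0 := by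
    by_cases hle : h ≤ R
    · exact Or.inl hle
    right
    exfalso
    have : Nonempty (Fin R ↪ C) := by
      rw [Function.Embedding.nonempty_iff_card_le]; simp; omega
    obtain ⟨y⟩ := this
    have := Fintype.card_le_of_injective _ (hp1 y)
    simp at this; omega
  have hd : ((N : ℝ) / 2) ^ R ≤ N.descFactorial R := by
    have := Nat.pow_sub_le_descFactorial N R
    have h2 : ((N + 1 - R : ℕ) : ℝ) ^ R ≤ N.descFactorial R := by exact_mod_cast this
    refine le_trans ?_ h2
    apply pow_le_pow_left₀ (by positivity)
    have : N ≤ 2 * (N + 1 - R) := by omega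
    have : (N : ℝ) ≤ 2 * ((N + 1 - R : ℕ) : ℝ) := by exact_mod_cast this
    linarith
  have hNR : (0:ℝ) < N := by exact_mod_cast hN0
  have hmain : (N : ℝ) ^ h / (2 ^ R * R ^ h) ≤ (Hc true + Hc false : ℕ) := by
    rcases hRN with hle | h0
    · have h3 : ((N : ℝ) / 2) ^ R ≤ R ^ h * ((Hc true + Hc false : ℕ) * N ^ (R - h)) :=
        hd.trans (by exact_mod_cast htot)
      rw [div_le_iff₀ (by positivity)]
      have h4 : (N : ℝ) ^ R = N ^ h * N ^ (R - h) := by rw [← pow_add]; congr 1; omega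
      rw [div_pow, h4, div_le_iff₀ (by positivity)] at h3
      have h5 : (0:ℝ) < (N : ℝ) ^ (R - h) := by positivity
      refine le_of_mul_le_mul_right ?_ h5
      calc (N : ℝ) ^ h * N ^ (R - h) ≤ _ := h3
        _ = _ := by ring
    · rw [h0] at htot
      have : 0 < N.descFactorial R := Nat.descFactorial_pos.2 (by omega)
      omega
  have hsel : ∃ τ : Bool, (Hc true + Hc false : ℕ) ≤ 2 * Hc τ := by
    rcases le_total (Hc true) (Hc false) with h1 | h1
    · exact ⟨false, by omega⟩
    · exact ⟨true, by omega⟩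
  obtain ⟨τ, hτ⟩ := hsel
  refine ⟨τ = true, ?_⟩
  have h6 : ((Hc true + Hc false : ℕ) : ℝ) ≤ 2 * Hc τ := by exact_mod_cast hτ
  change _ ≤ (Hc τ : ℝ)
  have h7 : 1 / (2 ^ (R + 1) * (R:ℝ) ^ h) * (N : ℝ) ^ h = (N : ℝ) ^ h / (2 ^ R * R ^ h) / 2 := by
    rw [pow_succ]; field_simp
  rw [h7]; linarith

theorem grey_free {VH : Type} [Fintype VH] (H : SimpleGraph VH) (r : ℕ) (hr : IsWpn H r)
    (η : ℝ) (hη : 0 < η) (hη1 : η ≤ 1) : ∃ ε : ℝ, 0 < ε ∧ ∃ n0 : ℕ, 0 < n0 ∧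
    ∀ (V : Type) (G : SimpleGraph V), IndFree H G → ∀ C : Fin (r + 1) → Finset V,
      (∀ i j, i ≠ j → Disjoint (C i) (C j)) → (∀ i, n0 ≤ #(C i)) →
      (∀ i j, i ≠ j → LowReg G.Adj (C i) (C j) η ε ∧
        LowReg (fun a b => ¬ G.Adj a b) (C i) (C j) η ε) → False := by
  obtain ⟨c, hc, n0, hn0, hss⟩ := supersat VH
  set N := Fintype.card (Fin (r + 1) × VH) ^ 2 with hN
  refine ⟨η ^ N * c ^ (r + 1) / (N + 1), by positivity, n0, hn0, ?_⟩
  intro V G hG C hdisj hcard hreg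
  choose τ hτ using fun i => hss V G (C i) (hcard i)
  let Φ : (Fin (r + 1) × VH → V) → Prop := fun x => ∀ i, Homog G (τ i) (fun y => x (i, y))
  have hex := count_exists (S := Fin (r + 1) × VH) (V := V) (fun s => C s.1) Φ
    (fun s s' => s.1 ≠ s'.1 ∧ s.2 ≠ s'.2) (fun s s' h => ⟨h.1.symm, h.2.symm⟩) (fun s h => h.1 rfl)
    (fun s s' a b => G.Adj a b ↔ H.Adj s.2 s'.2)
    (fun s s' a b h => by rw [G.adj_comm b a, H.adj_comm s'.2 s.2]; exact h)
    η (η ^ N * c ^ (r + 1) / (N + 1)) (c ^ (r + 1)) hη.le hη1 (by positivity) (by positivity)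
    ?_ ?_ ?_ ?_ ?_
  · obtain ⟨x, hx, hΦ, hadj⟩ := hex
    refine template H r hr (Fin (r + 1)) (by simp) τ G (fun i y => x (i, y)) hΦ ?_ ?_ hG
    · intro i j hij a b hab
      have h1 := hx (i, a)
      have h2 := hx (j, b)
      have hab' : x (i, a) = x (j, b) := hab
      rw [hab'] at h1
      exact Finset.disjoint_left.1 (hdisj i j hij) h1 h2
    · intro i j hij a b hab
      exact hadj (i, a) (j, b) ⟨hij, hab⟩
  · rintro ⟨i, a⟩ ⟨j, b⟩ ⟨hij, hab⟩ x
    simp only at hij hab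
    refine ⟨fun u => ∀ i', i' ≠ j → Homog G (τ i') (fun y => Function.update x (i, a) u (i', y)),
      fun v => Homog G (τ j) (fun y => Function.update x (j, b) v (j, y)), ?_⟩
    intro u v
    have e1 : ∀ i', i' ≠ j → (fun y => Function.update (Function.update x (i, a) u) (j, b) v (i', y))
        = (fun y => Function.update x (i, a) u (i', y)) := by
      intro i' hi'
      funext y
      rw [Function.update_of_ne]
      simp [hi']
    have e2 : (fun y => Function.update (Function.update x (i, a) u) (j, b) v (j, y))
        = (fun y => Function.update x (j, b) v (j, y)) := by
      funext y
      by_cases hy : y = b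
      · subst hy; simp
      · rw [Function.update_of_ne (by simp [hy]), Function.update_of_ne (by simp [hij.symm]),
          Function.update_of_ne (by simp [hy])]
    constructor
    · intro h
      refine ⟨fun i' hi' => ?_, ?_⟩
      · have := h i'; rwa [e1 i' hi'] at this
      · have := h j; rwa [e2] at this
    · rintro ⟨h1, h2⟩ i'
      by_cases hi' : i' = j
      · subst hi'; rw [e2]; exact h2
      · rw [e1 i' hi']; exact h1 i' hi'
  · rintro ⟨i, a⟩ ⟨j, b⟩ ⟨hij, hab⟩
    simp only at hij hab
    by_cases hH : H.Adj a b
    · simpa [hH] using (hreg i j hij).1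
    · simpa [hH] using (hreg i j hij).2
  · rintro ⟨i, a⟩
    exact card_pos.1 (lt_of_lt_of_le hn0 (hcard i))
  · have h1 : (∏ i, #(fil (Fintype.piFinset fun _ : VH => C i) (Homog G (τ i))))
        ≤ #(fil (Fintype.piFinset fun s : Fin (r + 1) × VH => C s.1) (fun x => Φ x)) := by
      rw [← Fintype.card_piFinset]
      apply card_le_card_of_injOn (fun z s => z s.1 s.2)
      · intro z hz
        have hz' : ∀ i, (∀ a, z i a ∈ C i) ∧ Homog G (τ i) (z i) := by
          simpa [mem_fil] using hz
        simp only [mem_coe, mem_fil, Fintype.mem_piFinset]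
        exact ⟨fun s => (hz' s.1).1 s.2, fun i => (hz' i).2⟩
      · intro z _ z' _ h
        funext i y
        exact congrFun h (i, y)
    have h2 : ∏ i, (c * (#(C i) : ℝ) ^ (Fintype.card VH))
        ≤ ∏ i, (#(fil (Fintype.piFinset fun _ : VH => C i) (Homog G (τ i))) : ℝ) :=
      prod_le_prod (fun i _ => by positivity) (fun i _ => hτ i)
    have h3 : c ^ (r + 1) * ∏ u : Fin (r + 1) × VH, (#(C u.1) : ℝ)
        = ∏ i, (c * (#(C i) : ℝ) ^ (Fintype.card VH)) := by
      rw [prod_mul_distrib, Fintype.prod_prod_type]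
      simp
    rw [h3]
    exact h2.trans (by exact_mod_cast h1)
  · have : ((Fintype.card (Fin (r + 1) × VH) : ℝ)) ^ 2 = N := by rw [hN]; push_cast; rfl
    rw [this]
    have hp : 0 < η ^ N * c ^ (r + 1) := by positivity
    rw [mul_div_assoc', div_lt_iff₀ (by positivity)]
    nlinarith
end Supersat
end WPN

namespace WPN
section Furedi
open Finset Classical

theorem ind_nonneg (p : Prop) : 0 ≤ ind p := by unfold ind; split_ifs <;> norm_num
theorem ind_le_one (p : Prop) : ind p ≤ 1 := by unfold ind; split_ifs <;> norm_num
theorem ind_true {p : Prop} (h : p) : ind p = 1 := by unfold ind; simp [h]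
theorem ind_false {p : Prop} (h : ¬ p) : ind p = 0 := by unfold ind; simp [h]
theorem ind_not (p : Prop) : ind (¬ p) = 1 - ind p := by
  by_cases h : p <;> simp [ind, h]

theorem furedi_aux {V : Type} (R : SimpleGraph V) : ∀ (r : ℕ) (A : Finset V),
    (¬ ∃ K ⊆ A, R.IsNClique (r + 1) K) → ∃ cl : V → ℕ, (∀ v ∈ A, cl v < r) ∧
    ∑ u ∈ A, ∑ v ∈ A, (ind (R.Adj u v) + ind (R.Adj u v ∧ cl u = cl v) - ind (cl u ≠ cl v)) ≤ 0 := by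
  intro r
  induction r with
  | zero =>
    intro A hA
    have : A = ∅ := by
      by_contra hne
      obtain ⟨v, hv⟩ := nonempty_iff_ne_empty.2 hne
      exact hA ⟨{v}, by simpa using hv, by simp [isNClique_iff]⟩
    subst this
    exact ⟨fun _ => 0, by simp, by simp⟩
  | succ r ih =>
    intro A hA
    by_cases hne : A.Nonempty
    swap
    · rw [not_nonempty_iff_eq_empty.1 hne]; exact ⟨fun _ => 0, by simp, by simp⟩
    obtain ⟨v1, hv1, hmax⟩ := exists_max_image A (fun u => ∑ v ∈ A, ind (R.Adj u v)) hne
    set A' := A.filter (fun v => R.Adj v1 v) with hA'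
    set V1 := A.filter (fun v => ¬ R.Adj v1 v) with hV1
    obtain ⟨cl', hcl', hsum'⟩ := ih A' (by
      rintro ⟨K, hK, hKc⟩
      apply hA
      refine ⟨insert v1 K, ?_, ?_⟩
      · intro x hx
        rcases mem_insert.1 hx with rfl | hx
        · exact hv1
        · exact (mem_filter.1 (hK hx)).1
      · exact hKc.insert (fun b hb => (mem_filter.1 (hK hb)).2))
    have hmA' : ∀ v, v ∈ A' ↔ v ∈ A ∧ R.Adj v1 v := fun v => by simp [hA']
    have hmV1 : ∀ v, v ∈ V1 ↔ v ∈ A ∧ ¬ R.Adj v1 v := fun v => by simp [hV1]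
    let cl : V → ℕ := fun v => if R.Adj v1 v then cl' v else r
    have hc1 : ∀ v ∈ A', cl v = cl' v := fun v hv => by simp [cl, ((hmA' v).1 hv).2]
    have hc2 : ∀ v ∈ V1, cl v = r := fun v hv => by simp [cl, ((hmV1 v).1 hv).2]
    have hsplit : ∀ f : V → ℝ, ∑ v ∈ A, f v = ∑ v ∈ A', f v + ∑ v ∈ V1, f v := fun f =>
      (sum_filter_add_sum_filter_not A _ f).symm
    refine ⟨cl, ?_, ?_⟩
    · intro v hv
      by_cases h : R.Adj v1 v
      · rw [hc1 v ((hmA' v).2 ⟨hv, h⟩)]; exact (hcl' v ((hmA' v).2 ⟨hv, h⟩)).trans (by omega)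
      · rw [hc2 v ((hmV1 v).2 ⟨hv, h⟩)]; omega
    · have hdeg : ∀ u ∈ V1, ∑ v ∈ A', ind (R.Adj u v) + ∑ v ∈ V1, ind (R.Adj u v) - ∑ v ∈ A', (1:ℝ) ≤ 0 := by
        intro u hu
        have h1 := hmax u ((hmV1 u).1 hu).1
        rw [hsplit, hsplit] at h1
        have h2 : ∑ v ∈ A', ind (R.Adj v1 v) = ∑ v ∈ A', (1:ℝ) :=
          sum_congr rfl fun v hv => ind_true ((hmA' v).1 hv).2
        have h3 : ∑ v ∈ V1, ind (R.Adj v1 v) = 0 :=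
          sum_eq_zero fun v hv => ind_false ((hmV1 v).1 hv).2
        linarith
      rw [hsplit]
      have e1 : ∑ u ∈ A', ∑ v ∈ A, (ind (R.Adj u v) + ind (R.Adj u v ∧ cl u = cl v) - ind (cl u ≠ cl v))
          = ∑ u ∈ A', ∑ v ∈ A', (ind (R.Adj u v) + ind (R.Adj u v ∧ cl' u = cl' v) - ind (cl' u ≠ cl' v))
            + ∑ u ∈ A', ∑ v ∈ V1, (ind (R.Adj u v) - 1) := by
        rw [← sum_add_distrib]
        refine sum_congr rfl fun u hu => ?_
        rw [hsplit]
        congr 1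
        · refine sum_congr rfl fun v hv => ?_
          rw [hc1 u hu, hc1 v hv]
        · refine sum_congr rfl fun v hv => ?_
          have : cl u ≠ cl v := by rw [hc1 u hu, hc2 v hv]; exact (hcl' u hu).ne
          rw [ind_true this, ind_false (p := R.Adj u v ∧ cl u = cl v) (fun h => this h.2)]; ring
      have e2 : ∑ u ∈ V1, ∑ v ∈ A, (ind (R.Adj u v) + ind (R.Adj u v ∧ cl u = cl v) - ind (cl u ≠ cl v))
          = ∑ u ∈ V1, ∑ v ∈ A', (ind (R.Adj u v) - 1)
            + ∑ u ∈ V1, ∑ v ∈ V1, 2 * ind (R.Adj u v) := by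
        rw [← sum_add_distrib]
        refine sum_congr rfl fun u hu => ?_
        rw [hsplit]
        congr 1
        · refine sum_congr rfl fun v hv => ?_
          have : cl u ≠ cl v := by rw [hc2 u hu, hc1 v hv]; exact (hcl' v hv).ne'
          rw [ind_true this, ind_false (p := R.Adj u v ∧ cl u = cl v) (fun h => this h.2)]; ring
        · refine sum_congr rfl fun v hv => ?_
          have : cl u = cl v := by rw [hc2 u hu, hc2 v hv]
          rw [ind_false (p := cl u ≠ cl v) (not_not.2 this), ind_and, ind_true this]; ring
      have e3 : ∑ u ∈ A', ∑ v ∈ V1, (ind (R.Adj u v) - 1) = ∑ u ∈ V1, ∑ v ∈ A', (ind (R.Adj u v) - 1) := by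
        rw [sum_comm]
        refine sum_congr rfl fun u hu => sum_congr rfl fun v hv => ?_
        rw [R.adj_comm]
      rw [e1, e2, e3]
      have h5 : ∑ u ∈ V1, (∑ v ∈ A', ind (R.Adj u v) + ∑ v ∈ V1, ind (R.Adj u v) - ∑ v ∈ A', (1:ℝ)) ≤ 0 :=
        sum_nonpos hdeg
      have h6 : ∑ u ∈ V1, ∑ v ∈ A', (ind (R.Adj u v) - 1) + (∑ u ∈ V1, ∑ v ∈ A', (ind (R.Adj u v) - 1)
            + ∑ u ∈ V1, ∑ v ∈ V1, 2 * ind (R.Adj u v)) = 2 * ∑ u ∈ V1, (∑ v ∈ A', ind (R.Adj u v) + ∑ v ∈ V1, ind (R.Adj u v) - ∑ v ∈ A', (1:ℝ)) := by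
        rw [mul_sum, ← sum_add_distrib, ← sum_add_distrib]
        refine sum_congr rfl fun u hu => ?_
        rw [sum_sub_distrib, ← mul_sum]; ring
      linarith

/-- number of ordered cross pairs. -/
theorem cross_identity {V : Type} [Fintype V] (r : ℕ) (hr : 0 < r) (S : V → Fin r) :
    ∑ u : V, ∑ v : V, ind (S u ≠ S v) = (1 - 1 / (r : ℝ)) * (Fintype.card V : ℝ) ^ 2
      - ∑ i, ((#(fil univ (fun v => S v = i)) : ℝ) - (Fintype.card V : ℝ) / r) ^ 2 := by
  have hrR : (r : ℝ) ≠ 0 := by positivity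
  have h1 : ∑ i, (#(fil univ (fun v => S v = i)) : ℝ) = Fintype.card V := by
    simp_rw [card_fil]
    rw [sum_comm]
    have : ∀ v : V, ∑ i, ind (S v = i) = 1 := by
      intro v; rw [sum_eq_single (S v)]
      · exact ind_true rfl
      · intro i _ hi; exact ind_false hi.symm
      · simp
    simp [this]
  have h2 : ∑ i, (#(fil univ (fun v => S v = i)) : ℝ) ^ 2 = ∑ u : V, ∑ v : V, ind (S u = S v) := by
    have : ∀ i, (#(fil univ (fun v => S v = i)) : ℝ) ^ 2 = ∑ u : V, ∑ v : V, ind (S u = i) * ind (S v = i) := by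
      intro i; rw [sq, card_fil, sum_mul_sum]
    simp_rw [this]
    rw [sum_comm]
    refine sum_congr rfl fun u _ => ?_
    rw [sum_comm]
    refine sum_congr rfl fun v _ => ?_
    rw [sum_eq_single (S u)]
    · rw [ind_true rfl, one_mul]; congr 1; exact propext eq_comm
    · intro i _ hi; rw [ind_false hi.symm, zero_mul]
    · simp
  have h3 : ∑ u : V, ∑ v : V, ind (S u ≠ S v) = (Fintype.card V : ℝ) ^ 2 - ∑ u : V, ∑ v : V, ind (S u = S v) := by
    have : ∀ u v : V, ind (S u ≠ S v) = 1 - ind (S u = S v) := fun u v => ind_not _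
    simp_rw [this, sum_sub_distrib]
    simp [sq]
  rw [h3, ← h2]
  have h4 : ∑ i, ((#(fil univ (fun v => S v = i)) : ℝ) - (Fintype.card V : ℝ) / r) ^ 2
     = ∑ i, (#(fil univ (fun v => S v = i)) : ℝ) ^ 2 - 2 * ((Fintype.card V : ℝ) / r) * ∑ i, (#(fil univ (fun v => S v = i)) : ℝ)
      + r * ((Fintype.card V : ℝ) / r) ^ 2 := by
    have : ∀ i, ((#(fil univ (fun v => S v = i)) : ℝ) - (Fintype.card V : ℝ) / r) ^ 2 =
      (#(fil univ (fun v => S v = i)) : ℝ) ^ 2 - 2 * ((Fintype.card V : ℝ) / r) * (#(fil univ (fun v => S v = i)) : ℝ)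
        + ((Fintype.card V : ℝ) / r) ^ 2 := fun i => by ring
    simp_rw [this, sum_add_distrib, sum_sub_distrib, ← mul_sum]
    simp
  rw [h4, h1]
  field_simp
  ring

theorem cross_le {V : Type} [Fintype V] (r : ℕ) (hr : 0 < r) (S : V → Fin r) :
    ∑ u : V, ∑ v : V, ind (S u ≠ S v) ≤ (1 - 1 / (r : ℝ)) * (Fintype.card V : ℝ) ^ 2 := by
  rw [cross_identity r hr S]
  have : 0 ≤ ∑ i, ((#(fil univ (fun v => S v = i)) : ℝ) - (Fintype.card V : ℝ) / r) ^ 2 :=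
    sum_nonneg fun i _ => sq_nonneg _
  linarith

theorem furedi {V : Type} [Fintype V] (R : SimpleGraph V) (r : ℕ) (hr : 0 < r)
    (hR : R.CliqueFree (r + 1)) : ∃ S : V → Fin r,
    ∑ u : V, ∑ v : V, ind (R.Adj u v) + ∑ u : V, ∑ v : V, ind (R.Adj u v ∧ S u = S v)
      ≤ (1 - 1 / (r : ℝ)) * (Fintype.card V : ℝ) ^ 2 := by
  obtain ⟨cl, hcl, hsum⟩ := furedi_aux R r univ (by rintro ⟨K, _, hK⟩; exact hR K hK)
  refine ⟨fun v => ⟨cl v, hcl v (mem_univ v)⟩, ?_⟩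
  have h := cross_le r hr (fun v => (⟨cl v, hcl v (mem_univ v)⟩ : Fin r))
  simp only [Fin.mk.injEq, ne_eq] at h ⊢
  simp only [sum_sub_distrib, sum_add_distrib] at hsum
  simp only [ne_eq] at hsum
  linarith
end Furedi
end WPN

namespace WPN
section VC
open Finset Classical

theorem card_fil_add_not {α : Type*} (s : Finset α) (p : α → Prop) :
    #(fil s p) + #(fil s (fun x => ¬ p x)) = #s := by
  have := card_filter_add_card_filter_not (s := s) p
  rw [← this]
  congr 2
  ext x; simp [mem_fil]

theorem card_small_sets (q e : ℕ) (hq : 0 < q) (𝒜 : Finset (Finset (Fin q)))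
    (h : ∀ s ∈ 𝒜, #s < e) : #𝒜 ≤ e * q ^ e := by
  have h1 : 𝒜 ⊆ (range e).biUnion (fun k => (univ : Finset (Fin q)).powersetCard k) := by
    intro s hs
    simp only [mem_biUnion, mem_range, mem_powersetCard]
    exact ⟨#s, h s hs, subset_univ _, rfl⟩
  refine (card_le_card h1).trans (card_biUnion_le.trans ?_)
  calc ∑ k ∈ range e, #((univ : Finset (Fin q)).powersetCard k) ≤ ∑ k ∈ range e, q ^ e := by
        apply sum_le_sum
        intro k hk
        rw [card_powersetCard, card_univ, Fintype.card_fin]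
        exact (Nat.choose_le_pow q k).trans (Nat.pow_le_pow_right hq (mem_range.1 hk).le)
    _ = _ := by simp

/-- a family of more than `e * q^e` subsets shatters a set of size `e = 2^K`, in dual form. -/
theorem dual_shatter {β : Type} (K q : ℕ) (hq : 0 < q) (B : Finset β) (tr : β → Fin q → Prop)
    (hinj : ∀ u ∈ B, ∀ v ∈ B, (∀ j, tr u j ↔ tr v j) → u = v)
    (hcard : 2 ^ K * q ^ (2 ^ K) < #B) :
    ∃ (u : Fin K → B) (pos : Finset (Fin K) → Fin q), ∀ j P, tr (u j) (pos P) ↔ j ∈ P := by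
  let 𝒜 : Finset (Finset (Fin q)) := B.image (fun u => univ.filter (fun j => tr u j))
  have h𝒜 : #𝒜 = #B := by
    apply card_image_of_injOn
    intro u hu v hv huv
    apply hinj u hu v hv
    intro j
    have := congrArg (fun s => j ∈ s) huv
    simpa using this
  have h2 : ∃ s ∈ 𝒜.shatterer, 2 ^ K ≤ #s := by
    by_contra hcon
    push Not at hcon
    have := card_small_sets q (2 ^ K) hq 𝒜.shatterer hcon
    have h3 := card_le_card_shatterer 𝒜
    omega
  obtain ⟨s, hs, hsc⟩ := h2
  rw [mem_shatterer] at hs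
  have hemb : Nonempty (Finset (Fin K) ↪ s) := by
    rw [Function.Embedding.nonempty_iff_card_le]; simpa using hsc
  obtain ⟨φ⟩ := hemb
  have hu : ∀ j : Fin K, ∃ u : B, ∀ P : Finset (Fin K), tr u (φ P) ↔ j ∈ P := by
    intro j
    have hsub : (univ.filter (fun P : Finset (Fin K) => j ∈ P)).image (fun P => (φ P : Fin q)) ⊆ s := by
      intro x hx
      obtain ⟨P, _, rfl⟩ := mem_image.1 hx
      exact (φ P).2
    obtain ⟨t, ht, hst⟩ := hs hsub
    obtain ⟨u, hu, rfl⟩ := mem_image.1 ht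
    refine ⟨⟨u, hu⟩, fun P => ?_⟩
    have := congrArg (fun s => (φ P : Fin q) ∈ s) hst
    simp only [mem_inter, mem_image, mem_filter, mem_univ, true_and, eq_iff_iff] at this
    constructor
    · intro h
      obtain ⟨P', hP', he⟩ := this.1 ⟨(φ P).2, h⟩
      have := φ.injective (Subtype.ext he)
      rwa [this] at hP'
    · intro h
      exact (this.2 ⟨P, h, rfl⟩).2
  choose u hu using hu
  exact ⟨u, fun P => φ P, fun j P => hu j P⟩

theorem exists_q (δ : ℝ) (hδ : 0 < δ) (hδ1 : δ < 1) (e : ℕ) : ∃ q : ℕ, 0 < q ∧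
    ((e * q ^ e + 1 : ℕ) : ℝ) ^ 2 * (1 - δ) ^ q ≤ 1 / 2 := by
  have h1 : Tendsto (fun q : ℕ => (q : ℝ) ^ (2 * e) * (1 - δ) ^ q) atTop (nhds 0) :=
    tendsto_pow_const_mul_const_pow_of_abs_lt_one (2 * e) (by rw [abs_of_pos] <;> linarith)
  have h2 : Tendsto (fun q : ℕ => ((e:ℝ) + 1) ^ 2 * ((q : ℝ) ^ (2 * e) * (1 - δ) ^ q)) atTop (nhds 0) := by
    simpa using h1.const_mul (((e:ℝ) + 1) ^ 2)
  have h3 := h2.eventually (gt_mem_nhds (show (0:ℝ) < 1 / 2 by norm_num))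
  obtain ⟨q, hq1, hq⟩ := (h3.and (eventually_gt_atTop 0)).exists
  refine ⟨q, hq, le_trans ?_ hq1.le⟩
  rw [← mul_assoc]
  apply mul_le_mul_of_nonneg_right _ (pow_nonneg (by linarith) _)
  have hq1 : (1:ℝ) ≤ (q:ℝ) ^ e := one_le_pow₀ (by exact_mod_cast hq)
  have : ((e:ℝ) + 1) ^ 2 * (q:ℝ) ^ (2 * e) = (((e:ℝ) + 1) * (q:ℝ) ^ e) ^ 2 := by
    rw [mul_pow, ← pow_mul, mul_comm 2 e]
  rw [this]
  apply pow_le_pow_left₀ (by positivity)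
  push_cast
  nlinarith

theorem vc_robust (δ : ℝ) (hδ : 0 < δ) (hδ1 : δ < 1) (K : ℕ) : ∃ (M : ℕ) (c : ℝ), 0 < c ∧
    ∀ (V : Type) (G : SimpleGraph V) (D : Finset V) (n : ℕ), 0 < n → #D ≤ n → ∀ B : Finset V,
      M ≤ #B → (∀ u ∈ B, ∀ v ∈ B, u ≠ v → δ * n ≤ #(fil D (fun x => ¬ (G.Adj u x ↔ G.Adj v x)))) →
      ∃ B' ⊆ B, #B' = K ∧ ∀ P ⊆ B', c * n ≤ #(fil D (fun x => ∀ u ∈ B', (G.Adj u x ↔ u ∈ P))) := by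
  obtain ⟨q, hq, hqM⟩ := exists_q δ hδ hδ1 (2 ^ K)
  set e := 2 ^ K with he
  set M := e * q ^ e + 1 with hM
  have he0 : 0 < e := by positivity
  have hM2 : 2 ≤ M := by
    have : 0 < e * q ^ e := by positivity
    omega
  set Q : ℝ := 2 * (M ^ K * q ^ e) with hQ
  have hQ0 : 0 < Q := by positivity
  refine ⟨M, δ / Q, by positivity, ?_⟩
  intro V G D n hn hDn B0 hB0 hfar0
  obtain ⟨B, hBB, hBM⟩ := exists_subset_card_eq hB0
  have hfar := fun u hu v hv => hfar0 u (hBB hu) v (hBB hv)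
  set d := #D with hd
  have hnR : (0:ℝ) < n := by exact_mod_cast hn
  have hdn : (d:ℝ) ≤ n := by exact_mod_cast hDn
  have hδd : δ * n ≤ d := by
    obtain ⟨u, hu, v, hv, huv⟩ := one_lt_card.1 (show 1 < #B by omega)
    refine (hfar u hu v hv huv).trans ?_
    exact_mod_cast card_le_card fil_subset
  have hd0 : (0:ℝ) < d := lt_of_lt_of_le (by positivity) hδd
  let Y := Fintype.piFinset (fun _ : Fin q => D)
  have hY : (#Y : ℝ) = (d:ℝ) ^ q := by simp [Y, hd]
  let Good : (Fin q → V) → Prop := fun y => ∀ u ∈ B, ∀ v ∈ B,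
    (∀ j, G.Adj u (y j) ↔ G.Adj v (y j)) → u = v
  -- good tuples
  have hbad : (#(fil Y (fun y => ¬ Good y)) : ℝ) ≤ (d:ℝ) ^ q / 2 := by
    have hsub : fil Y (fun y => ¬ Good y) ⊆ (B ×ˢ B).biUnion (fun p =>
        if p.1 = p.2 then ∅ else Fintype.piFinset (fun _ : Fin q => fil D (fun x => G.Adj p.1 x ↔ G.Adj p.2 x))) := by
      intro y hy
      obtain ⟨hyY, hyb⟩ := mem_fil.1 hy
      simp only [Good] at hyb
      push Not at hyb
      obtain ⟨u, hu, v, hv, hj, hne⟩ := hyb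
      rw [mem_biUnion]
      refine ⟨(u, v), by simp [hu, hv], ?_⟩
      simp only [hne, if_false, Fintype.mem_piFinset, mem_fil]
      exact fun j => ⟨Fintype.mem_piFinset.1 hyY j, hj j⟩
    have h1 : (#(fil Y (fun y => ¬ Good y)) : ℝ) ≤ ∑ p ∈ B ×ˢ B, ((1 - δ) * d) ^ q := by
      refine le_trans (Nat.cast_le.2 ((card_le_card hsub).trans card_biUnion_le)) ?_
      push_cast
      apply sum_le_sum
      rintro ⟨u, v⟩ hp
      simp only [mem_product] at hp
      have hnn : 0 ≤ ((1 - δ) * d) := mul_nonneg (by linarith) hd0.le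
      by_cases huv : u = v
      · simp only [huv, if_true, card_empty]; push_cast; positivity
      · simp only [huv, if_false, Fintype.card_piFinset, prod_const, card_univ, Fintype.card_fin]
        push_cast
        apply pow_le_pow_left₀ (by positivity)
        have h2 := hfar u hp.1 v hp.2 huv
        have h3 : (#(fil D (fun x => G.Adj u x ↔ G.Adj v x)) : ℝ) + #(fil D (fun x => ¬ (G.Adj u x ↔ G.Adj v x))) = d := by
          rw [hd]; exact_mod_cast card_fil_add_not D (fun x => G.Adj u x ↔ G.Adj v x)
        nlinarith
    refine h1.trans ?_
    rw [sum_const, card_product, hBM, nsmul_eq_mul, mul_pow]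
    push_cast
    have : ((M:ℝ) * M * ((1 - δ) ^ q * d ^ q)) = (M:ℝ) ^ 2 * (1 - δ) ^ q * d ^ q := by ring
    rw [this]
    have : (0:ℝ) < (d:ℝ) ^ q := by positivity
    nlinarith
  have hgood : (d:ℝ) ^ q / 2 ≤ #(fil Y Good) := by
    have h3 : (#(fil Y Good) : ℝ) + #(fil Y (fun y => ¬ Good y)) = #Y := by
      exact_mod_cast card_fil_add_not Y Good
    linarith
  have hch : ∀ y : Fin q → V, ∃ p : (Fin K → B) × (Finset (Fin K) → Fin q), Good y →
      ∀ j P, G.Adj (p.1 j) (y (p.2 P)) ↔ j ∈ P := by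
    intro y
    by_cases hy : Good y
    · obtain ⟨u, pos, h⟩ := dual_shatter K q hq B (fun u j => G.Adj u (y j)) hy (by rw [hBM, hM, ← he]; omega)
      exact ⟨(u, pos), fun _ => h⟩
    · have hb : Nonempty B := by
        obtain ⟨b, hb⟩ := card_pos.1 (show 0 < #B by omega)
        exact ⟨⟨b, hb⟩⟩
      exact ⟨(fun _ => hb.some, fun _ => ⟨0, hq⟩), fun h => absurd h hy⟩
  choose p hp using hch
  have hpig : ∃ P0 : (Fin K → B) × (Finset (Fin K) → Fin q),
      (d:ℝ) ^ q / Q ≤ #(fil (fil Y Good) (fun y => p y = P0)) := by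
    by_contra hcon
    push Not at hcon
    have h1 : (#(fil Y Good) : ℝ) = ∑ P0, (#(fil (fil Y Good) (fun y => p y = P0)) : ℝ) := by
      have := card_eq_sum_card_fiberwise (f := p) (s := fil Y Good) (t := univ) (fun _ _ => mem_univ _)
      rw [this]; push_cast
      refine sum_congr rfl fun P0 _ => ?_
      congr 2; ext y; simp [mem_fil]
    have hne : (univ : Finset ((Fin K → B) × (Finset (Fin K) → Fin q))).Nonempty := ⟨p (fun _ => (card_pos.1 (show 0 < #B by omega)).choose), mem_univ _⟩
    have h2 := sum_lt_sum_of_nonempty hne (fun P0 _ => hcon P0)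
    rw [← h1, sum_const, nsmul_eq_mul, card_univ] at h2
    have h3 : (Fintype.card ((Fin K → B) × (Finset (Fin K) → Fin q)) : ℝ) = M ^ K * q ^ e := by
      simp [hBM, he]
    rw [h3] at h2
    have h4 : (M:ℝ) ^ K * q ^ e * ((d:ℝ) ^ q / Q) = (d:ℝ) ^ q / 2 := by
      rw [hQ]; field_simp
    linarith
  obtain ⟨⟨u, pos⟩, hP0⟩ := hpig
  have hpat : ∀ y ∈ fil (fil Y Good) (fun y => p y = (u, pos)), y ∈ Y ∧ ∀ j P, G.Adj (u j) (y (pos P)) ↔ j ∈ P := by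
    intro y hy
    obtain ⟨h1, h2⟩ := mem_fil.1 hy
    obtain ⟨h3, h4⟩ := mem_fil.1 h1
    refine ⟨h3, ?_⟩
    have := hp y h4
    rwa [h2] at this
  have hpos : 0 < (#(fil (fil Y Good) (fun y => p y = (u, pos))) : ℝ) := lt_of_lt_of_le (by positivity) hP0
  have huinj : Function.Injective (fun j => (u j : V)) := by
    obtain ⟨y, hy⟩ := card_pos.1 (by exact_mod_cast hpos : 0 < #(fil (fil Y Good) (fun y => p y = (u, pos))))
    have h := (hpat y hy).2
    intro j j' hjj
    have h1 := h j {j}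
    have h2 := h j' {j}
    simp only at hjj
    rw [← hjj, h1] at h2
    have h3 : j' = j := by simpa using h2
    exact h3.symm
  refine ⟨univ.image (fun j => (u j : V)), ?_, ?_, ?_⟩
  · intro x hx
    obtain ⟨j, _, rfl⟩ := mem_image.1 hx
    exact hBB (u j).2
  · rw [card_image_of_injective _ huinj]; simp
  · intro P hP
    set D' := fil D (fun x => ∀ v ∈ univ.image (fun j => (u j : V)), (G.Adj v x ↔ v ∈ P)) with hD'
    set P' : Finset (Fin K) := univ.filter (fun j => (u j : V) ∈ P) with hP'
    have h1 : (#(fil (fil Y Good) (fun y => p y = (u, pos))) : ℝ) ≤ #(fil Y (fun y => y (pos P') ∈ D')) := by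
      have hs : fil (fil Y Good) (fun y => p y = (u, pos)) ⊆ fil Y (fun y => y (pos P') ∈ D') := by
        intro y hy
        obtain ⟨hyY, h⟩ := hpat y hy
        rw [mem_fil, hD', mem_fil]
        refine ⟨hyY, Fintype.mem_piFinset.1 hyY _, ?_⟩
        intro v hv
        obtain ⟨j, _, rfl⟩ := mem_image.1 hv
        rw [h j P', hP']; simp
      exact_mod_cast card_le_card hs
    have h2 : (d:ℝ) * #(fil Y (fun y => y (pos P') ∈ D')) = (d:ℝ) ^ q * #D' := by
      rw [card_fil, hd, avg_update (fun _ : Fin q => D) (pos P') (fun y => ind (y (pos P') ∈ D'))]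
      simp only [Function.update_self]
      rw [sum_const, nsmul_eq_mul, ← card_fil, ← hd]
      have e1 : fil D (fun x => x ∈ D') = D' := by
        ext x; rw [mem_fil]; exact ⟨fun h => h.2, fun h => ⟨fil_subset h, h⟩⟩
      rw [e1]
      rw [← hY]
    have h3 : (d:ℝ) * ((d:ℝ) ^ q / Q) ≤ (d:ℝ) ^ q * #D' := by
      rw [← h2]
      exact mul_le_mul_of_nonneg_left (hP0.trans h1) hd0.le
    have hdq : (0:ℝ) < (d:ℝ) ^ q := by positivity
    have h4 : (d:ℝ) / Q ≤ #D' := by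
      refine le_of_mul_le_mul_left ?_ hdq
      calc (d:ℝ) ^ q * (d / Q) = d * (d ^ q / Q) := by ring
        _ ≤ _ := h3
    calc δ / Q * n = (δ * n) / Q := by ring
      _ ≤ d / Q := by gcongr
      _ ≤ _ := h4
end VC
end WPN

namespace WPN
section Szem
open Finset Classical

theorem inter_card {V : Type} (G : SimpleGraph V) (A B : Finset V) :
    (#(fil (A ×ˢ B) (fun q => G.Adj q.1 q.2)) : ℝ) = (G.edgeDensity A B : ℝ) * #A * #B := by
  have h : #(fil (A ×ˢ B) (fun q => G.Adj q.1 q.2)) = #(G.interedges A B) := by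
    congr 1
  rw [h, SimpleGraph.edgeDensity_def]
  by_cases hA : (#A : ℝ) = 0
  · have : A = ∅ := by simpa using hA
    subst this; simp
  by_cases hB : (#B : ℝ) = 0
  · have : B = ∅ := by simpa using hB
    subst this; simp [SimpleGraph.interedges, Rel.interedges]
  push_cast
  field_simp

theorem inter_card_not {V : Type} (G : SimpleGraph V) (A B : Finset V) :
    (#(fil (A ×ˢ B) (fun q => ¬ G.Adj q.1 q.2)) : ℝ) = (1 - (G.edgeDensity A B : ℝ)) * #A * #B := by
  have h := card_fil_add_not (A ×ˢ B) (fun q => G.Adj q.1 q.2)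
  have h2 : (#(fil (A ×ˢ B) (fun q => G.Adj q.1 q.2)) : ℝ) + #(fil (A ×ˢ B) (fun q => ¬ G.Adj q.1 q.2))
    = #A * #B := by
    have := congrArg (fun x : ℕ => (x : ℝ)) h
    simpa [card_product] using this
  rw [inter_card] at h2
  linarith

theorem lowreg_aux {V : Type} (ψ : V → V → Prop) (A B : Finset V) (η ε : ℝ) (hη : η ≤ 1) (h0 : 0 < η)
    (hε : 0 < ε)
    (h : ∀ A' ⊆ A, ∀ B' ⊆ B, #A * ε ≤ (#A' : ℝ) → #B * ε ≤ (#B' : ℝ) →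
      η * #A' * #B' ≤ (#(fil (A' ×ˢ B') (fun q => ψ q.1 q.2)) : ℝ)) : LowReg ψ A B η ε := by
  intro A' hA' B' hB'
  have a1 : (#A' : ℝ) ≤ #A := by exact_mod_cast card_le_card hA'
  have b1 : (#B' : ℝ) ≤ #B := by exact_mod_cast card_le_card hB'
  have e0 : (0:ℝ) ≤ (#(fil (A' ×ˢ B') (fun q => ψ q.1 q.2)) : ℝ) := by positivity
  have p1 : (0:ℝ) ≤ #A' := by positivity
  have p2 : (0:ℝ) ≤ #B' := by positivity
  by_cases hA : #A * ε ≤ (#A' : ℝ)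
  · by_cases hB : #B * ε ≤ (#B' : ℝ)
    · have := h A' hA' B' hB' hA hB
      have : 0 ≤ ε * #A * #B := by positivity
      linarith
    · push Not at hB
      have : η * #A' * #B' ≤ 1 * #A * (#B * ε) := by gcongr
      nlinarith
  · push Not at hA
    have : η * #A' * #B' ≤ 1 * (#A * ε) * #B := by gcongr
    nlinarith

theorem LowReg.mono {V : Type} {ψ : V → V → Prop} {A B : Finset V} {η ε ε' : ℝ}
    (h : LowReg ψ A B η ε) (h' : ε ≤ ε') : LowReg ψ A B η ε' := by
  intro A' hA' B' hB'
  refine le_trans ?_ (h A' hA' B' hB')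
  have : ε * #A * #B ≤ ε' * #A * #B :=
    mul_le_mul_of_nonneg_right (mul_le_mul_of_nonneg_right h' (Nat.cast_nonneg _)) (Nat.cast_nonneg _)
  linarith

theorem lowreg_of_uniform {V : Type} (G : SimpleGraph V) (A B : Finset V) (η ε : ℝ) (h0 : 0 < η)
    (h1 : η ≤ 1) (hε : 0 < ε) (hε2 : ε ≤ η / 2) (hu : G.IsUniform ε A B)
    (hd : η ≤ (G.edgeDensity A B : ℝ)) (hd' : (G.edgeDensity A B : ℝ) ≤ 1 - η) :
    LowReg G.Adj A B (η/2) ε ∧ LowReg (fun x y => ¬ G.Adj x y) A B (η/2) ε := by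
  constructor
  · apply lowreg_aux _ _ _ _ _ (by linarith) (by linarith) hε
    intro A' hA' B' hB' hA hB
    have := abs_lt.1 (hu hA' hB' hA hB)
    rw [inter_card]
    gcongr
    linarith [this.1]
  · apply lowreg_aux _ _ _ _ _ (by linarith) (by linarith) hε
    intro A' hA' B' hB' hA hB
    have := abs_lt.1 (hu hA' hB' hA hB)
    rw [inter_card_not]
    gcongr
    linarith [this.2]

theorem arith7 (t n ε η : ℝ) (ht : t ≠ 0) : t * (2 * n / t)^2 + (t^2 * ε) * (2 * n / t)^2 + η * n^2
    = (4 / t + 4 * ε + η) * n^2 := by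
  field_simp; ring

set_option maxHeartbeats 1000000 in
theorem szem {VH : Type} [Fintype VH] (H : SimpleGraph VH) (r : ℕ) (hr : IsWpn H r) (κ : ℝ) (hκ : 0 < κ) :
    ∃ T n0 : ℕ, ∀ (V : Type) [Fintype V], n0 ≤ Fintype.card V → ∀ G : SimpleGraph V, IndFree H G →
      ∃ t, 0 < t ∧ t ≤ T ∧ ∃ f : V → Fin t,
        (∀ a, #(fil univ (fun v => f v = a)) ≤ Fintype.card V / t + 1) ∧
        ∃ R : SimpleGraph (Fin t), R.CliqueFree (r+1) ∧ ∃ D : Fin t → Fin t → Prop,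
        (#(fil (univ : Finset (V × V)) (fun q => ¬ R.Adj (f q.1) (f q.2) ∧
          ¬ (G.Adj q.1 q.2 ↔ D (f q.1) (f q.2)))) : ℝ) ≤ κ * (Fintype.card V)^2 := by
  obtain ⟨η, hη0, hη1, hηκ⟩ : ∃ η : ℝ, 0 < η ∧ η ≤ 1/2 ∧ η ≤ κ / 4 :=
    ⟨min (1/2) (κ/4), by positivity, min_le_left _ _, min_le_right _ _⟩
  obtain ⟨ε0, hε0, n1, hn1, hgrey⟩ := grey_free H r hr (η/2) (by linarith) (by linarith)
  obtain ⟨ε, hε, hεη, hεκ, hε00⟩ : ∃ ε : ℝ, 0 < ε ∧ ε ≤ η / 2 ∧ ε ≤ κ / 16 ∧ ε ≤ ε0 :=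
    ⟨min (η/2) (min (κ/16) ε0), by positivity, min_le_left _ _,
      (min_le_right _ _).trans (min_le_left _ _), (min_le_right _ _).trans (min_le_right _ _)⟩
  obtain ⟨l, hl⟩ := exists_nat_gt (16 / κ)
  have hl0 : 0 < l := by
    have : (0:ℝ) < l := lt_trans (by positivity) hl
    exact_mod_cast this
  obtain ⟨T, hT⟩ : ∃ T, T = SzemerediRegularity.bound ε l := ⟨_, rfl⟩
  refine ⟨T, l + T * (n1 + 1), ?_⟩
  intro V _ hn G hG
  obtain ⟨P, hP, hlP, hPT, hPu⟩ := szemeredi_regularity G hε (l := l) (by omega)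
  rw [← hT] at hPT
  have hT0 : 0 < T := lt_of_lt_of_le (lt_of_lt_of_le hl0 hlP) hPT
  obtain ⟨t, ht⟩ : ∃ t, t = #P.parts := ⟨_, rfl⟩
  rw [← ht] at hlP hPT
  have ht0 : 0 < t := by omega
  obtain ⟨n, hn'⟩ : ∃ n, n = Fintype.card V := ⟨_, rfl⟩
  rw [← hn'] at hn ⊢
  have hnT : t ≤ n := by nlinarith
  let e : P.parts ≃ Fin t := P.parts.equivFinOfCardEq ht.symm
  let C : Fin t → Finset V := fun a => (e.symm a).1
  let f : V → Fin t := fun v => e ⟨P.part v, P.part_mem.2 (mem_univ v)⟩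
  have hfC : ∀ a, fil univ (fun v => f v = a) = C a := by
    intro a; ext v
    simp only [mem_fil, mem_univ, true_and]
    constructor
    · rintro rfl
      simp only [C, f, Equiv.symm_apply_apply]
      exact P.mem_part (mem_univ v)
    · intro hv
      have : P.part v = C a := P.part_eq_of_mem (e.symm a).2 hv
      simp only [f, this]
      simp [C]
  have hmem : ∀ v a, f v = a ↔ v ∈ C a := by
    intro v a; rw [← hfC, mem_fil]; simp
  have hCle : ∀ a, #(C a) ≤ n / t + 1 := by
    intro a
    have := hP.card_part_le_average_add_one (e.symm a).2
    simpa [hn', ht] using this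
  have hCge : ∀ a, n1 ≤ #(C a) := by
    intro a
    have := hP.average_le_card_part (e.symm a).2
    refine le_trans ?_ this
    rw [card_univ, ← ht, ← hn']
    rw [Nat.le_div_iff_mul_le ht0]
    nlinarith
  have hdisj : ∀ a b, a ≠ b → Disjoint (C a) (C b) := by
    intro a b hab
    rw [Finset.disjoint_left]
    intro v hv hv'
    exact hab (((hmem v a).2 hv).symm.trans ((hmem v b).2 hv'))
  have hCinj : ∀ a b, C a = C b → a = b := by
    intro a b hab
    have := Subtype.ext hab
    exact e.symm.injective this
  let R : SimpleGraph (Fin t) := 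
    { Adj := fun a b => a ≠ b ∧ G.IsUniform ε (C a) (C b) ∧ η ≤ (G.edgeDensity (C a) (C b) : ℝ) ∧ 
        (G.edgeDensity (C a) (C b) : ℝ) ≤ 1 - η
      symm := ⟨by
        rintro a b ⟨h1, h2, h3, h4⟩
        refine ⟨h1.symm, (SimpleGraph.isUniform_comm G).1 h2, ?_, ?_⟩ <;> rw [SimpleGraph.edgeDensity_comm] <;> assumption⟩
      loopless := ⟨fun a h => h.1 rfl⟩ }
  have hR : R.CliqueFree (r+1) := by
    intro s hs
    obtain ⟨hs1, hs2⟩ := (SimpleGraph.isNClique_iff R).1 hs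
    let g : Fin (r+1) ≃ s := (s.equivFinOfCardEq hs2).symm
    refine hgrey V G hG (fun i => C (g i).1) ?_ ?_ ?_
    · intro i j hij
      apply hdisj
      intro h; exact hij (g.injective (Subtype.ext h))
    · intro i; exact hCge _
    · intro i j hij
      have hadj : R.Adj (g i).1 (g j).1 := hs1 (g i).2 (g j).2 
        (fun h => hij (g.injective (Subtype.ext h)))
      obtain ⟨h1, h2, h3, h4⟩ := hadj
      have := lowreg_of_uniform G _ _ η ε hη0 (by linarith) hε hεη h2 h3 h4
      exact ⟨this.1.mono hε00, this.2.mono hε00⟩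
  refine ⟨t, ht0, hPT, f, fun a => by rw [hfC]; exact hCle a, R, hR,
    fun a b => (1/2 : ℝ) < (G.edgeDensity (C a) (C b) : ℝ), ?_⟩
  have hn0 : (0:ℝ) < n := by exact_mod_cast (lt_of_lt_of_le ht0 hnT)
  have ht0' : (0:ℝ) < t := by exact_mod_cast ht0
  have hCle' : ∀ a, (#(C a) : ℝ) ≤ 2 * n / t := by
    intro a
    have h1 : (#(C a) : ℝ) ≤ ((n / t : ℕ) : ℝ) + 1 := by exact_mod_cast hCle a
    have h2 : ((n / t : ℕ) : ℝ) ≤ (n : ℝ) / t := Nat.cast_div_le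
    have h3 : (1 : ℝ) ≤ (n : ℝ) / t := by
      rw [le_div_iff₀ ht0']; simpa using (by exact_mod_cast hnT : (t : ℝ) ≤ n)
    calc (#(C a) : ℝ) ≤ n / t + n / t := by linarith
      _ = _ := by ring
  set bad : V × V → Prop := fun q => ¬ R.Adj (f q.1) (f q.2) ∧
          ¬ (G.Adj q.1 q.2 ↔ (1/2 : ℝ) < (G.edgeDensity (C (f q.1)) (C (f q.2)) : ℝ)) with hbad
  have hsplit : (#(fil (univ : Finset (V × V)) bad) : ℝ)
      = ∑ p : Fin t × Fin t, (#(fil (C p.1 ×ˢ C p.2) bad) : ℝ) := by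
    have := Finset.card_eq_sum_card_fiberwise (s := fil (univ : Finset (V × V)) bad) 
      (t := (univ : Finset (Fin t × Fin t))) (f := fun q => (f q.1, f q.2)) (fun _ _ => by simp)
    rw [this]
    push_cast
    apply sum_congr rfl
    rintro ⟨a, b⟩ _
    congr 2
    ext ⟨x, y⟩
    simp only [mem_filter, mem_fil, mem_univ, true_and, mem_product, Prod.mk.injEq, hmem]
    tauto
  have hpair : ∀ p : Fin t × Fin t, (#(fil (C p.1 ×ˢ C p.2) bad) : ℝ) ≤
      ind (p.1 = p.2) * (2 * n / t)^2 + ind (p.1 ≠ p.2 ∧ ¬ G.IsUniform ε (C p.1) (C p.2)) * (2 * n / t)^2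
        + η * (#(C p.1) * #(C p.2)) := by
    rintro ⟨a, b⟩
    dsimp only
    have htriv : (#(fil (C a ×ˢ C b) bad) : ℝ) ≤ (2 * n / t)^2 := by
      have h1 : (#(fil (C a ×ˢ C b) bad) : ℝ) ≤ #(C a) * #(C b) := by
        have := card_le_card (fil_subset : fil (C a ×ˢ C b) bad ⊆ _)
        rw [card_product] at this
        exact_mod_cast this
      refine h1.trans ?_
      rw [sq]
      exact mul_le_mul (hCle' a) (hCle' b) (Nat.cast_nonneg _) (le_trans (Nat.cast_nonneg _) (hCle' a))
    have hi1 := ind_nonneg (a = b)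
    have hi2 := ind_nonneg (a ≠ b ∧ ¬ G.IsUniform ε (C a) (C b))
    have hcc : (0:ℝ) ≤ #(C a) * #(C b) := mul_nonneg (Nat.cast_nonneg _) (Nat.cast_nonneg _)
    have hpos : (0:ℝ) ≤ η * (#(C a) * #(C b)) := mul_nonneg hη0.le hcc
    have hsq : (0:ℝ) ≤ (2 * n / t)^2 := sq_nonneg _
    by_cases hab : a = b
    · rw [ind_true hab]; nlinarith
    by_cases hu : G.IsUniform ε (C a) (C b)
    · have hgoal : (#(fil (C a ×ˢ C b) bad) : ℝ) ≤ η * (#(C a) * #(C b)) := by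
        by_cases hd : (1/2 : ℝ) < (G.edgeDensity (C a) (C b) : ℝ)
        · have hsub : fil (C a ×ˢ C b) bad ⊆ fil (C a ×ˢ C b) (fun q => ¬ G.Adj q.1 q.2) := by
            rintro ⟨x, y⟩ hq
            simp only [mem_fil, mem_product, hbad] at hq ⊢
            obtain ⟨⟨hx, hy⟩, h1, h2⟩ := hq
            rw [(hmem x a).2 hx, (hmem y b).2 hy] at h2
            exact ⟨⟨hx, hy⟩, fun h => h2 ⟨fun _ => hd, fun _ => h⟩⟩
          by_cases hne : (fil (C a ×ˢ C b) bad).Nonempty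
          · obtain ⟨⟨x, y⟩, hq⟩ := hne
            simp only [mem_fil, mem_product, hbad] at hq
            obtain ⟨⟨hx, hy⟩, h1, h2⟩ := hq
            rw [(hmem x a).2 hx, (hmem y b).2 hy] at h1
            have h3 : 1 - η < (G.edgeDensity (C a) (C b) : ℝ) := by
              by_contra h3
              push Not at h3
              exact h1 ⟨hab, hu, by linarith, h3⟩
            have h4 : (#(fil (C a ×ˢ C b) bad) : ℝ) ≤ #(fil (C a ×ˢ C b) (fun q => ¬ G.Adj q.1 q.2)) :=
              Nat.cast_le.2 (card_le_card hsub)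
            rw [inter_card_not, mul_assoc] at h4
            refine h4.trans (mul_le_mul_of_nonneg_right (by linarith) hcc)
          · rw [not_nonempty_iff_eq_empty] at hne
            rw [hne]; simpa using hpos
        · have hsub : fil (C a ×ˢ C b) bad ⊆ fil (C a ×ˢ C b) (fun q => G.Adj q.1 q.2) := by
            rintro ⟨x, y⟩ hq
            simp only [mem_fil, mem_product, hbad] at hq ⊢
            obtain ⟨⟨hx, hy⟩, h1, h2⟩ := hq
            rw [(hmem x a).2 hx, (hmem y b).2 hy] at h2
            refine ⟨⟨hx, hy⟩, ?_⟩
            by_contra h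
            exact h2 ⟨fun h' => absurd h' h, fun h' => absurd h' hd⟩
          by_cases hne : (fil (C a ×ˢ C b) bad).Nonempty
          · obtain ⟨⟨x, y⟩, hq⟩ := hne
            simp only [mem_fil, mem_product, hbad] at hq
            obtain ⟨⟨hx, hy⟩, h1, h2⟩ := hq
            rw [(hmem x a).2 hx, (hmem y b).2 hy] at h1
            have h3 : (G.edgeDensity (C a) (C b) : ℝ) < η := by
              by_contra h3
              push Not at h3 hd
              exact h1 ⟨hab, hu, h3, by linarith⟩
            have h4 : (#(fil (C a ×ˢ C b) bad) : ℝ) ≤ #(fil (C a ×ˢ C b) (fun q => G.Adj q.1 q.2)) :=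
              Nat.cast_le.2 (card_le_card hsub)
            rw [inter_card, mul_assoc] at h4
            refine h4.trans (mul_le_mul_of_nonneg_right h3.le hcc)
          · rw [not_nonempty_iff_eq_empty] at hne
            rw [hne]; simpa using hpos
      nlinarith
    · rw [ind_true (p := a ≠ b ∧ ¬ G.IsUniform ε (C a) (C b)) ⟨hab, hu⟩]; nlinarith
  have hs1 : ∑ p : Fin t × Fin t, ind (p.1 = p.2) = t := by
    rw [Fintype.sum_prod_type]
    have : ∀ x : Fin t, (∑ y : Fin t, ind (x = y)) = 1 := by
      intro x
      rw [Finset.sum_eq_single x]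
      · exact ind_true rfl
      · intro y _ hy; exact ind_false (fun h => hy h.symm)
      · simp
    simp only [this]; simp
  have hs2 : ∑ p : Fin t × Fin t, ind (p.1 ≠ p.2 ∧ ¬ G.IsUniform ε (C p.1) (C p.2)) ≤ t^2 * ε := by
    rw [← card_fil]
    have h1 : #(fil univ (fun p : Fin t × Fin t => p.1 ≠ p.2 ∧ ¬ G.IsUniform ε (C p.1) (C p.2)))
        ≤ #(P.nonUniforms G ε) := by
      apply card_le_card_of_injOn (fun p => (C p.1, C p.2))
      · rintro ⟨a, b⟩ hp
        simp only [mem_coe, mem_fil, mem_univ, true_and] at hp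
        simp only [mem_coe, Finpartition.nonUniforms, mem_filter, mem_offDiag]
        exact ⟨⟨(e.symm a).2, (e.symm b).2, fun h => hp.1 (hCinj _ _ h)⟩, hp.2⟩
      · rintro ⟨a, b⟩ _ ⟨a', b'⟩ _ h
        simp only [Prod.mk.injEq] at h ⊢
        exact ⟨hCinj _ _ h.1, hCinj _ _ h.2⟩
    have h2 : (#(P.nonUniforms G ε) : ℝ) ≤ ((t * (t - 1) : ℕ) : ℝ) * ε := by rw [ht]; exact hPu
    have h3 : ((t * (t - 1) : ℕ) : ℝ) ≤ t^2 := by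
      have : t * (t-1) ≤ t^2 := by rw [sq]; exact Nat.mul_le_mul_left _ (by omega)
      exact_mod_cast this
    calc _ ≤ (#(P.nonUniforms G ε) : ℝ) := Nat.cast_le.2 h1
      _ ≤ _ := h2
      _ ≤ _ := by gcongr
  have hs3 : ∑ p : Fin t × Fin t, (#(C p.1) * #(C p.2) : ℝ) = (n:ℝ)^2 := by
    rw [Fintype.sum_prod_type]
    simp only
    rw [← Finset.sum_mul_sum]
    have : ∑ a, (#(C a) : ℝ) = n := by
      have h := Finset.card_eq_sum_card_fiberwise (s := (univ : Finset V)) 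
        (t := (univ : Finset (Fin t))) (f := f) (fun _ _ => by simp)
      rw [hn', ← card_univ, h]
      push_cast
      apply sum_congr rfl
      intro a _
      rw [← hfC]; congr 2; ext x; simp [mem_fil]
    rw [this, sq]
  rw [hsplit]
  calc _ ≤ ∑ p : Fin t × Fin t, (ind (p.1 = p.2) * (2 * n / t)^2 + ind (p.1 ≠ p.2 ∧ ¬ G.IsUniform ε (C p.1) (C p.2)) * (2 * n / t)^2
        + η * (#(C p.1) * #(C p.2))) := sum_le_sum (fun p _ => hpair p)
    _ ≤ t * (2 * n / t)^2 + (t^2 * ε) * (2 * n / t)^2 + η * n^2 := by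
      rw [sum_add_distrib, sum_add_distrib, ← sum_mul, ← sum_mul, ← mul_sum, hs1, hs3]
      gcongr
    _ = (4 / t + 4 * ε + η) * n^2 := arith7 _ _ _ _ ht0'.ne'
    _ ≤ κ * n^2 := by
      gcongr
      have : (4:ℝ) / t ≤ κ / 4 := by
        rw [div_le_iff₀ ht0']
        have h1 : (l:ℝ) ≤ t := by exact_mod_cast hlP
        rw [div_lt_iff₀ hκ] at hl
        nlinarith
      linarith

end Szem
end WPN

namespace WPN
section Enc
open Finset Classical

/-- volume bound for Hamming balls -/
theorem vol (c : ℝ) (hc : 0 < c) : ∃ κ : ℝ, 0 < κ ∧ ∀ (α : Type) (P : Finset α) (N : ℝ), (#P : ℝ) ≤ N →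
    (#(fil P.powerset (fun F => (#F : ℝ) ≤ κ * N)) : ℝ) ≤ (2:ℝ) ^ (c * N) := by
  obtain ⟨x, hx0, hx1, hx⟩ : ∃ x : ℝ, 0 < x ∧ x < 1 ∧ 1 + x ≤ (2:ℝ) ^ (c/2) := by
    have h : (1:ℝ) < (2:ℝ) ^ (c/2) := Real.one_lt_rpow (by norm_num) (by linarith)
    refine ⟨min (1/2) ((2:ℝ) ^ (c/2) - 1), lt_min (by norm_num) (by linarith), ?_, ?_⟩
    · exact lt_of_le_of_lt (min_le_left _ _) (by norm_num)
    · linarith [min_le_right (1/2 : ℝ) ((2:ℝ) ^ (c/2) - 1)]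
  have hl : 0 < Real.logb 2 (1/x) := Real.logb_pos (by norm_num) (by rw [lt_div_iff₀ hx0]; linarith)
  refine ⟨c / 2 / Real.logb 2 (1/x), by positivity, ?_⟩
  intro α P N hN
  have hN0 : 0 ≤ N := le_trans (Nat.cast_nonneg _) hN
  set κ := c / 2 / Real.logb 2 (1/x) with hκ
  have hxk : x ^ (κ * N) = (2:ℝ) ^ (-(c/2 * N)) := by
    have : x = (2:ℝ) ^ (- Real.logb 2 (1/x)) := by
      rw [Real.rpow_neg (by norm_num), Real.rpow_logb (by norm_num) (by norm_num) (by positivity)]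
      simp
    conv_lhs => rw [this]
    rw [← Real.rpow_mul (by norm_num)]
    congr 1
    rw [hκ]; field_simp
  have h1 : (#(fil P.powerset (fun F => (#F : ℝ) ≤ κ * N)) : ℝ) * x ^ (κ * N) ≤ (1 + x) ^ #P := by
    have h2 : (1 + x) ^ #P = ∑ F ∈ P.powerset, x ^ #F := by
      have := Finset.sum_pow_mul_eq_add_pow x 1 P
      simp only [one_pow, mul_one] at this
      rw [this, add_comm]
    rw [h2]
    calc _ = ∑ F ∈ fil P.powerset (fun F => (#F : ℝ) ≤ κ * N), x ^ (κ * N) := by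
            rw [sum_const, nsmul_eq_mul]
      _ ≤ ∑ F ∈ fil P.powerset (fun F => (#F : ℝ) ≤ κ * N), x ^ #F := by
            apply sum_le_sum
            intro F hF
            rw [← Real.rpow_natCast]
            exact Real.rpow_le_rpow_of_exponent_ge hx0 hx1.le (mem_fil.1 hF).2
      _ ≤ _ := sum_le_sum_of_subset_of_nonneg fil_subset (fun F _ _ => by positivity)
  rw [hxk] at h1
  have h3 : (1 + x) ^ #P ≤ (2:ℝ) ^ (c/2 * N) := by
    calc (1 + x) ^ #P = (1 + x) ^ (#P : ℝ) := (Real.rpow_natCast _ _).symm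
      _ ≤ (1 + x) ^ N := Real.rpow_le_rpow_of_exponent_le (by linarith) hN
      _ ≤ ((2:ℝ) ^ (c/2)) ^ N := Real.rpow_le_rpow (by linarith) hx hN0
      _ = _ := by rw [← Real.rpow_mul (by norm_num)]
  have h4 : (2:ℝ) ^ (c * N) = (2:ℝ) ^ (c/2 * N) * (2:ℝ) ^ (c/2 * N) := by
    rw [← Real.rpow_add (by norm_num)]; congr 1; ring
  rw [h4]
  have h5 : (2:ℝ) ^ (-(c/2 * N)) * (2:ℝ) ^ (c/2 * N) = 1 := by
    rw [← Real.rpow_add (by norm_num)]; simp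
  have h6 : (0:ℝ) < (2:ℝ) ^ (c/2 * N) := by positivity
  calc _ = ((#(fil P.powerset (fun F => (#F : ℝ) ≤ κ * N)) : ℝ) * (2:ℝ) ^ (-(c/2 * N))) * (2:ℝ) ^ (c/2 * N) := by
        rw [mul_assoc, h5, mul_one]
    _ ≤ _ := mul_le_mul_of_nonneg_right (h1.trans h3) h6.le

/-- ordered pairs -/
noncomputable def PR (n : ℕ) : Finset (Fin n × Fin n) := fil univ (fun p => p.1 < p.2)

noncomputable def enc {n : ℕ} (G : SimpleGraph (Fin n)) : Finset (Fin n × Fin n) :=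
  fil (PR n) (fun p => G.Adj p.1 p.2)

noncomputable def CP {n r : ℕ} (S : Fin n → Fin r) : Finset (Fin n × Fin n) :=
  fil (PR n) (fun p => S p.1 ≠ S p.2)

noncomputable def IP {n r : ℕ} (S : Fin n → Fin r) : Finset (Fin n × Fin n) :=
  fil (PR n) (fun p => S p.1 = S p.2)

theorem enc_inj {n : ℕ} {G G' : SimpleGraph (Fin n)} (h : enc G = enc G') : G = G' := by
  have key : ∀ u v : Fin n, u < v → (G.Adj u v ↔ G'.Adj u v) := by
    intro u v huv
    have := congrArg (fun s => (u, v) ∈ s) h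
    simpa [enc, mem_fil, PR, huv] using this
  ext u v
  rcases lt_trichotomy u v with h1 | h1 | h1
  · exact key u v h1
  · subst h1; simp
  · rw [G.adj_comm, G'.adj_comm]; exact key v u h1

theorem adj_of_enc {n : ℕ} {G G' : SimpleGraph (Fin n)} {E : Finset (Fin n × Fin n)}
    (h : enc G \ E = enc G' \ E) {u v : Fin n} (h1 : (u, v) ∉ E) (h2 : (v, u) ∉ E) :
    G.Adj u v ↔ G'.Adj u v := by
  have key : ∀ u v : Fin n, u < v → (u, v) ∉ E → (G.Adj u v ↔ G'.Adj u v) := by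
    intro u v huv hE
    have := congrArg (fun s => (u, v) ∈ s) h
    simpa [enc, mem_fil, PR, huv, hE] using this
  rcases lt_trichotomy u v with h3 | h3 | h3
  · exact key u v h3 h1
  · subst h3; simp
  · rw [G.adj_comm, G'.adj_comm]; exact key v u h3 h2

theorem two_card_PR {n : ℕ} (Q : Fin n → Fin n → Prop) (hs : ∀ u v, Q u v → Q v u) (hi : ∀ u, ¬ Q u u) :
    2 * (#(fil (PR n) (fun p => Q p.1 p.2)) : ℝ) = ∑ u, ∑ v, ind (Q u v) := by
  have h1 : ∑ u, ∑ v, ind (Q u v) = ∑ p : Fin n × Fin n, ind (Q p.1 p.2) := by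
    rw [Fintype.sum_prod_type]
  rw [h1]
  have h2 : ∀ p : Fin n × Fin n, ind (Q p.1 p.2) = ind (p.1 < p.2 ∧ Q p.1 p.2) + ind (p.2 < p.1 ∧ Q p.1 p.2) := by
    rintro ⟨u, v⟩
    rcases lt_trichotomy u v with h | h | h
    · by_cases hq : Q u v
      · rw [ind_true hq, ind_true (p := (u,v).1 < (u,v).2 ∧ Q u v) ⟨h, hq⟩, ind_false (p := (u,v).2 < (u,v).1 ∧ Q u v) (fun h' => absurd h'.1 h.asymm)]; norm_num
      · rw [ind_false hq, ind_false (p := (u,v).1 < (u,v).2 ∧ Q u v) (fun h' => hq h'.2), ind_false (p := (u,v).2 < (u,v).1 ∧ Q u v) (fun h' => hq h'.2)]; norm_num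
    · subst h
      have hq := hi u
      rw [ind_false hq, ind_false (p := (u,u).1 < (u,u).2 ∧ Q u u) (fun h' => hq h'.2)]; norm_num
    · by_cases hq : Q u v
      · rw [ind_true hq, ind_true (p := (u,v).2 < (u,v).1 ∧ Q u v) ⟨h, hq⟩, ind_false (p := (u,v).1 < (u,v).2 ∧ Q u v) (fun h' => absurd h'.1 h.asymm)]; norm_num
      · rw [ind_false hq, ind_false (p := (u,v).1 < (u,v).2 ∧ Q u v) (fun h' => hq h'.2), ind_false (p := (u,v).2 < (u,v).1 ∧ Q u v) (fun h' => hq h'.2)]; norm_num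
  rw [sum_congr rfl (fun p _ => h2 p), sum_add_distrib]
  have h3 : ∑ p : Fin n × Fin n, ind (p.2 < p.1 ∧ Q p.1 p.2) = ∑ p : Fin n × Fin n, ind (p.1 < p.2 ∧ Q p.1 p.2) := by
    refine Fintype.sum_equiv (Equiv.prodComm _ _) _ _ ?_
    rintro ⟨u, v⟩
    simp only [Equiv.prodComm_apply, Prod.swap]
    congr 1
    simp only [eq_iff_iff]
    exact ⟨fun h => ⟨h.1, hs _ _ h.2⟩, fun h => ⟨h.1, hs _ _ h.2⟩⟩
  rw [h3, ← card_fil]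
  have h4 : fil (PR n) (fun p => Q p.1 p.2) = fil univ (fun p : Fin n × Fin n => p.1 < p.2 ∧ Q p.1 p.2) := by
    ext p; simp [PR, mem_fil]
  rw [h4]; ring

theorem card_CP {n r : ℕ} (hr : 0 < r) (S : Fin n → Fin r) :
    (#(CP S) : ℝ) = (1 - 1/(r:ℝ)) * n^2 / 2 - (∑ i, ((#(fil univ (fun v => S v = i)) : ℝ) - n / r)^2) / 2 := by
  have h := two_card_PR (fun u v => S u ≠ S v) (fun u v h => h.symm) (fun u h => h rfl)
  have h' := cross_identity r hr S
  simp only [Fintype.card_fin] at h'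
  rw [h'] at h
  unfold CP
  linarith

theorem card_CP_le {n r : ℕ} (hr : 0 < r) (S : Fin n → Fin r) :
    (#(CP S) : ℝ) ≤ (1 - 1/(r:ℝ)) * n^2 / 2 := by
  rw [card_CP hr]
  have : 0 ≤ ∑ i, ((#(fil univ (fun v => S v = i)) : ℝ) - n / r)^2 := sum_nonneg (fun _ _ => sq_nonneg _)
  linarith

theorem card_PR_le (n : ℕ) : (#(PR n) : ℝ) ≤ (n:ℝ)^2 := by
  have : #(PR n) ≤ n^2 := by
    refine (card_le_card fil_subset).trans ?_
    simp [sq]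
  exact_mod_cast this

/-- the fibre bound without constraints -/
theorem fibre_card {n : ℕ} (E : Finset (Fin n × Fin n)) (𝒢 : Finset (SimpleGraph (Fin n)))
    (G0 : SimpleGraph (Fin n)) (h : ∀ G ∈ 𝒢, enc G \ E = enc G0 \ E) : (#𝒢 : ℝ) ≤ (2:ℝ) ^ (#E : ℝ) := by
  have h1 : #𝒢 ≤ #E.powerset := by
    apply card_le_card_of_injOn (fun G => enc G ∩ E)
    · intro G hG; simp
    · intro G hG G' hG' hh
      apply enc_inj
      have h2 := (h G hG).trans (h G' hG').symm
      rw [← Finset.sdiff_union_inter (enc G) E, ← Finset.sdiff_union_inter (enc G') E, h2]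
      dsimp only at hh
      rw [hh]
  rw [card_powerset] at h1
  rw [Real.rpow_natCast]
  exact_mod_cast h1

/-- classical image -/
noncomputable def img {X Y : Type} (φ : X → Y) (s : Finset X) : Finset Y := s.image φ

theorem mem_img {X Y : Type} {φ : X → Y} {s : Finset X} {y : Y} : y ∈ img φ s ↔ ∃ x ∈ s, φ x = y := by
  simp [img]

theorem count_cert {X Y Λ : Type} [Fintype Λ] (𝒢 : Finset X) (P : Λ → X → Prop)
    (hP : ∀ G ∈ 𝒢, ∃ l, P l G) (φ : Λ → X → Y) (A N : ℝ) (hN0 : 0 ≤ N)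
    (hA : ∀ l, (#(img (φ l) (fil 𝒢 (P l))) : ℝ) ≤ A)
    (hN : ∀ l, ∀ G0 ∈ 𝒢, P l G0 → (#(fil 𝒢 (fun G => P l G ∧ φ l G = φ l G0)) : ℝ) ≤ N) :
    (#𝒢 : ℝ) ≤ Fintype.card Λ * A * N := by
  have h1 : 𝒢 ⊆ (univ : Finset Λ).biUnion (fun l => fil 𝒢 (P l)) := by
    intro G hG
    obtain ⟨l, hl⟩ := hP G hG
    simp only [mem_biUnion, mem_univ, true_and]
    exact ⟨l, mem_fil.2 ⟨hG, hl⟩⟩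
  have h2 : ∀ l, (#(fil 𝒢 (P l)) : ℝ) ≤ A * N := by
    intro l
    have h3 := Finset.card_eq_sum_card_fiberwise (s := fil 𝒢 (P l)) (t := img (φ l) (fil 𝒢 (P l)))
      (f := φ l) (fun G hG => mem_coe.2 (mem_img.2 ⟨G, mem_coe.1 hG, rfl⟩))
    rw [h3]
    push_cast
    calc _ ≤ ∑ b ∈ img (φ l) (fil 𝒢 (P l)), N := by
          apply sum_le_sum
          intro b hb
          obtain ⟨G0, hG0, rfl⟩ := mem_img.1 hb
          refine le_trans (le_of_eq ?_) (hN l G0 (mem_fil.1 hG0).1 (mem_fil.1 hG0).2)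
          congr 2
          ext G; simp [mem_fil, and_assoc]
      _ = #(img (φ l) (fil 𝒢 (P l))) * N := by rw [sum_const, nsmul_eq_mul]
      _ ≤ _ := mul_le_mul_of_nonneg_right (hA l) hN0
  calc (#𝒢 : ℝ) ≤ #((univ : Finset Λ).biUnion (fun l => fil 𝒢 (P l))) := Nat.cast_le.2 (card_le_card h1)
    _ ≤ ((∑ l : Λ, #(fil 𝒢 (P l)) : ℕ) : ℝ) := Nat.cast_le.2 card_biUnion_le
    _ = ∑ l : Λ, (#(fil 𝒢 (P l)) : ℝ) := by push_cast; rfl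
    _ ≤ ∑ l : Λ, A * N := sum_le_sum (fun l _ => h2 l)
    _ = _ := by rw [sum_const, nsmul_eq_mul, card_univ]; ring

/-- finset of graphs with a property -/
noncomputable def gr (n : ℕ) (p : SimpleGraph (Fin n) → Prop) : Finset (SimpleGraph (Fin n)) := fil univ p

theorem mem_gr {n : ℕ} {p : SimpleGraph (Fin n) → Prop} {G} : G ∈ gr n p ↔ p G := by simp [gr, mem_fil]

/-- an event which is negligible -/
def Negl (r : ℕ) (p : ∀ n : ℕ, SimpleGraph (Fin n) → Prop) : Prop :=
  ∃ N : ℕ, ∀ n : ℕ, N ≤ n → (#(gr n (p n)) : ℝ) ≤ (2:ℝ) ^ ((1 - 1/(r:ℝ)) * n^2 / 2 - 2 * n)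

/-- inside approximations: image bound -/
theorem approx_image {n : ℕ} (c κ : ℝ)
    (hv : ∀ (α : Type) (P : Finset α) (N : ℝ), (#P : ℝ) ≤ N →
    (#(fil P.powerset (fun F => (#F : ℝ) ≤ κ * N)) : ℝ) ≤ (2:ℝ) ^ (c * N))
    (E : Finset (Fin n × Fin n)) (D : Fin n → Fin n → Prop) (𝒢 : Finset (SimpleGraph (Fin n)))
    (h : ∀ G ∈ 𝒢, (#(fil (PR n \ E) (fun p => ¬ (G.Adj p.1 p.2 ↔ D p.1 p.2))) : ℝ) ≤ κ * n^2) :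
    (#(img (fun G => enc G \ E) 𝒢) : ℝ) ≤ (2:ℝ) ^ (c * n^2) := by
  have h1 := hv _ (PR n \ E) (n^2) ((Nat.cast_le.2 (card_le_card sdiff_subset)).trans (card_PR_le n))
  refine le_trans (Nat.cast_le.2 ?_) h1
  set Dp := fil (PR n \ E) (fun p => D p.1 p.2) with hDp
  apply card_le_card_of_injOn (fun F => symmDiff F Dp)
  · intro F hF
    obtain ⟨G, hG, rfl⟩ := mem_img.1 (mem_coe.1 hF)
    have : symmDiff (enc G \ E) Dp = fil (PR n \ E) (fun p => ¬ (G.Adj p.1 p.2 ↔ D p.1 p.2)) := by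
      ext p
      simp only [hDp, mem_symmDiff, Finset.mem_sdiff, mem_fil, enc]
      tauto
    rw [mem_coe, mem_fil, mem_powerset]
    dsimp only
    rw [this]
    exact ⟨fil_subset, h G hG⟩
  · intro F _ F' _ hh
    exact symmDiff_left_injective Dp hh

end Enc
end WPN

namespace WPN
section WSsec
open Finset Classical

theorem fiber_sum {V : Type} [Fintype V] {t : ℕ} (f : V → Fin t) (M : ℝ)
    (hM : ∀ a, (#(fil univ (fun v => f v = a)) : ℝ) ≤ M) (g : Fin t → Fin t → ℝ) (hg : ∀ a b, 0 ≤ g a b) :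
    ∑ u, ∑ v, g (f u) (f v) ≤ (∑ a, ∑ b, g a b) * M^2 := by
  have key : ∀ (k : Fin t → ℝ), (∀ a, 0 ≤ k a) → ∑ u, k (f u) ≤ (∑ a, k a) * M := by
    intro k hk
    rw [← Finset.sum_fiberwise_of_maps_to (s := univ) (t := univ) (g := f) (fun _ _ => mem_univ _), sum_mul]
    apply sum_le_sum
    intro a _
    calc _ = ∑ x ∈ fil univ (fun v => f v = a), k a := by
          apply sum_congr
          · ext x; simp [mem_fil]
          · intro x hx; rw [(mem_fil.1 hx).2]
      _ = #(fil univ (fun v => f v = a)) * k a := by rw [sum_const, nsmul_eq_mul]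
      _ ≤ k a * M := by rw [mul_comm]; exact mul_le_mul_of_nonneg_left (hM a) (hk a)
  have hM0 : ∀ a : Fin t, 0 ≤ M := fun a => le_trans (Nat.cast_nonneg _) (hM a)
  calc _ ≤ ∑ u, (∑ b, g (f u) b) * M := sum_le_sum (fun u _ => key (g (f u)) (hg _))
    _ = (∑ u, ∑ b, g (f u) b) * M := by rw [sum_mul]
    _ ≤ ((∑ a, ∑ b, g a b) * M) * M := by
        by_cases h : Nonempty (Fin t)
        · exact mul_le_mul_of_nonneg_right (key (fun a => ∑ b, g a b) (fun a => sum_nonneg (fun b _ => hg a b))) (hM0 h.some)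
        · rw [not_nonempty_iff] at h
          have : IsEmpty V := ⟨fun v => h.elim (f v)⟩
          simp
    _ = _ := by ring

theorem ev_quad (a C : ℝ) (ha : 0 < a) : ∃ N : ℕ, ∀ n : ℕ, N ≤ n → C * n + C ≤ a * (n:ℝ)^2 := by
  obtain ⟨N, hN⟩ := exists_nat_gt ((2 * |C|) / a)
  refine ⟨N + 1, fun n hn => ?_⟩
  have h1 : (N:ℝ) + 1 ≤ n := by exact_mod_cast hn
  rw [div_lt_iff₀ ha] at hN
  have h2 : C ≤ |C| := le_abs_self C
  have h3 : 0 ≤ |C| := abs_nonneg C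
  have h4 : (1:ℝ) ≤ n := by have : (0:ℝ) ≤ N := Nat.cast_nonneg _
                            linarith
  have h5 : 2 * |C| ≤ a * n := by nlinarith
  nlinarith

/-- low certificate type -/
abbrev LowCert (T n : ℕ) : Type := Σ t : Fin (T+1), (Fin n → Fin t) × SimpleGraph (Fin t) × (Fin t → Fin t → Prop)

theorem nat_le_two_rpow (m : ℕ) : (m:ℝ) ≤ (2:ℝ) ^ (m:ℝ) := by
  rw [Real.rpow_natCast]
  exact_mod_cast Nat.lt_two_pow_self.le

theorem pow_le_two_rpow (T n : ℕ) : ((T^n : ℕ):ℝ) ≤ (2:ℝ) ^ ((T:ℝ) * n) := by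
  rw [Real.rpow_mul (by norm_num), Real.rpow_natCast]
  push_cast
  exact pow_le_pow_left₀ (Nat.cast_nonneg _) (nat_le_two_rpow T) n

theorem card_LowCert (T : ℕ) : ∃ C : ℝ, ∀ n : ℕ, (Fintype.card (LowCert T n) : ℝ) ≤ (2:ℝ) ^ (C * n + C) := by
  let c : ℕ := ∑ t : Fin (T+1), Fintype.card (SimpleGraph (Fin t)) * Fintype.card (Fin t → Fin t → Prop)
  refine ⟨c + T, fun n => ?_⟩
  have h1 : Fintype.card (LowCert T n) ≤ T^n * c := by
    unfold LowCert
    rw [Fintype.card_sigma, Finset.mul_sum]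
    apply sum_le_sum
    intro t _
    rw [Fintype.card_prod, Fintype.card_prod]
    apply Nat.mul_le_mul_right
    simp only [Fintype.card_fun, Fintype.card_fin]
    exact Nat.pow_le_pow_left (by omega) n
  calc (Fintype.card (LowCert T n) : ℝ) ≤ ((T^n : ℕ) : ℝ) * c := by exact_mod_cast h1
    _ ≤ (2:ℝ) ^ ((T:ℝ) * n) * (2:ℝ) ^ (c:ℝ) := by
        apply mul_le_mul (pow_le_two_rpow T n) (nat_le_two_rpow c) (Nat.cast_nonneg _) (by positivity)
    _ = (2:ℝ) ^ ((T:ℝ) * n + c) := by rw [← Real.rpow_add (by norm_num)]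
    _ ≤ _ := by
        apply Real.rpow_le_rpow_of_exponent_le (by norm_num)
        have : (0:ℝ) ≤ n := Nat.cast_nonneg _
        have : (0:ℝ) ≤ c := Nat.cast_nonneg _
        have : (0:ℝ) ≤ T := Nat.cast_nonneg _
        nlinarith

/-- weak structure -/
def WS {n : ℕ} (r T : ℕ) (κ : ℝ) (G : SimpleGraph (Fin n)) : Prop :=
  ∃ t ≤ T, ∃ (f : Fin n → Fin t) (U : Fin t → Fin r) (D : Fin t → Fin t → Prop),
    (#(fil (univ : Finset (Fin n × Fin n)) (fun q => U (f q.1) = U (f q.2) ∧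
      ¬ (G.Adj q.1 q.2 ↔ D (f q.1) (f q.2)))) : ℝ) ≤ κ * n^2

set_option maxHeartbeats 1000000 in
theorem ws_negl {VH : Type} [Fintype VH] (H : SimpleGraph VH) (r : ℕ) (hr : IsWpn H r) (hr0 : 0 < r)
    (κ' : ℝ) (hκ' : 0 < κ') : ∃ T, Negl r (fun n G => IndFree H G ∧ ¬ WS r T κ' G) := by
  set β := κ' / 8 with hβ
  have hβ0 : 0 < β := by positivity
  obtain ⟨κ0, hκ0, hv⟩ := vol (β/8) (by positivity)
  obtain ⟨κ, hκpos, hκ1, hκ2⟩ : ∃ κ : ℝ, 0 < κ ∧ κ ≤ κ0 ∧ κ ≤ κ' / 2 :=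
    ⟨min κ0 (κ'/2), by positivity, min_le_left _ _, min_le_right _ _⟩
  obtain ⟨T, n0, hS⟩ := szem H r hr κ hκpos
  refine ⟨T, ?_⟩
  obtain ⟨C, hC⟩ := card_LowCert T
  obtain ⟨N1, hN1⟩ := ev_quad (β/8) (|C| + 2 + (2*T+T^2)) (by positivity)
  refine ⟨max (max n0 N1) (T+1), fun n hn => ?_⟩
  have hn0 : n0 ≤ n := le_trans (le_trans (le_max_left _ _) (le_max_left _ _)) hn
  have hnN : N1 ≤ n := le_trans (le_trans (le_max_right _ _) (le_max_left _ _)) hn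
  have hnT : T + 1 ≤ n := le_trans (le_max_right _ _) hn
  have hn1 := hN1 n hnN
  have hr1 : (0:ℝ) ≤ 1 - 1/(r:ℝ) := by
    have : (1:ℝ) ≤ r := by exact_mod_cast hr0
    have : 1/(r:ℝ) ≤ 1 := by rw [div_le_one (by linarith)]; exact this
    linarith
  have hr1' : 1 - 1/(r:ℝ) ≤ 1 := by
    have : (0:ℝ) ≤ 1/(r:ℝ) := by positivity
    linarith
  let P : LowCert T n → SimpleGraph (Fin n) → Prop := fun l G =>
    (#(fil (PR n) (fun p => l.2.2.1.Adj (l.2.1 p.1) (l.2.1 p.2))) : ℝ) ≤ (1 - 1/(r:ℝ)) * n^2 / 2 - β/2 * n^2 + (T * n + T^2) ∧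
    (#(fil (univ : Finset (Fin n × Fin n)) (fun q => ¬ l.2.2.1.Adj (l.2.1 q.1) (l.2.1 q.2) ∧
      ¬ (G.Adj q.1 q.2 ↔ l.2.2.2 (l.2.1 q.1) (l.2.1 q.2)))) : ℝ) ≤ κ * n^2
  let Efn : LowCert T n → Finset (Fin n × Fin n) := fun l =>
    fil (PR n) (fun p => l.2.2.1.Adj (l.2.1 p.1) (l.2.1 p.2))
  have hcc := count_cert (gr n (fun G => IndFree H G ∧ ¬ WS r T κ' G)) P ?_ (fun l G => enc G \ Efn l)
    ((2:ℝ) ^ (β/8 * n^2)) ((2:ℝ) ^ ((1 - 1/(r:ℝ)) * n^2 / 2 - β/2 * n^2 + (T * n + T^2))) (by positivity) ?_ ?_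
  · refine hcc.trans ?_
    have hpos : (0:ℝ) < 2 := by norm_num
    calc _ ≤ (2:ℝ) ^ (C * n + C) * ((2:ℝ) ^ (β/8 * n^2)) * ((2:ℝ) ^ ((1 - 1/(r:ℝ)) * n^2 / 2 - β/2 * n^2 + (T * n + T^2))) := by
            have := hC n
            apply mul_le_mul_of_nonneg_right _ (Real.rpow_nonneg hpos.le _)
            exact mul_le_mul_of_nonneg_right this (Real.rpow_nonneg hpos.le _)
      _ = (2:ℝ) ^ ((C * n + C) + (β/8 * n^2) + ((1 - 1/(r:ℝ)) * n^2 / 2 - β/2 * n^2 + (T * n + T^2))) := by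
            rw [← Real.rpow_add hpos, ← Real.rpow_add hpos]
      _ ≤ _ := by
            apply Real.rpow_le_rpow_of_exponent_le (by norm_num)
            have hCn : C * n ≤ |C| * n := mul_le_mul_of_nonneg_right (le_abs_self C) (Nat.cast_nonneg _)
            have hCC := le_abs_self C
            have hT : (0:ℝ) ≤ T := Nat.cast_nonneg _
            have hnn : (0:ℝ) ≤ n := Nat.cast_nonneg _
            have e1 : (0:ℝ) ≤ (T:ℝ) * n := mul_nonneg hT hnn
            have e2 : (0:ℝ) ≤ (T:ℝ)^2 * n := by positivity
            have e3 : (0:ℝ) ≤ β * (n:ℝ)^2 := by positivity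
            have e4 : 0 ≤ |C| := abs_nonneg C
            linarith
  · intro G hG
    obtain ⟨hG1, hG2⟩ := mem_gr.1 hG
    obtain ⟨t, ht0, htT, f, hf, R, hR, D, hD⟩ := hS (Fin n) (by simpa using hn0) G hG1
    simp only [Fintype.card_fin] at hf hD
    obtain ⟨U, hU⟩ := furedi R r hr0 hR
    simp only [Fintype.card_fin] at hU
    have ht0' : (0:ℝ) < t := by exact_mod_cast ht0
    have htT' : (t:ℝ) ≤ T := by exact_mod_cast htT
    have hn' : (T:ℝ) + 1 ≤ n := by exact_mod_cast hnT
    have hM : ∀ a, (#(fil univ (fun v => f v = a)) : ℝ) ≤ n / t + 1 := by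
      intro a
      have h1 : (#(fil univ (fun v => f v = a)) : ℝ) ≤ ((n / t : ℕ) : ℝ) + 1 := by exact_mod_cast hf a
      have h2 : ((n / t : ℕ) : ℝ) ≤ (n : ℝ) / t := Nat.cast_div_le
      linarith
    have hMsq : (t:ℝ)^2 * ((n:ℝ) / t + 1)^2 = (n + t)^2 := by field_simp
    set ER := ∑ a, ∑ b, ind (R.Adj a b) with hER
    have hERn : (0:ℝ) ≤ ((n:ℝ)/t + 1)^2 := sq_nonneg _
    by_cases hlow : ER ≤ (1 - 1/(r:ℝ)) * t^2 - β * t^2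
    · refine ⟨⟨⟨t, by omega⟩, f, R, D⟩, ?_, ?_⟩
      · show (#(fil (PR n) (fun p => R.Adj (f p.1) (f p.2))) : ℝ) ≤ _
        have h2 := two_card_PR (fun u v => R.Adj (f u) (f v)) (fun u v h => h.symm) (fun u h => R.loopless.irrefl _ h)
        have h3 := fiber_sum f _ hM (fun a b => ind (R.Adj a b)) (fun a b => ind_nonneg _)
        have h4 : ER * ((n:ℝ)/t + 1)^2 ≤ ((1 - 1/(r:ℝ)) - β) * (n + t)^2 := by
          rw [← hMsq, ← mul_assoc]
          apply mul_le_mul_of_nonneg_right _ hERn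
          linarith
        have h5 : ((1 - 1/(r:ℝ)) - β) * (n + t)^2 ≤ ((1 - 1/(r:ℝ)) - β) * n^2 + (2 * (T * n) + T^2) := by
          have e1 : ((n:ℝ)+t)^2 - n^2 = 2 * (t * n) + t^2 := by ring
          have e2 : (t:ℝ) * n ≤ T * n := mul_le_mul_of_nonneg_right htT' (Nat.cast_nonneg _)
          have e3 : (t:ℝ)^2 ≤ T^2 := pow_le_pow_left₀ ht0'.le htT' 2
          have e4 : 0 ≤ (t:ℝ) * n := mul_nonneg ht0'.le (Nat.cast_nonneg _)
          have e5 : 0 ≤ (t:ℝ)^2 := sq_nonneg _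
          have e6 : ((1 - 1/(r:ℝ)) - β) * (2 * (t * n) + t^2) ≤ 1 * (2 * (t * n) + t^2) :=
            mul_le_mul_of_nonneg_right (by linarith) (by linarith)
          have e7 : ((1 - 1/(r:ℝ)) - β) * (n + t)^2 = ((1 - 1/(r:ℝ)) - β) * n^2 + ((1 - 1/(r:ℝ)) - β) * (2 * (t * n) + t^2) := by ring
          linarith
        have e8 : (0:ℝ) ≤ (T:ℝ)^2 := sq_nonneg _
        have h6 := h2.trans_le (h3.trans (h4.trans h5))
        have h7 : ((1 - 1/(r:ℝ)) - β) * (n:ℝ)^2 = (1 - 1/(r:ℝ)) * (n:ℝ)^2 - β * (n:ℝ)^2 := by ring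
        rw [h7] at h6
        have h8 : (1 - 1/(r:ℝ)) * (n:ℝ)^2 / 2 - β / 2 * (n:ℝ)^2 = ((1 - 1/(r:ℝ)) * (n:ℝ)^2 - β * (n:ℝ)^2)/2 := by ring
        rw [h8]
        linarith
      · exact hD
    · exfalso
      push Not at hlow
      apply hG2
      refine ⟨t, htT, f, U, D, ?_⟩
      have h1 : ∑ a, ∑ b, ind (R.Adj a b ∧ U a = U b) ≤ β * t^2 := by linarith
      have h3 := fiber_sum f _ hM (fun a b => ind (R.Adj a b ∧ U a = U b)) (fun a b => ind_nonneg _)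
      have h4 : (∑ a, ∑ b, ind (R.Adj a b ∧ U a = U b)) * ((n:ℝ)/t + 1)^2 ≤ β * (n + t)^2 := by
        rw [← hMsq, ← mul_assoc]
        exact mul_le_mul_of_nonneg_right h1 hERn
      have h5 : ((n:ℝ) + t)^2 ≤ 4 * n^2 := by
        have : (n:ℝ) + t ≤ 2 * n := by linarith
        have := pow_le_pow_left₀ (by positivity) this 2
        linarith
      have h6 : (#(fil (univ : Finset (Fin n × Fin n)) (fun q => R.Adj (f q.1) (f q.2) ∧ U (f q.1) = U (f q.2))) : ℝ)
          ≤ κ' / 2 * n^2 := by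
        rw [card_fil, Fintype.sum_prod_type]
        have : β * (4 * (n:ℝ)^2) = κ'/2 * n^2 := by rw [hβ]; ring
        have h7 : β * ((n:ℝ)+t)^2 ≤ β * (4 * (n:ℝ)^2) := mul_le_mul_of_nonneg_left h5 hβ0.le
        linarith
      have h7 : fil (univ : Finset (Fin n × Fin n)) (fun q => U (f q.1) = U (f q.2) ∧
          ¬ (G.Adj q.1 q.2 ↔ D (f q.1) (f q.2))) ⊆ 
          fil (univ : Finset (Fin n × Fin n)) (fun q => ¬ R.Adj (f q.1) (f q.2) ∧
          ¬ (G.Adj q.1 q.2 ↔ D (f q.1) (f q.2))) ∪ 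
          fil (univ : Finset (Fin n × Fin n)) (fun q => R.Adj (f q.1) (f q.2) ∧ U (f q.1) = U (f q.2)) := by
        intro q hq
        obtain ⟨_, ha, hb⟩ := mem_fil.1 hq
        rw [mem_union, mem_fil, mem_fil]
        by_cases h : R.Adj (f q.1) (f q.2)
        · exact Or.inr ⟨mem_univ _, h, ha⟩
        · exact Or.inl ⟨mem_univ _, h, hb⟩
      have h8 := Nat.cast_le (α := ℝ) |>.2 ((card_le_card h7).trans (card_union_le _ _))
      push_cast at h8
      have h9 : κ * (n:ℝ)^2 ≤ κ'/2 * n^2 := mul_le_mul_of_nonneg_right hκ2 (sq_nonneg _)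
      linarith
  · intro l
    apply approx_image (β/8) κ0 hv (Efn l) (fun u v => l.2.2.2 (l.2.1 u) (l.2.1 v))
    intro G hG
    have hP := (mem_fil.1 hG).2.2
    have hsub : fil (PR n \ Efn l) (fun p => ¬ (G.Adj p.1 p.2 ↔ l.2.2.2 (l.2.1 p.1) (l.2.1 p.2))) ⊆
      fil (univ : Finset (Fin n × Fin n)) (fun q => ¬ l.2.2.1.Adj (l.2.1 q.1) (l.2.1 q.2) ∧
      ¬ (G.Adj q.1 q.2 ↔ l.2.2.2 (l.2.1 q.1) (l.2.1 q.2))) := by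
      intro p hp
      simp only [mem_fil, Finset.mem_sdiff, Efn] at hp
      rw [mem_fil]
      exact ⟨mem_univ _, fun h => hp.1.2 ⟨hp.1.1, h⟩, hp.2⟩
    calc _ ≤ _ := Nat.cast_le.2 (card_le_card hsub)
      _ ≤ κ * (n:ℝ)^2 := hP
      _ ≤ κ0 * (n:ℝ)^2 := mul_le_mul_of_nonneg_right hκ1 (sq_nonneg _)
  · intro l G0 hG0 hP
    refine (fibre_card (Efn l) _ G0 ?_).trans ?_
    · intro G hG; exact (mem_fil.1 hG).2.2
    · exact Real.rpow_le_rpow_of_exponent_le (by norm_num) hP.1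

end WSsec
end WPN

namespace WPN
section Lower
open Finset Classical

theorem balanced (n r : ℕ) (hr : 0 < r) : ∃ S : Fin n → Fin r,
    ∀ i, |(#(fil univ (fun v => S v = i)) : ℝ) - n / r| ≤ 1 := by
  refine ⟨fun v => ⟨v.1 % r, Nat.mod_lt _ hr⟩, fun i => ?_⟩
  have h1 : #(fil univ (fun v : Fin n => (⟨v.1 % r, Nat.mod_lt _ hr⟩ : Fin r) = i)) = Nat.count (· ≡ i.1 [MOD r]) n := by
    rw [Nat.count_eq_card_filter_range]
    apply card_bij (fun v _ => v.1)
    · intro v hv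
      have := (mem_fil.1 hv).2
      rw [mem_filter, mem_range]
      refine ⟨v.2, ?_⟩
      have h2 := congrArg Fin.val this
      simp only at h2
      rw [Nat.ModEq, h2, Nat.mod_eq_of_lt i.2]
    · intro v _ w _ h; exact Fin.ext h
    · intro b hb
      rw [mem_filter, mem_range] at hb
      refine ⟨⟨b, hb.1⟩, ?_, rfl⟩
      rw [mem_fil]
      refine ⟨mem_univ _, Fin.ext ?_⟩
      have := hb.2
      rw [Nat.ModEq, Nat.mod_eq_of_lt i.2] at this
      exact this
  rw [h1, Nat.count_modEq_card n hr i.1]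
  have hr' : (0:ℝ) < r := by exact_mod_cast hr
  have h3 : (n:ℝ) / r = (n / r : ℕ) + ((n % r : ℕ):ℝ) / r := by
    rw [div_eq_iff hr'.ne', add_mul, div_mul_cancel₀ _ hr'.ne']
    have := Nat.div_add_mod n r
    have h : ((r * (n/r) + n % r : ℕ):ℝ) = n := by rw [this]
    push_cast at h; push_cast; linarith
  have h4 : ((n % r : ℕ):ℝ) / r ≤ 1 := by
    rw [div_le_one hr']; exact_mod_cast (Nat.mod_lt n hr).le
  have h5 : 0 ≤ ((n % r : ℕ):ℝ) / r := by positivity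
  rw [h3, abs_le]
  split_ifs <;> push_cast <;> constructor <;> linarith

/-- the graph with homogeneous classes and cross edges `F` -/
def cgraph {n r : ℕ} (S : Fin n → Fin r) (τ : Fin r → Prop) (F : Finset (Fin n × Fin n)) :
    SimpleGraph (Fin n) where
  Adj u v := u ≠ v ∧ ((S u = S v ∧ τ (S u)) ∨ (S u ≠ S v ∧ ((u, v) ∈ F ∨ (v, u) ∈ F)))
  symm := ⟨by
    rintro u v ⟨h, h2⟩
    refine ⟨h.symm, ?_⟩
    rcases h2 with ⟨h3, h4⟩ | ⟨h3, h4⟩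
    · exact Or.inl ⟨h3.symm, h3 ▸ h4⟩
    · exact Or.inr ⟨fun h => h3 h.symm, h4.symm⟩⟩
  loopless := ⟨fun u h => h.1 rfl⟩

theorem cgraph_free {VH : Type} (H : SimpleGraph VH) (c s : ℕ) (hcs : ¬ HasCSPartition H c s) {n : ℕ}
    (S : Fin n → Fin (c+s)) (F : Finset (Fin n × Fin n)) :
    IndFree H (cgraph S (fun i => i.1 < c) F) := by
  rintro ⟨e⟩
  apply hcs
  refine ⟨fun x => finSumFinEquiv.symm (S (e x)), ?_, ?_⟩
  · intro i x hx y hy hxy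
    simp only [Set.mem_setOf_eq, Equiv.symm_apply_eq] at hx hy
    rw [← e.map_adj_iff]
    refine ⟨fun h => hxy (e.injective h), Or.inl ⟨hx.trans hy.symm, ?_⟩⟩
    rw [hx]; simp
  · intro j x hx y hy hadj
    rw [Equiv.symm_apply_eq] at hx hy
    rw [← e.map_adj_iff] at hadj
    rcases hadj.2 with ⟨h1, h2⟩ | ⟨h1, h2⟩
    · rw [hx] at h2; simp at h2
    · exact h1 (hx.trans hy.symm)

theorem lower_bound {VH : Type} (H : SimpleGraph VH) (r : ℕ) (hr : IsWpn H r) (hr0 : 0 < r) (n : ℕ) :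
    (2:ℝ) ^ ((1 - 1/(r:ℝ)) * n^2 / 2 - r) ≤ #(gr n (fun G => IndFree H G)) := by
  obtain ⟨⟨c, s, hcs, hno⟩, _⟩ := hr
  subst hcs
  obtain ⟨S, hS⟩ := balanced n (c+s) hr0
  have h1 : #(CP S).powerset ≤ #(gr n (fun G => IndFree H G)) := by
    apply card_le_card_of_injOn (fun F => cgraph S (fun i => i.1 < c) F)
    · intro F _
      exact mem_coe.2 (mem_gr.2 (cgraph_free H c s hno S F))
    · intro F hF F' hF' h
      have key : ∀ F F' : Finset (Fin n × Fin n), F ⊆ CP S → F' ⊆ CP S → cgraph S (fun i => i.1 < c) F = cgraph S (fun i => i.1 < c) F' → F ⊆ F' := by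
        intro F F' hF hF' h p hp
        have hpc := mem_fil.1 (hF hp)
        have hlt : p.1 < p.2 := (mem_fil.1 hpc.1).2
        have h2 : (cgraph S (fun i => i.1 < c) F).Adj p.1 p.2 := ⟨hlt.ne, Or.inr ⟨hpc.2, Or.inl hp⟩⟩
        rw [h] at h2
        rcases h2.2 with ⟨h3, _⟩ | ⟨_, h3 | h3⟩
        · exact absurd h3 hpc.2
        · exact h3
        · have := (mem_fil.1 (mem_fil.1 (hF' h3)).1).2
          exact absurd this hlt.asymm
      have a := mem_powerset.1 (mem_coe.1 hF)
      have b := mem_powerset.1 (mem_coe.1 hF')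
      exact Subset.antisymm (key F F' a b h) (key F' F b a h.symm)
  rw [card_powerset] at h1
  have h2 : (2:ℝ) ^ (#(CP S) : ℝ) ≤ #(gr n (fun G => IndFree H G)) := by
    rw [Real.rpow_natCast]; exact_mod_cast h1
  refine le_trans ?_ h2
  apply Real.rpow_le_rpow_of_exponent_le (by norm_num)
  rw [card_CP hr0]
  have h3 : ∑ i, ((#(fil univ (fun v => S v = i)) : ℝ) - n / (c+s : ℕ))^2 ≤ ∑ i : Fin (c+s), (1:ℝ) := by
    apply sum_le_sum
    intro i _
    rw [← sq_abs]
    exact pow_le_one₀ (abs_nonneg _) (hS i)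
  rw [sum_const, card_univ, Fintype.card_fin, nsmul_eq_mul, mul_one] at h3
  have : (0:ℝ) ≤ ((c+s:ℕ):ℝ) := Nat.cast_nonneg _
  linarith

end Lower
end WPN

namespace WPN
section Blocks
open Finset Classical

theorem blocks {α ι : Type} [DecidableEq α] (q : ℕ) (J : Finset ι) (B : ι → Finset α) (π : ι → Finset α)
    (hq : ∀ j, #(B j) ≤ q) (hπ : ∀ j, π j ⊆ B j) : 
    ∀ (E : Finset α), (∀ j ∈ J, B j ⊆ E) → (∀ j ∈ J, ∀ j' ∈ J, j ≠ j' → Disjoint (B j) (B j')) →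
    (#(fil E.powerset (fun F => ∀ j ∈ J, F ∩ B j ≠ π j)) : ℝ) ≤ (1 - (1/2:ℝ)^q)^(#J) * 2^(#E) := by
  induction J using Finset.induction_on with
  | empty =>
    intro E _ _
    have := card_le_card (fil_subset : fil E.powerset (fun F => ∀ j ∈ (∅ : Finset ι), F ∩ B j ≠ π j) ⊆ _)
    rw [card_powerset] at this
    simpa using (by exact_mod_cast this : ((#(fil E.powerset (fun F => ∀ j ∈ (∅ : Finset ι), F ∩ B j ≠ π j)) : ℕ):ℝ) ≤ (2:ℝ)^(#E))
  | insert j J hj ih =>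
    intro E hE hd
    have hjE := hE j (mem_insert_self _ _)
    have ih' := ih (E \ B j) (fun k hk x hx => by
        rw [Finset.mem_sdiff]
        refine ⟨hE k (mem_insert_of_mem hk) hx, fun hx' => ?_⟩
        exact Finset.disjoint_left.1 (hd k (mem_insert_of_mem hk) j (mem_insert_self _ _) (fun h => hj (h ▸ hk))) hx hx')
      (fun k hk k' hk' h => hd k (mem_insert_of_mem hk) k' (mem_insert_of_mem hk') h)
    have h1 : #(fil E.powerset (fun F => ∀ k ∈ insert j J, F ∩ B k ≠ π k)) ≤
        #(((B j).powerset.erase (π j)) ×ˢ (fil (E \ B j).powerset (fun F => ∀ k ∈ J, F ∩ B k ≠ π k))) := by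
      apply card_le_card_of_injOn (fun F => (F ∩ B j, F \ B j))
      · intro F hF
        obtain ⟨hF1, hF2⟩ := mem_fil.1 (mem_coe.1 hF)
        rw [mem_powerset] at hF1
        rw [mem_coe, mem_product, mem_erase, mem_powerset, mem_fil, mem_powerset]
        refine ⟨⟨hF2 j (mem_insert_self _ _), inter_subset_right⟩, sdiff_subset_sdiff hF1 (Subset.refl _), ?_⟩
        intro k hk
        have : (F \ B j) ∩ B k = F ∩ B k := by
          ext x
          simp only [mem_inter, Finset.mem_sdiff]
          constructor
          · rintro ⟨⟨a, b⟩, c⟩; exact ⟨a, c⟩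
          · rintro ⟨a, c⟩
            refine ⟨⟨a, fun hx' => ?_⟩, c⟩
            exact Finset.disjoint_left.1 (hd k (mem_insert_of_mem hk) j (mem_insert_self _ _) (fun h => hj (h ▸ hk))) c hx'
        rw [this]
        exact hF2 k (mem_insert_of_mem hk)
      · intro F _ F' _ h
        simp only [Prod.mk.injEq] at h
        rw [← Finset.sdiff_union_inter F (B j), ← Finset.sdiff_union_inter F' (B j), h.1, h.2]
    rw [card_product, card_erase_of_mem (mem_powerset.2 (hπ j)), card_powerset] at h1
    have h2 : ((2 ^ #(B j) - 1 : ℕ):ℝ) ≤ (1 - (1/2:ℝ)^q) * 2^(#(B j)) := by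
      rw [Nat.cast_sub Nat.one_le_two_pow]
      push_cast
      have h3 : (1/2:ℝ)^q ≤ (1/2:ℝ)^(#(B j)) := pow_le_pow_of_le_one (by norm_num) (by norm_num) (hq j)
      have h4 : (1/2:ℝ)^(#(B j)) * 2^(#(B j)) = 1 := by rw [← mul_pow]; norm_num
      have h5 : (0:ℝ) < 2^(#(B j)) := by positivity
      nlinarith
    have h6 : #E = #(E \ B j) + #(B j) := by
      rw [card_sdiff_of_subset hjE]
      have := card_le_card hjE
      omega
    have h0 : (0:ℝ) ≤ 1 - (1/2:ℝ)^q := by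
      have : (1/2:ℝ)^q ≤ 1 := pow_le_one₀ (by norm_num) (by norm_num)
      linarith
    calc _ ≤ ((2 ^ #(B j) - 1 : ℕ):ℝ) * #(fil (E \ B j).powerset (fun F => ∀ k ∈ J, F ∩ B k ≠ π k)) := by
            exact_mod_cast h1
      _ ≤ ((1 - (1/2:ℝ)^q) * 2^(#(B j))) * ((1 - (1/2:ℝ)^q)^(#J) * 2^(#(E \ B j))) := by
            apply mul_le_mul h2 ih' (Nat.cast_nonneg _) (by positivity)
      _ = _ := by rw [card_insert_of_notMem hj, h6, pow_add, pow_succ]; ring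

theorem card_img_le {α β : Type} (φ : α → β) (s : Finset α) : #(img φ s) ≤ #s := by
  unfold img; exact card_image_le

theorem blocks_graph {n : ℕ} {ι : Type} (q : ℕ) (J : Finset ι) (B : ι → Finset (Fin n × Fin n))
    (pat : ι → Fin n × Fin n → Prop) (hq : ∀ j, #(B j) ≤ q)
    (E : Finset (Fin n × Fin n)) (hEP : E ⊆ PR n) (hE : ∀ j ∈ J, B j ⊆ E)
    (hd : ∀ j ∈ J, ∀ j' ∈ J, j ≠ j' → Disjoint (B j) (B j')) (𝒢 : Finset (SimpleGraph (Fin n)))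
    (G0 : SimpleGraph (Fin n)) (h : ∀ G ∈ 𝒢, enc G \ E = enc G0 \ E)
    (hno : ∀ G ∈ 𝒢, ∀ j ∈ J, ¬ ∀ p ∈ B j, (G.Adj p.1 p.2 ↔ pat j p)) :
    (#𝒢 : ℝ) ≤ (1 - (1/2:ℝ)^q)^(#J) * 2^(#E) := by
  refine le_trans (Nat.cast_le.2 ?_) (blocks q J B (fun j => fil (B j) (pat j)) hq (fun j => fil_subset) E hE hd)
  apply card_le_card_of_injOn (fun G => enc G ∩ E)
  · intro G hG
    rw [mem_coe, mem_fil, mem_powerset]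
    refine ⟨inter_subset_right, fun j hj heq => hno G (mem_coe.1 hG) j hj ?_⟩
    intro p hp
    have h1 := congrArg (fun s => p ∈ s) heq
    simp only [mem_inter, mem_fil, enc, hp, hE j hj hp, hEP (hE j hj hp), true_and, and_true, eq_iff_iff] at h1
    exact h1
  · intro G hG G' hG' hh
    apply enc_inj
    have h2 := (h G hG).trans (h G' hG').symm
    rw [← Finset.sdiff_union_inter (enc G) E, ← Finset.sdiff_union_inter (enc G') E, h2]
    dsimp only at hh
    rw [hh]

theorem one_sub_pow_le (x : ℝ) (hx : 0 ≤ x) (hx1 : x ≤ 1) (m : ℕ) : (1 - x)^m ≤ (2:ℝ) ^ (-(x * m)) := by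
  have h1 : 1 - x ≤ (2:ℝ) ^ (-x) := by
    have h2 : (2:ℝ) ^ (-x) = Real.exp (Real.log 2 * (-x)) := Real.rpow_def_of_pos (by norm_num) _
    rw [h2]
    have h3 := Real.add_one_le_exp (Real.log 2 * (-x))
    have h4 : Real.log 2 < 1 := by
      have := Real.log_two_lt_d9
      linarith
    nlinarith
  calc (1 - x)^m ≤ ((2:ℝ) ^ (-x))^m := pow_le_pow_left₀ (by linarith) h1 m
    _ = _ := by rw [← Real.rpow_natCast, ← Real.rpow_mul (by norm_num)]; congr 1; ring

/-- index of slot s in the line `(u,a)` -/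
def lidx {r : ℕ} (i0 i : Fin r) (j : ℕ × ℕ) : ℕ := if i = i0 then j.1 else j.2 + i.1 * j.1

theorem lidx_inj {r : ℕ} (i0 i i' : Fin r) (h : i ≠ i') (j j' : ℕ × ℕ) (h1 : lidx i0 i j = lidx i0 i j')
    (h2 : lidx i0 i' j = lidx i0 i' j') : j = j' := by
  obtain ⟨u, a⟩ := j
  obtain ⟨u', a'⟩ := j'
  unfold lidx at h1 h2
  simp only at h1 h2
  by_cases e1 : i = i0
  · subst e1
    rw [if_pos rfl] at h1
    rw [if_neg (Ne.symm h)] at h2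
    rw [if_pos rfl] at h1
    rw [if_neg (Ne.symm h)] at h2
    subst h1
    simp only [Prod.mk.injEq, true_and]; omega
  · by_cases e2 : i' = i0
    · subst e2
      rw [if_pos rfl, if_pos rfl] at h2
      rw [if_neg h, if_neg h] at h1
      subst h2
      simp only [Prod.mk.injEq, true_and]; omega
    · rw [if_neg e1, if_neg e1] at h1
      rw [if_neg e2, if_neg e2] at h2
      have hne : i.1 ≠ i'.1 := fun hh => h (Fin.ext hh)
      have hu : u = u' := by
        have h3 : ((a:ℤ) + i.1 * u) = a' + i.1 * u' := by exact_mod_cast h1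
        have h4 : ((a:ℤ) + i'.1 * u) = a' + i'.1 * u' := by exact_mod_cast h2
        have h5 : ((i.1:ℤ) - i'.1) * ((u:ℤ) - u') = 0 := by linear_combination h3 - h4
        rcases mul_eq_zero.1 h5 with h6 | h6
        · exfalso; apply hne; omega
        · omega
      subst hu
      simp only [Prod.mk.injEq, true_and]; omega

theorem lidx_lt {r : ℕ} (i0 i : Fin r) (j : ℕ × ℕ) (m L : ℕ) (h1 : j.1 < m) (h2 : j.2 < L) :
    lidx i0 i j < if i = i0 then m else L + r * m := by
  unfold lidx
  split_ifs
  · exact h1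
  · have : i.1 * j.1 ≤ r * m := Nat.mul_le_mul i.2.le h1.le
    omega

theorem lines {n r : ℕ} {Q : Type} [Fintype Q] (S : Fin n → Fin r) (cl : Q → Fin r) (i0 : Fin r) (m L : ℕ)
    (z : Q → ℕ → Fin n) (pat : Q → Q → Prop) (hpat : ∀ s s', pat s s' → pat s' s)
    (len : Fin r → ℕ) (hlen0 : m ≤ len i0) (hlen : ∀ i, i ≠ i0 → L + r * m ≤ len i)
    (hzS : ∀ s k, k < len (cl s) → S (z s k) = cl s)
    (hzinj : ∀ s k s' k', cl s = cl s' → k < len (cl s) → k' < len (cl s') → z s k = z s' k' → s = s' ∧ k = k')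
    (E : Finset (Fin n × Fin n)) (hE : E ⊆ CP S)
    (hzE : ∀ s k s' k', k < len (cl s) → k' < len (cl s') → (z s k, z s' k') ∈ CP S → (z s k, z s' k') ∈ E)
    (𝒢 : Finset (SimpleGraph (Fin n))) (G0 : SimpleGraph (Fin n)) (h : ∀ G ∈ 𝒢, enc G \ E = enc G0 \ E)
    (hno : ∀ G ∈ 𝒢, ∀ k : Fin r → ℕ, (∀ i, k i < len i) →
      ¬ ∀ s s', cl s ≠ cl s' → (G.Adj (z s (k (cl s))) (z s' (k (cl s'))) ↔ pat s s')) :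
    (#𝒢 : ℝ) ≤ (2:ℝ) ^ ((#(CP S) : ℝ) - (1/2:ℝ)^(Fintype.card Q ^2) * (m * L)) := by
  let idx : ℕ × ℕ → Fin r → ℕ := fun j i => lidx i0 i j
  let J : Finset (ℕ × ℕ) := range m ×ˢ range L
  have hidx : ∀ j ∈ J, ∀ i, idx j i < len i := by
    intro j hj i
    simp only [J, mem_product, mem_range] at hj
    have := lidx_lt i0 i j m L hj.1 hj.2
    refine lt_of_lt_of_le this ?_
    split_ifs with hi
    · rw [hi]; exact hlen0
    · exact hlen i hi
  let v : ℕ × ℕ → Q → Fin n := fun j s => z s (idx j (cl s))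
  let B : ℕ × ℕ → Finset (Fin n × Fin n) := fun j =>
    if j ∈ J then (img (fun p : Q × Q => (v j p.1, v j p.2)) univ) ∩ CP S else ∅
  have hB : ∀ j ∈ J, B j = (img (fun p : Q × Q => (v j p.1, v j p.2)) univ) ∩ CP S := by
    intro j hj; simp only [B, if_pos hj]
  let pt : ℕ × ℕ → Fin n × Fin n → Prop := fun j p => ∃ s s', p = (v j s, v j s') ∧ pat s s'
  have hcard : ∀ j, #(B j) ≤ Fintype.card Q ^ 2 := by
    intro j
    by_cases hj : j ∈ J
    · rw [hB j hj]
      refine (card_le_card inter_subset_left).trans ?_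
      refine (card_img_le _ _).trans ?_
      rw [card_univ, Fintype.card_prod, sq]
    · simp only [B, if_neg hj]; simp
  have hvinj : ∀ j ∈ J, ∀ j' ∈ J, ∀ s s', v j s = v j' s' → s = s' ∧ idx j (cl s) = idx j' (cl s) := by
    intro j hj j' hj' s s' hv
    have c1 : S (v j s) = cl s := hzS _ _ (hidx j hj _)
    have c2 : S (v j' s') = cl s' := hzS _ _ (hidx j' hj' _)
    have hc : cl s = cl s' := by rw [← c1, hv, c2]
    have := hzinj s _ s' _ hc (hidx j hj _) (hidx j' hj' _) hv
    obtain ⟨h1, h2⟩ := this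
    subst h1
    exact ⟨rfl, h2⟩
  have hmain := blocks_graph (Fintype.card Q ^ 2) J B pt hcard E (hE.trans fil_subset) ?_ ?_ 𝒢 G0 h ?_
  · have hJ : #J = m * L := by simp [J]
    rw [hJ] at hmain
    have h1 := one_sub_pow_le ((1/2:ℝ)^(Fintype.card Q ^2)) (by positivity) (pow_le_one₀ (by norm_num) (by norm_num)) (m * L)
    have h2 : (2:ℝ)^(#E) ≤ (2:ℝ)^(#(CP S) : ℝ) := by
      rw [Real.rpow_natCast]
      exact pow_le_pow_right₀ (by norm_num) (card_le_card hE)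
    refine hmain.trans ((mul_le_mul h1 h2 (by positivity) (by positivity)).trans (le_of_eq ?_))
    rw [← Real.rpow_add (by norm_num)]
    congr 1
    push_cast; ring
  · intro j hj p hp
    rw [hB j hj, mem_inter, mem_img] at hp
    obtain ⟨⟨⟨s, s'⟩, _, rfl⟩, hp2⟩ := hp
    exact hzE s _ s' _ (hidx j hj _) (hidx j hj _) hp2
  · intro j hj j' hj' hjj
    rw [Finset.disjoint_left]
    intro p hp hp'
    rw [hB j hj, mem_inter, mem_img] at hp
    rw [hB j' hj', mem_inter, mem_img] at hp'
    obtain ⟨⟨⟨s, s'⟩, _, rfl⟩, hp2⟩ := hp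
    obtain ⟨⟨⟨w, w'⟩, _, heq⟩, _⟩ := hp'
    simp only [Prod.mk.injEq] at heq
    obtain ⟨a1, a2⟩ := hvinj j' hj' j hj _ _ heq.1
    obtain ⟨b1, b2⟩ := hvinj j' hj' j hj _ _ heq.2
    subst a1 b1
    have hne := (mem_fil.1 hp2).2
    simp only at hne
    have c1 : S (v j w) = cl w := hzS _ _ (hidx j hj _)
    have c2 : S (v j w') = cl w' := hzS _ _ (hidx j hj _)
    rw [c1, c2] at hne
    exact hjj (lidx_inj i0 (cl w) (cl w') hne j' j a2 b2).symm
  · intro G hG j hj hall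
    apply hno G hG (idx j) (hidx j hj)
    have key : ∀ s s', cl s ≠ cl s' → v j s < v j s' → (G.Adj (v j s) (v j s') ↔ pat s s') := by
      intro s s' hss hlt
      have c1 : S (v j s) = cl s := hzS _ _ (hidx j hj _)
      have c2 : S (v j s') = cl s' := hzS _ _ (hidx j hj _)
      have hmem : (v j s, v j s') ∈ B j := by
        rw [hB j hj, mem_inter, mem_img]
        refine ⟨⟨(s, s'), mem_univ _, rfl⟩, mem_fil.2 ⟨mem_fil.2 ⟨mem_univ _, hlt⟩, ?_⟩⟩
        simp only [c1, c2]; exact hss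
      rw [hall _ hmem]
      constructor
      · rintro ⟨w, w', heq, hp⟩
        simp only [Prod.mk.injEq] at heq
        obtain ⟨a1, _⟩ := hvinj j hj j hj _ _ heq.1
        obtain ⟨b1, _⟩ := hvinj j hj j hj _ _ heq.2
        subst a1 b1
        exact hp
      · intro hp; exact ⟨s, s', rfl, hp⟩
    intro s s' hss
    show G.Adj (v j s) (v j s') ↔ pat s s'
    have c1 : S (v j s) = cl s := hzS _ _ (hidx j hj _)
    have c2 : S (v j s') = cl s' := hzS _ _ (hidx j hj _)
    rcases lt_trichotomy (v j s) (v j s') with h1 | h1 | h1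
    · exact key s s' hss h1
    · exfalso; apply hss; rw [← c1, h1, c2]
    · rw [G.adj_comm, key s' s hss.symm h1]
      exact ⟨hpat _ _, hpat _ _⟩

end Blocks
end WPN

namespace WPN
section UK
open Finset Classical

/-- Ramsey for indexed families -/
theorem ramsey_fam (VH : Type) [Fintype VH] : ∃ R : ℕ, 0 < R ∧ ∀ {V : Type} (G : SimpleGraph V) (w : Fin R → V),
    Function.Injective w → ∃ (τ : Prop) (ι : VH → Fin R), Function.Injective ι ∧ Homog G τ (w ∘ ι) := by
  obtain ⟨R, hR, h⟩ := ramsey_homog VH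
  refine ⟨R, hR, fun {V} G w hw => ?_⟩
  obtain ⟨τ, z, hz, hom⟩ := h V G (univ.image w) (by rw [card_image_of_injective _ hw]; simp)
  have : ∀ x, ∃ j, w j = z x := fun x => by
    have := hz x
    rw [mem_image] at this
    obtain ⟨j, _, hj⟩ := this
    exact ⟨j, hj⟩
  choose ι hι using this
  have e : w ∘ ι = z := funext hι
  refine ⟨τ, ι, fun x y hxy => hom.1 ?_, e ▸ hom⟩
  rw [← hι, ← hι, hxy]

theorem uk_pattern {VH : Type} [Fintype VH] (H : SimpleGraph VH) : ∃ k : ℕ, 0 < k ∧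
    ∀ {V : Type} (G : SimpleGraph V) (f : Fin k ↪ V) (g : Finset (Fin k) ↪ V),
      (∀ (a : Fin k) (s : Finset (Fin k)), G.Adj (f a) (g s) ↔ a ∈ s) →
      ∃ (τa τb : Prop) (a b : VH → V), Homog G τa a ∧ Homog G τb b ∧ (∀ x, a x ∈ Set.range f) ∧
        (∀ x, b x ∈ Set.range g) ∧ ∀ x y, G.Adj (a x) (b y) ↔ H.Adj x y := by
  obtain ⟨R2, hR2, h2⟩ := ramsey_fam VH
  obtain ⟨N, hN, h1⟩ := ramsey_fam (VH × (Fin R2 → Bool))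
  let e : (Fin N → Bool) ≃ Fin (Fintype.card (Fin N → Bool)) := Fintype.equivFin _
  refine ⟨Fintype.card (Fin N → Bool), Fintype.card_pos, fun {V} G f g hadj => ?_⟩
  let bb : Fin N → V := fun j => g (univ.filter (fun a => e.symm a j = true))
  have hbb : Function.Injective bb := by
    intro j j' hj
    have h := g.injective hj
    have h3 := congrArg (fun s => e (fun i => decide (i = j)) ∈ s) h
    simp only [mem_filter, mem_univ, true_and, Equiv.symm_apply_apply, decide_eq_true_eq, eq_iff_iff] at h3
    exact (h3.1 trivial).symm
  obtain ⟨τb, ι1, hι1, hom1⟩ := h1 G bb hbb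
  let α : (VH × (Fin R2 → Bool) → Bool) → V := fun P => f (e (fun i => decide (∃ t, ι1 t = i ∧ P t = true)))
  have hα : ∀ P t, G.Adj (α P) (bb (ι1 t)) ↔ P t = true := by
    intro P t
    simp only [α, bb, hadj, mem_filter, mem_univ, true_and, Equiv.symm_apply_apply, decide_eq_true_eq]
    constructor
    · rintro ⟨t', h, hp⟩; rw [← hι1 h]; exact hp
    · intro h; exact ⟨t, rfl, h⟩
  by_cases hne : Nonempty VH
  swap
  · rw [not_nonempty_iff] at hne
    refine ⟨True, True, fun x => hne.elim x, fun x => hne.elim x, ⟨fun x => hne.elim x, fun x => hne.elim x⟩, ⟨fun x => hne.elim x, fun x => hne.elim x⟩, fun x => hne.elim x, fun x => hne.elim x, fun x => hne.elim x⟩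
  obtain ⟨x0⟩ := hne
  let aa : Fin R2 → V := fun j => α (fun t => t.2 j)
  have haa : Function.Injective aa := by
    intro j j' hj
    have h1 := hα (fun t => t.2 j) (x0, fun i => decide (i = j))
    have h2 := hα (fun t => t.2 j') (x0, fun i => decide (i = j))
    have h3 : α (fun t => t.2 j) = α (fun t => t.2 j') := hj
    rw [h3, h2] at h1
    simp only [decide_eq_true_eq] at h1
    exact (h1.2 trivial).symm
  obtain ⟨τa, ι2, hι2, hom2⟩ := h2 G aa haa
  refine ⟨τa, τb, aa ∘ ι2, fun y => bb (ι1 (y, fun j => decide (∃ x, ι2 x = j ∧ H.Adj x y))), hom2, ?_, ?_, ?_, ?_⟩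
  · refine ⟨fun y y' h => ?_, fun y y' h => ?_⟩
    · exact congrArg Prod.fst (hom1.1 h)
    · exact hom1.2 _ _ (fun hh => h (congrArg Prod.fst hh))
  · intro x; exact ⟨_, rfl⟩
  · intro x; exact ⟨_, rfl⟩
  · intro x y
    have := hα (fun t => t.2 (ι2 x)) (y, fun j => decide (∃ x, ι2 x = j ∧ H.Adj x y))
    refine this.trans ?_
    simp only [decide_eq_true_eq]
    constructor
    · rintro ⟨x', h, hp⟩; rw [← hι2 h]; exact hp
    · intro h; exact ⟨x, rfl, h⟩

end UK
end WPN

namespace WPN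
section CertSec
open Finset Classical

/-- negligible up to constants -/
def Neg (r : ℕ) (p : ∀ n : ℕ, SimpleGraph (Fin n) → Prop) : Prop :=
  ∃ (C : ℝ) (N : ℕ), 0 ≤ C ∧ ∀ n : ℕ, N ≤ n → (#(gr n (p n)) : ℝ) ≤ C * (2:ℝ) ^ ((1 - 1/(r:ℝ)) * n^2 / 2 - 2 * n)

theorem Negl.neg {r : ℕ} {p : ∀ n : ℕ, SimpleGraph (Fin n) → Prop} (h : Negl r p) : Neg r p := by
  obtain ⟨N, hN⟩ := h
  exact ⟨1, N, by norm_num, fun n hn => by rw [one_mul]; exact hN n hn⟩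

theorem Neg.mono {r : ℕ} {p q : ∀ n : ℕ, SimpleGraph (Fin n) → Prop} (h : Neg r p) (N0 : ℕ)
    (hpq : ∀ n, N0 ≤ n → ∀ G, q n G → p n G) : Neg r q := by
  obtain ⟨C, N, hC, hN⟩ := h
  refine ⟨C, max N N0, hC, fun n hn => le_trans (Nat.cast_le.2 (card_le_card ?_)) (hN n (le_trans (le_max_left _ _) hn))⟩
  intro G hG
  exact mem_gr.2 (hpq n (le_trans (le_max_right _ _) hn) G (mem_gr.1 hG))

theorem Neg.or {r : ℕ} {p q : ∀ n : ℕ, SimpleGraph (Fin n) → Prop} (hp : Neg r p) (hq : Neg r q) :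
    Neg r (fun n G => p n G ∨ q n G) := by
  obtain ⟨C, N, hC, hN⟩ := hp
  obtain ⟨C', N', hC', hN'⟩ := hq
  refine ⟨C + C', max N N', by linarith, fun n hn => ?_⟩
  have h1 := hN n (le_trans (le_max_left _ _) hn)
  have h2 := hN' n (le_trans (le_max_right _ _) hn)
  have h3 : #(gr n (fun G => p n G ∨ q n G)) ≤ #(gr n (p n)) + #(gr n (q n)) := by
    refine le_trans (card_le_card ?_) (card_union_le _ _)
    intro G hG
    rw [mem_union, mem_gr, mem_gr]
    exact mem_gr.1 hG
  have h4 : (#(gr n (fun G => p n G ∨ q n G)) : ℝ) ≤ #(gr n (p n)) + #(gr n (q n)) := by exact_mod_cast h3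
  linarith

theorem Neg.ex {r : ℕ} {ι : Type} [Fintype ι] {p : ι → ∀ n : ℕ, SimpleGraph (Fin n) → Prop} (hp : ∀ i, Neg r (p i)) :
    Neg r (fun n G => ∃ i, p i n G) := by
  have key : ∀ s : Finset ι, Neg r (fun n G => ∃ i ∈ s, p i n G) := by
    intro s
    induction s using Finset.induction_on with
    | empty =>
      refine ⟨0, 0, le_refl _, fun n _ => ?_⟩
      have : gr n (fun G => ∃ i ∈ (∅ : Finset ι), p i n G) = ∅ := by
        ext G; rw [mem_gr]; simp
      rw [this]; simp
    | insert a s ha ih =>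
      refine ((hp a).or ih).mono 0 (fun n _ G => ?_)
      rintro ⟨i, hi, h⟩
      rcases mem_insert.1 hi with rfl | hi
      · exact Or.inl h
      · exact Or.inr ⟨i, hi, h⟩
  exact (key univ).mono 0 (fun n _ G ⟨i, h⟩ => ⟨i, mem_univ _, h⟩)

/-- certificates at the weak structure level -/
abbrev Cert (r T : ℕ) (K : Type) (n : ℕ) : Type :=
  Σ t : Fin (T+1), (Fin n → Fin t) × ((Fin t → Fin r) × (Fin t → Fin t → Prop)) × ((K → Fin n) × (K → Fin n → Prop))

def cS {r T n : ℕ} {K : Type} (l : Cert r T K n) (v : Fin n) : Fin r := l.2.2.1.1 (l.2.1 v)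
def cw {r T n : ℕ} {K : Type} (l : Cert r T K n) : K → Fin n := l.2.2.2.1
def cNb {r T n : ℕ} {K : Type} (l : Cert r T K n) : K → Fin n → Prop := l.2.2.2.2
def cD {r T n : ℕ} {K : Type} (l : Cert r T K n) (u v : Fin n) : Prop := l.2.2.1.2 (l.2.1 u) (l.2.1 v)
noncomputable def cE {r T n : ℕ} {K : Type} (l : Cert r T K n) : Finset (Fin n × Fin n) :=
  fil (CP (cS l)) (fun p => (∀ a, cw l a ≠ p.1) ∧ ∀ a, cw l a ≠ p.2)

def CV {r T n : ℕ} {K : Type} (κ : ℝ) (l : Cert r T K n) (G : SimpleGraph (Fin n)) : Prop :=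
  (#(fil univ (fun q : Fin n × Fin n => cS l q.1 = cS l q.2 ∧ ¬ (G.Adj q.1 q.2 ↔ cD l q.1 q.2))) : ℝ) ≤ κ * n^2 ∧
  ∀ a v, (cNb l a v ↔ G.Adj (cw l a) v)

theorem card_Cert (r T : ℕ) (K : Type) [Fintype K] : ∃ C : ℝ, ∀ n : ℕ,
    (Fintype.card (Cert r T K n) : ℝ) ≤ (2:ℝ) ^ (C * n + C) := by
  let c : ℕ := ∑ t : Fin (T+1), Fintype.card ((Fin t → Fin r) × (Fin t → Fin t → Prop))
  refine ⟨c + T + 2 * Fintype.card K, fun n => ?_⟩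
  have h1 : Fintype.card (Cert r T K n) ≤ T^n * c * ((n * 2^n)^Fintype.card K) := by
    unfold Cert
    rw [Fintype.card_sigma, Finset.mul_sum, Finset.sum_mul]
    apply sum_le_sum
    intro t _
    rw [Fintype.card_prod, Fintype.card_prod, ← mul_assoc]
    apply Nat.mul_le_mul
    · apply Nat.mul_le_mul_right
      simp only [Fintype.card_fun, Fintype.card_fin]
      exact Nat.pow_le_pow_left (by omega) n
    · rw [Fintype.card_prod]
      simp only [Fintype.card_fun, Fintype.card_fin, Fintype.card_prop]
      rw [mul_pow]
  have h2 : (((n * 2^n)^Fintype.card K : ℕ) : ℝ) ≤ (2:ℝ) ^ (2 * (Fintype.card K : ℝ) * n) := by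
    have : n * 2^n ≤ 2^(2*n) := by
      rw [two_mul, pow_add]
      exact Nat.mul_le_mul_right _ Nat.lt_two_pow_self.le
    have h3 : (n * 2^n)^Fintype.card K ≤ (2^(2*n))^Fintype.card K := Nat.pow_le_pow_left this _
    rw [← pow_mul] at h3
    calc _ ≤ (((2^(2*n*Fintype.card K) : ℕ)) : ℝ) := Nat.cast_le.2 h3
      _ = (2:ℝ) ^ (((2*n*Fintype.card K : ℕ)):ℝ) := by rw [Real.rpow_natCast]; push_cast; rfl
      _ = _ := by push_cast; congr 1; ring
  calc (Fintype.card (Cert r T K n) : ℝ) ≤ ((T^n : ℕ) : ℝ) * c * (((n * 2^n)^Fintype.card K : ℕ) : ℝ) := by exact_mod_cast h1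
    _ ≤ ((2:ℝ) ^ ((T:ℝ) * n) * (2:ℝ) ^ (c:ℝ)) * (2:ℝ) ^ (2 * (Fintype.card K : ℝ) * n) := by
        apply mul_le_mul _ h2 (Nat.cast_nonneg _) (by positivity)
        apply mul_le_mul (pow_le_two_rpow T n) (nat_le_two_rpow c) (Nat.cast_nonneg _) (by positivity)
    _ = (2:ℝ) ^ ((T:ℝ) * n + c + 2 * (Fintype.card K : ℝ) * n) := by
        rw [← Real.rpow_add (by norm_num), ← Real.rpow_add (by norm_num)]
    _ ≤ _ := by
        apply Real.rpow_le_rpow_of_exponent_le (by norm_num)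
        have h1 : (0:ℝ) ≤ n := Nat.cast_nonneg _
        have h2 : (0:ℝ) ≤ c := Nat.cast_nonneg _
        have h3 : (0:ℝ) ≤ T := Nat.cast_nonneg _
        have h4 : (0:ℝ) ≤ Fintype.card K := Nat.cast_nonneg _
        nlinarith [mul_nonneg h2 h1]

theorem cert_negl (r : ℕ) (c : ℝ) (hc : 0 < c) : ∃ κ0 : ℝ, 0 < κ0 ∧ ∀ (κ : ℝ), κ ≤ κ0 → ∀ (T : ℕ) (K : Type) [Fintype K]
    (P : ∀ n, Cert r T K n → SimpleGraph (Fin n) → Prop) (N0 : ℕ)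
    (hfib : ∀ n, N0 ≤ n → ∀ l G0, P n l G0 → CV κ l G0 → ∀ 𝒢 : Finset (SimpleGraph (Fin n)),
      (∀ G ∈ 𝒢, P n l G ∧ CV κ l G ∧ enc G \ cE l = enc G0 \ cE l) →
      (#𝒢 : ℝ) ≤ (2:ℝ) ^ ((1 - 1/(r:ℝ)) * n^2 / 2 - c * n^2)),
    Neg r (fun n G => ∃ l : Cert r T K n, CV κ l G ∧ P n l G) := by
  obtain ⟨κ0, hκ0, hv0⟩ := vol (c/2) (by positivity)
  refine ⟨κ0, hκ0, fun κ hκ T K _ P N0 hfib => ?_⟩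
  have hv : ∀ (α : Type) (P : Finset α) (N : ℝ), (#P : ℝ) ≤ N →
      (#(fil P.powerset (fun F => (#F : ℝ) ≤ κ * N)) : ℝ) ≤ (2:ℝ) ^ (c/2 * N) := by
    intro α P N hP
    refine le_trans (Nat.cast_le.2 (card_le_card ?_)) (hv0 α P N hP)
    intro F hF
    obtain ⟨h1, h2⟩ := mem_fil.1 hF
    refine mem_fil.2 ⟨h1, h2.trans ?_⟩
    exact mul_le_mul_of_nonneg_right hκ (le_trans (Nat.cast_nonneg _) hP)
  obtain ⟨C, hC⟩ := card_Cert r T K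
  obtain ⟨N1, hN1⟩ := ev_quad (c/2) (|C| + 2) (by positivity)
  apply Negl.neg
  refine ⟨max N0 N1, fun n hn => ?_⟩
  have hn0 : N0 ≤ n := le_trans (le_max_left _ _) hn
  have hn1 := hN1 n (le_trans (le_max_right _ _) hn)
  have hcc := count_cert (gr n (fun G => ∃ l : Cert r T K n, CV κ l G ∧ P n l G)) (fun l G => CV κ l G ∧ P n l G)
    (fun G hG => mem_gr.1 hG) (fun l G => enc G \ cE l)
    ((2:ℝ) ^ (c/2 * n^2)) ((2:ℝ) ^ ((1 - 1/(r:ℝ)) * n^2 / 2 - c * n^2)) (by positivity) ?_ ?_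
  · refine hcc.trans ?_
    have hpos : (0:ℝ) < 2 := by norm_num
    calc _ ≤ (2:ℝ) ^ (C * n + C) * ((2:ℝ) ^ (c/2 * n^2)) * ((2:ℝ) ^ ((1 - 1/(r:ℝ)) * n^2 / 2 - c * n^2)) := by
            have := hC n
            apply mul_le_mul_of_nonneg_right _ (Real.rpow_nonneg hpos.le _)
            exact mul_le_mul_of_nonneg_right this (Real.rpow_nonneg hpos.le _)
      _ = (2:ℝ) ^ ((C * n + C) + (c/2 * n^2) + ((1 - 1/(r:ℝ)) * n^2 / 2 - c * n^2)) := by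
            rw [← Real.rpow_add hpos, ← Real.rpow_add hpos]
      _ ≤ _ := by
            apply Real.rpow_le_rpow_of_exponent_le (by norm_num)
            have hCn : C * n ≤ |C| * n := mul_le_mul_of_nonneg_right (le_abs_self C) (Nat.cast_nonneg _)
            have hCC := le_abs_self C
            linarith
  · intro l
    apply approx_image (c/2) κ hv (cE l) (fun u v => (∃ a, cw l a = u ∧ cNb l a v) ∨ (∃ a, cw l a = v ∧ cNb l a u) ∨
      ((∀ a, cw l a ≠ u) ∧ (∀ a, cw l a ≠ v) ∧ cD l u v))
    intro G hG
    obtain ⟨hG1, hcv, hP⟩ := mem_fil.1 hG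
    refine le_trans (Nat.cast_le.2 (card_le_card ?_)) hcv.1
    intro p hp
    obtain ⟨hp1, hp2⟩ := mem_fil.1 hp
    rw [Finset.mem_sdiff] at hp1
    refine mem_fil.2 ⟨mem_univ _, ?_⟩
    by_cases h1 : ∃ a, cw l a = p.1
    · exfalso
      apply hp2
      obtain ⟨a, ha⟩ := h1
      constructor
      · intro h; left; exact ⟨a, ha, (hcv.2 a _).2 (ha ▸ h)⟩
      · rintro (⟨b, hb, hb2⟩ | ⟨b, hb, hb2⟩ | ⟨hb, _⟩)
        · rw [← hb]; exact (hcv.2 b _).1 hb2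
        · rw [← hb]; exact ((hcv.2 b _).1 hb2).symm
        · exact absurd ha (hb a)
    by_cases h2 : ∃ a, cw l a = p.2
    · exfalso
      apply hp2
      obtain ⟨a, ha⟩ := h2
      constructor
      · intro h; right; left; exact ⟨a, ha, (hcv.2 a _).2 (ha ▸ h.symm)⟩
      · rintro (⟨b, hb, hb2⟩ | ⟨b, hb, hb2⟩ | ⟨_, hb, _⟩)
        · rw [← hb]; exact (hcv.2 b _).1 hb2
        · rw [← hb]; exact ((hcv.2 b _).1 hb2).symm
        · exact absurd ha (hb a)
    push Not at h1 h2
    have hE : p ∉ CP (cS l) := fun h => hp1.2 (mem_fil.2 ⟨h, h1, h2⟩)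
    constructor
    · by_contra hne
      exact hE (mem_fil.2 ⟨hp1.1, hne⟩)
    · intro h
      apply hp2
      rw [h]
      constructor
      · intro h; exact Or.inr (Or.inr ⟨h1, h2, h⟩)
      · rintro (⟨b, hb, hb2⟩ | ⟨b, hb, hb2⟩ | ⟨_, _, hb⟩)
        · exact absurd hb (h1 b)
        · exact absurd hb (h2 b)
        · exact hb
  · intro l G0 hG0 hl
    apply hfib n hn0 l G0 hl.2 hl.1
    intro G hG
    obtain ⟨_, ⟨h1, h2⟩, h3⟩ := mem_fil.1 hG
    exact ⟨h2, h1, h3⟩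

end CertSec
end WPN

namespace WPN
section EnumSec
open Finset Classical

theorem enum_finset {α : Type} [Nonempty α] (s : Finset α) : ∃ e : ℕ → α, (∀ j, j < #s → e j ∈ s) ∧
    ∀ j j', j < #s → j' < #s → e j = e j' → j = j' := by
  let eq := s.equivFin
  refine ⟨fun j => if h : j < #s then (eq.symm ⟨j, h⟩ : α) else Classical.arbitrary α, ?_, ?_⟩
  · intro j hj
    simp only [dif_pos hj]
    exact (eq.symm ⟨j, hj⟩).2
  · intro j j' hj hj' h
    simp only [dif_pos hj, dif_pos hj'] at h
    have := eq.symm.injective (Subtype.ext h)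
    simpa using this

theorem pigeon_enum {κ : Type} [Fintype κ] (c : ℕ → κ) (N m : ℕ) (h : Fintype.card κ * m ≤ N) :
    ∃ (k : κ) (a : ℕ → ℕ), (∀ j, j < m → a j < N ∧ c (a j) = k) ∧
      ∀ j j', j < m → j' < m → a j = a j' → j = j' := by
  obtain ⟨k, _, hk⟩ := Finset.exists_le_card_fiber_of_mul_le_card_of_maps_to (s := range N) (t := (univ : Finset κ)) (f := c) (n := m)
    (fun _ _ => mem_univ _) ⟨c 0, mem_univ _⟩ (by rw [card_univ, card_range]; exact h)
  obtain ⟨e, he1, he2⟩ := enum_finset (((range N).filter (fun x => c x = k)))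
  refine ⟨k, e, fun j hj => ?_, fun j j' hj hj' => he2 j j' (lt_of_lt_of_le hj hk) (lt_of_lt_of_le hj' hk)⟩
  have := he1 j (lt_of_lt_of_le hj hk)
  rw [mem_filter, mem_range] at this
  exact this

/-- event that a class is too small -/
theorem e1_negl (r : ℕ) (hr0 : 0 < r) : ∃ κ0 : ℝ, 0 < κ0 ∧ ∀ κ, κ ≤ κ0 → ∀ T,
    Neg r (fun n G => ∃ l : Cert r T Empty n, CV κ l G ∧ ∃ i, (#(fil univ (fun v => cS l v = i)) : ℝ) < n / (2 * r)) := by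
  have hr : (0:ℝ) < r := by exact_mod_cast hr0
  obtain ⟨κ0, hκ0, h⟩ := cert_negl r (1 / (8 * r^2)) (by positivity)
  refine ⟨κ0, hκ0, fun κ hκ T => h κ hκ T Empty _ 0 ?_⟩
  rintro n - l G0 ⟨i, hi⟩ hcv 𝒢 h𝒢
  refine (fibre_card (cE l) 𝒢 G0 (fun G hG => (h𝒢 G hG).2.2)).trans ?_
  apply Real.rpow_le_rpow_of_exponent_le (by norm_num)
  have h1 : (#(cE l) : ℝ) ≤ #(CP (cS l)) := Nat.cast_le.2 (card_le_card fil_subset)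
  rw [card_CP hr0] at h1
  have h2 := Finset.single_le_sum (f := fun i => ((#(fil univ (fun v => cS l v = i)) : ℝ) - n / r)^2)
    (fun i _ => sq_nonneg _) (mem_univ i)
  have h3 : (1 / (8 * (r:ℝ)^2)) * n^2 = ((n:ℝ) / (2 * r))^2 / 2 := by field_simp; ring
  have h4 : ((n:ℝ) / (2 * r))^2 ≤ ((#(fil univ (fun v => cS l v = i)) : ℝ) - n / r)^2 := by
    have e : (n:ℝ) / r = 2 * (n / (2 * r)) := by field_simp
    have : (0:ℝ) ≤ n / (2 * r) := by positivity
    rw [e]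
    nlinarith
  linarith

theorem vc_iter (δ : ℝ) (hδ : 0 < δ) (hδ1 : δ < 1) (r K : ℕ) : ∀ j : ℕ, ∃ (M : ℕ) (c : ℝ), 0 < c ∧
    ∀ (n : ℕ) (G : SimpleGraph (Fin n)) (S : Fin n → Fin r), 0 < n → ∀ B : Finset (Fin n), M ≤ #B →
      (∀ u ∈ B, ∀ v ∈ B, u ≠ v → ∀ i, δ * n ≤ #(fil univ (fun x => S x = i ∧ ¬ (G.Adj u x ↔ G.Adj v x)))) →
      ∃ B' ⊆ B, #B' = K ∧ ∀ i : Fin r, i.1 < j → ∀ P ⊆ B', c * n ≤ #(fil univ (fun x => S x = i ∧ ∀ u ∈ B', (G.Adj u x ↔ u ∈ P))) := by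
  intro j
  induction j with
  | zero =>
    refine ⟨K, 1, one_pos, fun n G S hn B hB _ => ?_⟩
    obtain ⟨B', h1, h2⟩ := exists_subset_card_eq hB
    exact ⟨B', h1, h2, fun i hi => absurd hi (by omega)⟩
  | succ j ih =>
    obtain ⟨M1, c1, hc1, h1⟩ := ih
    obtain ⟨M, c, hc, h⟩ := vc_robust δ hδ hδ1 M1
    refine ⟨M, min c c1, lt_min hc hc1, fun n G S hn B hB hfar => ?_⟩
    have hn' : (0:ℝ) ≤ n := Nat.cast_nonneg _
    by_cases hj : j < r
    swap
    · obtain ⟨B0, hB0, hB0c⟩ := exists_subset_card_eq (show M1 ≤ #B by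
        by_cases hM : M1 ≤ #B
        · exact hM
        · have := h (Fin n) G ∅ n hn (by simp) B hB
          by_contra
          exfalso
          by_cases hr : r = 0
          · subst hr
            have : IsEmpty (Fin n) := ⟨fun v => (S v).elim0⟩
            exact absurd (this.elim ⟨0, hn⟩) id
          · have hfar' := fun u hu v hv huv => (hfar u hu v hv huv ⟨0, by omega⟩)
            obtain ⟨B', hB', hc', _⟩ := h (Fin n) G univ n hn (by simp) B hB (fun u hu v hv huv => by
              refine (hfar' u hu v hv huv).trans (Nat.cast_le.2 (card_le_card ?_))
              intro x hx
              exact mem_fil.2 ⟨mem_univ _, (mem_fil.1 hx).2.2⟩)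
            exact hM (hc' ▸ card_le_card hB'))
      obtain ⟨B', hB', hK, hP⟩ := h1 n G S hn B0 hB0c.ge (fun u hu v hv => hfar u (hB0 hu) v (hB0 hv))
      refine ⟨B', hB'.trans hB0, hK, fun i hi P hPB => ?_⟩
      refine le_trans ?_ (hP i (by have := i.2; omega) P hPB)
      exact mul_le_mul_of_nonneg_right (min_le_right _ _) hn'
    · obtain ⟨B0, hB0, hB0c, hB0P⟩ := h (Fin n) G (fil univ (fun x => S x = ⟨j, hj⟩)) n hn
        ((card_le_univ _).trans (by simp)) B hB (fun u hu v hv huv => by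
          refine (hfar u hu v hv huv ⟨j, hj⟩).trans (Nat.cast_le.2 (card_le_card ?_))
          intro x hx
          obtain ⟨_, a, b⟩ := mem_fil.1 hx
          exact mem_fil.2 ⟨mem_fil.2 ⟨mem_univ _, a⟩, b⟩)
      obtain ⟨B', hB', hK, hP⟩ := h1 n G S hn B0 hB0c.ge (fun u hu v hv => hfar u (hB0 hu) v (hB0 hv))
      refine ⟨B', hB'.trans hB0, hK, fun i hi P hPB => ?_⟩
      by_cases hij : i.1 < j
      · refine le_trans ?_ (hP i hij P hPB)
        exact mul_le_mul_of_nonneg_right (min_le_right _ _) hn'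
      · have hi' : i = ⟨j, hj⟩ := Fin.ext (by simp only; omega)
        refine le_trans ?_ ((hB0P P (hPB.trans hB')).trans (Nat.cast_le.2 (card_le_card ?_)))
        · exact mul_le_mul_of_nonneg_right (min_le_left _ _) hn'
        · intro x hx
          obtain ⟨a, b⟩ := mem_fil.1 hx
          exact mem_fil.2 ⟨mem_univ _, by rw [hi']; exact (mem_fil.1 a).2, fun u hu => b u (hB' hu)⟩

end EnumSec
end WPN

namespace WPN
section EZero
open Finset Classical

theorem ev_lin (a C : ℝ) (ha : 0 < a) : ∃ N : ℕ, ∀ n : ℕ, N ≤ n → C ≤ a * (n:ℝ) := by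
  obtain ⟨N, hN⟩ := exists_nat_gt (C / a)
  refine ⟨N, fun n hn => ?_⟩
  rw [div_lt_iff₀ ha] at hN
  have : (N:ℝ) ≤ n := by exact_mod_cast hn
  nlinarith

theorem nonempty_of_indFree {VH V : Type} {H : SimpleGraph VH} {G : SimpleGraph V} (h : IndFree H G) : Nonempty VH := by
  by_contra hne
  rw [not_nonempty_iff] at hne
  exact h ⟨⟨⟨fun x => hne.elim x, fun x => hne.elim x⟩, fun {x} => hne.elim x⟩⟩

/-- property of the shattered certificate -/
def PZ {VH : Type} (H : SimpleGraph VH) (r R : ℕ) (c : ℝ) (T n : ℕ) (l : Cert r T (VH × (Fin r → Fin R → Bool)) n)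
    (G : SimpleGraph (Fin n)) : Prop :=
  IndFree H G ∧ (∃ τ, Homog G τ (cw l)) ∧ ∀ i, ∀ Pt : VH × (Fin r → Fin R → Bool) → Prop,
    c * n ≤ #(fil univ (fun v => cS l v = i ∧ ∀ a, (cNb l a v ↔ Pt a)))

theorem adj_inside {n r T : ℕ} {K : Type} (l : Cert r T K n) {G G0 : SimpleGraph (Fin n)} (h : enc G \ cE l = enc G0 \ cE l)
    {u v : Fin n} (huv : cS l u = cS l v) : G.Adj u v ↔ G0.Adj u v := by
  apply adj_of_enc h
  · intro hh; exact (mem_fil.1 (mem_fil.1 hh).1).2 huv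
  · intro hh; exact (mem_fil.1 (mem_fil.1 hh).1).2 huv.symm

theorem e0_fibre {VH : Type} [Fintype VH] (H : SimpleGraph VH) (r : ℕ) (hr : IsWpn H r) (hr0 : 0 < r) (R : ℕ)
    (hR : ∀ {V : Type} (G : SimpleGraph V) (w : Fin R → V),
    Function.Injective w → ∃ (τ : Prop) (ι : VH → Fin R), Function.Injective ι ∧ Homog G τ (w ∘ ι)) (c : ℝ) (hc : 0 < c)
    (T n m1 : ℕ) (hn : 0 < n) (l : Cert r T (VH × (Fin r → Fin R → Bool)) n) 
    (hm1 : (Fintype.card (Prop × (VH → Fin R)) * (2 * r * m1) : ℝ) + Fintype.card (VH × (Fin r → Fin R → Bool)) ≤ c * n) (κ : ℝ)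
    (G0 : SimpleGraph (Fin n)) (hP : PZ H r R c T n l G0) (hcv : CV κ l G0) (𝒢 : Finset (SimpleGraph (Fin n)))
    (h𝒢 : ∀ G ∈ 𝒢, PZ H r R c T n l G ∧ CV κ l G ∧ enc G \ cE l = enc G0 \ cE l) :
    (#𝒢 : ℝ) ≤ (2:ℝ) ^ ((#(CP (cS l)) : ℝ) - (1/2:ℝ)^(Fintype.card (Fin r × VH) ^2) * (m1 * (r * m1 : ℕ))) := by
  obtain ⟨hfree, ⟨τ, hτ⟩, hsh⟩ := hP
  obtain ⟨x0⟩ := nonempty_of_indFree hfree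
  have : Nonempty (Fin n) := ⟨⟨0, hn⟩⟩
  obtain ⟨A, hA⟩ : ∃ A : Fin r → Fin R → Finset (Fin n), ∀ i j, A i j = fil univ (fun v => cS l v = i ∧
    (∀ a, (cNb l a v ↔ a.2 i j = true)) ∧ ∀ a, cw l a ≠ v) := ⟨_, fun _ _ => rfl⟩
  have hmA : ∀ i j v, v ∈ A i j ↔ (cS l v = i ∧ (∀ a, (cNb l a v ↔ a.2 i j = true)) ∧ ∀ a, cw l a ≠ v) := by
    intro i j v; rw [hA, mem_fil]; simp
  obtain ⟨N, hN⟩ : ∃ N, N = Fintype.card (Prop × (VH → Fin R)) * (2 * r * m1) := ⟨_, rfl⟩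
  have hAN : ∀ i j, N ≤ #(A i j) := by
    intro i j
    have h1 := hsh i (fun a => a.2 i j = true)
    have h2 : #(fil univ (fun v => cS l v = i ∧ ∀ a, (cNb l a v ↔ a.2 i j = true))) ≤
        #(A i j) + Fintype.card (VH × (Fin r → Fin R → Bool)) := by
      calc _ ≤ #(A i j ∪ img (cw l) univ) := by
            apply card_le_card
            intro v hv
            obtain ⟨_, a, b⟩ := mem_fil.1 hv
            rw [mem_union, hmA, mem_img]
            by_cases hw : ∀ a, cw l a ≠ v
            · exact Or.inl ⟨a, b, hw⟩
            · push Not at hw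
              obtain ⟨a, ha⟩ := hw
              exact Or.inr ⟨a, mem_univ _, ha⟩
        _ ≤ _ := (card_union_le _ _).trans (Nat.add_le_add_left ((card_img_le _ _).trans (by rw [card_univ])) _)
    have h3 : c * n ≤ (#(A i j) : ℝ) + Fintype.card (VH × (Fin r → Fin R → Bool)) := h1.trans (by exact_mod_cast h2)
    have h4 : (N:ℝ) ≤ #(A i j) := by rw [hN]; push_cast; push_cast at h3 hm1; linarith
    exact_mod_cast h4
  have hdis : ∀ i j j' v, v ∈ A i j → v ∈ A i j' → j = j' := by
    intro i j j' v h1 h2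
    have a1 := ((hmA _ _ _).1 h1).2.1 (x0, fun _ j'' => decide (j'' = j))
    have a2 := ((hmA _ _ _).1 h2).2.1 (x0, fun _ j'' => decide (j'' = j))
    rw [a1] at a2
    simp only [decide_eq_true_eq] at a2
    exact (a2.1 trivial).symm
  have he : ∀ i j, ∃ e : ℕ → Fin n, (∀ k, k < #(A i j) → e k ∈ A i j) ∧
    ∀ k k', k < #(A i j) → k' < #(A i j) → e k = e k' → k = k' := fun i j => enum_finset (A i j)
  choose e he1 he2 using he
  have hcol : ∀ i k, ∃ col : Prop × (VH → Fin R), k < N → Function.Injective col.2 ∧ Homog G0 col.1 (fun x => e i (col.2 x) k) := by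
    intro i k
    by_cases hk : k < N
    · obtain ⟨τ', ι, hι, hh⟩ := hR G0 (fun j => e i j k) (by
        intro j j' hjj
        dsimp only at hjj
        have b1 := he1 i j k (lt_of_lt_of_le hk (hAN i j))
        have b2 := he1 i j' k (lt_of_lt_of_le hk (hAN i j'))
        rw [← hjj] at b2
        exact hdis i j j' _ b1 b2)
      exact ⟨(τ', ι), fun _ => ⟨hι, hh⟩⟩
    · obtain ⟨τ', ι, hι, hh⟩ := hR (⊥ : SimpleGraph (Fin R)) id (fun _ _ h => h)
      exact ⟨(True, ι), fun h => absurd h hk⟩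
  choose col hcol using hcol
  have hpg := fun i => pigeon_enum (col i) N (2 * r * m1) hN.ge
  choose kc a ha1 ha2 using hpg
  have hlt : ∀ i k j, k < 2 * r * m1 → a i k < #(A i j) := fun i k j hk => lt_of_lt_of_le (ha1 i k hk).1 (hAN i j)
  have hmem : ∀ i k j, k < 2 * r * m1 → e i j (a i k) ∈ A i j := fun i k j hk => he1 i j _ (hlt i k j hk)
  have hkinj : ∀ i k, k < 2 * r * m1 → Function.Injective (kc i).2 ∧ Homog G0 (kc i).1 (fun x => e i ((kc i).2 x) (a i k)) := by
    intro i k hk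
    have := hcol i (a i k) (ha1 i k hk).1
    rw [(ha1 i k hk).2] at this
    exact this
  apply lines (cS l) (Prod.fst : Fin r × VH → Fin r) ⟨0, hr0⟩ m1 (r * m1) (fun q k => e q.1 ((kc q.1).2 q.2) (a q.1 k))
    (fun q q' => H.Adj q.2 q'.2) (fun q q' h => h.symm) (fun _ => 2 * r * m1) _ _ _ _ (cE l) fil_subset _ 𝒢 G0
    (fun G hG => (h𝒢 G hG).2.2)
  · intro G hG k hk hpat
    obtain ⟨⟨hGfree, ⟨τG, hτG⟩, _⟩, hGcv, hGenc⟩ := h𝒢 G hG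
    have hA' : ∀ i x, e i ((kc i).2 x) (a i (k i)) ∈ A i ((kc i).2 x) := fun i x => hmem i _ _ (hk i)
    let s : VH → Fin r → Fin R → Bool := fun x i j => decide (∃ y, (kc i).2 y = j ∧ H.Adj x y)
    have hws : ∀ i x y, G.Adj (cw l (x, s x)) (e i ((kc i).2 y) (a i (k i))) ↔ H.Adj x y := by
      intro i x y
      rw [← hGcv.2, ((hmA _ _ _).1 (hA' i y)).2.1]
      simp only [s, decide_eq_true_eq]
      constructor
      · rintro ⟨y', h, hp⟩; rw [← (hkinj i _ (hk i)).1 h]; exact hp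
      · intro h; exact ⟨y, rfl, h⟩
    refine template H r hr (Option (Fin r)) (by simp) (fun o => o.elim τG (fun i => (kc i).1)) G
      (fun o x => o.elim (cw l (x, s x)) (fun i => e i ((kc i).2 x) (a i (k i)))) ?_ ?_ ?_ hGfree
    · rintro (_ | i)
      · refine ⟨fun x y h => ?_, fun x y h => ?_⟩
        · exact congrArg Prod.fst (hτG.1 h)
        · exact hτG.2 _ _ (fun hh => h (congrArg Prod.fst hh))
      · obtain ⟨_, hh⟩ := hkinj i _ (hk i)
        refine ⟨hh.1, fun x y hxy => ?_⟩
        refine (adj_inside l hGenc ?_).trans (hh.2 x y hxy)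
        have e1 := ((hmA _ _ _).1 (hA' i x)).1
        have e2 := ((hmA _ _ _).1 (hA' i y)).1
        exact e1.trans e2.symm
    · rintro (_ | i) (_ | i') hij x y
      · exact absurd rfl hij
      · exact ((hmA _ _ _).1 (hA' i' y)).2.2 _
      · exact (((hmA _ _ _).1 (hA' i x)).2.2 _).symm
      · intro heq
        apply hij
        have e1 := ((hmA _ _ _).1 (hA' i x)).1
        have e2 := ((hmA _ _ _).1 (hA' i' y)).1
        dsimp only [Option.elim] at heq
        rw [heq] at e1
        exact congrArg some (e1.symm.trans e2)
    · rintro (_ | i) (_ | i') hij x y hxy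
      · exact absurd rfl hij
      · exact hws i' x y
      · rw [G.adj_comm, H.adj_comm]; exact hws i y x
      · exact hpat (i, x) (i', y) (fun h => hij (congrArg some h))
  · nlinarith
  · intro i _; nlinarith
  · intro q k hk; exact ((hmA _ _ _).1 (hmem q.1 k _ hk)).1
  · rintro ⟨i, x⟩ k ⟨i', x'⟩ k' hii hk hk' heq
    dsimp only at hii hk hk' heq
    subst hii
    have m1' := hmem i k ((kc i).2 x) hk
    have m2' := hmem i k' ((kc i).2 x') hk'
    have hj := hdis i _ _ _ m1' (heq ▸ m2')
    have hx := (hkinj i k hk).1 hj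
    subst hx
    exact ⟨rfl, ha2 i k k' hk hk' (he2 i _ _ _ (hlt i k _ hk) (hlt i k' _ hk') heq)⟩
  · intro q k q' k' hk hk' hcp
    exact mem_fil.2 ⟨hcp, ((hmA _ _ _).1 (hmem q.1 k _ hk)).2.2, ((hmA _ _ _).1 (hmem q'.1 k' _ hk')).2.2⟩

theorem e0_negl {VH : Type} [Fintype VH] (H : SimpleGraph VH) (r : ℕ) (hr : IsWpn H r) (hr0 : 0 < r) (R : ℕ)
    (hR : ∀ {V : Type} (G : SimpleGraph V) (w : Fin R → V),
    Function.Injective w → ∃ (τ : Prop) (ι : VH → Fin R), Function.Injective ι ∧ Homog G τ (w ∘ ι)) (c : ℝ) (hc : 0 < c) :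
    ∃ κ0 : ℝ, 0 < κ0 ∧ ∀ κ, κ ≤ κ0 → ∀ T, Neg r (fun n G => ∃ l, CV κ l G ∧ PZ H r R c T n l G) := by
  obtain ⟨q0, hq0⟩ : ∃ q0 : ℝ, q0 = Fintype.card (Prop × (VH → Fin R)) + 1 := ⟨_, rfl⟩
  have hq0p : (0:ℝ) < q0 := by rw [hq0]; positivity
  have hrr : (0:ℝ) < r := by exact_mod_cast hr0
  obtain ⟨η, hη⟩ : ∃ η : ℝ, η = c / (4 * q0 * r) := ⟨_, rfl⟩
  have hηp : 0 < η := by rw [hη]; positivity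
  obtain ⟨θ, hθ⟩ : ∃ θ : ℝ, θ = (1/2:ℝ)^(Fintype.card (Fin r × VH) ^2) := ⟨_, rfl⟩
  have hθp : 0 < θ := by rw [hθ]; positivity
  obtain ⟨κ0, hκ0, h⟩ := cert_negl r (θ * (η/2)^2) (by positivity)
  obtain ⟨N1, hN1⟩ := ev_lin (c/2) (Fintype.card (VH × (Fin r → Fin R → Bool))) (by positivity)
  obtain ⟨N2, hN2⟩ := ev_lin (η/2) 1 (by positivity)
  refine ⟨κ0, hκ0, fun κ hκ T => h κ hκ T _ _ (max (max N1 N2) 1) ?_⟩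
  intro n hn l G0 hP hcv 𝒢 h𝒢
  have hn1 := hN1 n (le_trans (le_trans (le_max_left _ _) (le_max_left _ _)) hn)
  have hn2 := hN2 n (le_trans (le_trans (le_max_right _ _) (le_max_left _ _)) hn)
  have hn0 : 0 < n := lt_of_lt_of_le one_pos (le_trans (le_max_right _ _) hn)
  have hnn : (0:ℝ) ≤ n := Nat.cast_nonneg _
  obtain ⟨m1, hm1⟩ : ∃ m1, m1 = ⌊η * n⌋₊ := ⟨_, rfl⟩
  have f1 : (m1:ℝ) ≤ η * n := by rw [hm1]; exact Nat.floor_le (by positivity)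
  have f2 : η * n < m1 + 1 := by rw [hm1]; exact Nat.lt_floor_add_one _
  have f3 : η/2 * n ≤ m1 := by linarith
  refine (e0_fibre H r hr hr0 R hR c hc T n m1 hn0 l ?_ κ G0 hP hcv 𝒢 h𝒢).trans ?_
  · have g1 : q0 * (2 * r * (η * n)) = c / 2 * n := by rw [hη]; field_simp; ring
    have g2 : (Fintype.card (Prop × (VH → Fin R)) : ℝ) * (2 * r * m1) ≤ q0 * (2 * r * (η * n)) := by
      apply mul_le_mul _ _ (by positivity) hq0p.le
      · rw [hq0]; linarith
      · exact mul_le_mul_of_nonneg_left f1 (by positivity)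
    linarith
  · apply Real.rpow_le_rpow_of_exponent_le (by norm_num)
    have g1 := card_CP_le hr0 (cS l)
    rw [← hθ]
    have hr1 : (1:ℝ) ≤ r := by exact_mod_cast hr0
    have hm0 : (0:ℝ) ≤ m1 := Nat.cast_nonneg _
    have g3 : (η/2)^2 * n^2 ≤ (m1:ℝ) * (r * m1 : ℕ) := by
      push_cast
      have : (η/2 * n)^2 ≤ (m1:ℝ)^2 := by
        apply pow_le_pow_left₀ (by positivity) f3
      have h5 : (m1:ℝ)^2 ≤ m1 * (r * m1) := by nlinarith [mul_nonneg hm0 hm0]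
      nlinarith
    have := mul_le_mul_of_nonneg_left g3 hθp.le
    linarith

end EZero
end WPN

namespace WPN
section PartB
open Finset Classical

/-- strong structure -/
def STS {n : ℕ} (r : ℕ) (δ : ℝ) (b : ℕ) (G : SimpleGraph (Fin n)) (S : Fin n → Fin r) (β : Fin b → Fin n) : Prop :=
  (∀ v, ∃ a, (#(fil univ (fun x => S x = S v ∧ ¬ (G.Adj v x ↔ G.Adj (β a) x))) : ℝ) < δ * n) ∧
  ∀ i, (n:ℝ) / (4 * r) ≤ #(fil univ (fun v => S v = i))

def ST {n : ℕ} (r : ℕ) (δ : ℝ) (b : ℕ) (G : SimpleGraph (Fin n)) : Prop :=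
  ∃ (S : Fin n → Fin r) (β : Fin b → Fin n), STS r δ b G S β

theorem cover_fin {α : Type} [Nonempty α] (s : Finset α) (b : ℕ) (h : #s ≤ b) : ∃ β : Fin b → α, ∀ x ∈ s, ∃ a, β a = x := by
  let e := s.equivFin
  refine ⟨fun a => if h : a.1 < #s then (e.symm ⟨a.1, h⟩ : α) else Classical.arbitrary α, fun x hx => ?_⟩
  refine ⟨⟨(e ⟨x, hx⟩).1, lt_of_lt_of_le (e ⟨x, hx⟩).2 h⟩, ?_⟩
  simp only [dif_pos (e ⟨x, hx⟩).2]
  simp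

theorem partB_det {VH : Type} [Fintype VH] (H : SimpleGraph VH) (r : ℕ) (hr0 : 0 < r) (δ : ℝ) (hδ : 0 < δ)
    (R RK M T n : ℕ) (hn : 0 < n) (c σ : ℝ) (hc : 0 < c) (hσ : 0 < σ) (hσδ : σ ≤ δ / 4) (hσr : σ ≤ 1 / (4 * r))
    (hRK : ∀ (V : Type) (G : SimpleGraph V) (s : Finset V), RK ≤ #s →
      ∃ (τ : Prop) (z : VH × (Fin r → Fin R → Bool) → V), (∀ x, z x ∈ s) ∧ Homog G τ z)
    (hM : ∀ (n : ℕ) (G : SimpleGraph (Fin n)) (S : Fin n → Fin r), 0 < n → ∀ B : Finset (Fin n), M ≤ #B →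
      (∀ u ∈ B, ∀ v ∈ B, u ≠ v → ∀ i, δ/2 * n ≤ #(fil univ (fun x => S x = i ∧ ¬ (G.Adj u x ↔ G.Adj v x)))) →
      ∃ B' ⊆ B, #B' = RK ∧ ∀ i : Fin r, i.1 < r → ∀ P ⊆ B', c * n ≤ #(fil univ (fun x => S x = i ∧ ∀ u ∈ B', (G.Adj u x ↔ u ∈ P))))
    (G : SimpleGraph (Fin n)) (hfree : IndFree H G) (hWS : WS r T (σ^2) G)
    (h1 : ¬ ∃ l : Cert r T Empty n, CV (σ^2) l G ∧ ∃ i, (#(fil univ (fun v => cS l v = i)) : ℝ) < n / (2 * r))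
    (h0 : ¬ ∃ l, CV (σ^2) l G ∧ PZ H r R c T n l G) : ST r δ (M + T) G := by
  obtain ⟨t, htT, f, U, D, hD⟩ := hWS
  obtain ⟨S, hS⟩ : ∃ S : Fin n → Fin r, ∀ v, S v = U (f v) := ⟨_, fun _ => rfl⟩
  have hnn : (0:ℝ) < n := by exact_mod_cast hn
  have hne : Nonempty (Fin n) := ⟨⟨0, hn⟩⟩
  have hsize : ∀ i, (n:ℝ) / (2 * r) ≤ #(fil univ (fun v => S v = i)) := by
    intro i
    by_contra hlt
    push Not at hlt
    apply h1
    refine ⟨⟨⟨t, by omega⟩, f, (U, D), (fun x => x.elim, fun x => x.elim)⟩, ⟨hD, fun a => a.elim⟩, i, ?_⟩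
    have : (fun v => S v = i) = (fun v => U (f v) = i) := by funext v; rw [hS]
    rw [this] at hlt
    exact hlt
  obtain ⟨B, hBf, hBm⟩ := Finset.exists_max_image (fil (univ : Finset (Fin n)).powerset (fun B =>
    ∀ u ∈ B, ∀ v ∈ B, u ≠ v → ∀ i, δ/2 * n ≤ #(fil univ (fun x => S x = i ∧ ¬ (G.Adj u x ↔ G.Adj v x))))) card
    ⟨∅, mem_fil.2 ⟨by simp, fun u hu => absurd hu (notMem_empty u)⟩⟩
  have hBfar := (mem_fil.1 hBf).2
  have hBM : #B < M := by
    by_contra hge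
    push Not at hge
    obtain ⟨B', hB', hc', hsh⟩ := hM n G S hn B hge hBfar
    obtain ⟨τ, w, hw, hom⟩ := hRK (Fin n) G B' hc'.ge
    apply h0
    refine ⟨⟨⟨t, by omega⟩, f, (U, D), (w, fun a v => G.Adj (w a) v)⟩, ⟨hD, fun a v => Iff.rfl⟩, hfree, ⟨τ, hom⟩, ?_⟩
    intro i Pt
    refine (hsh i i.2 (fil B' (fun u => ∃ a, w a = u ∧ Pt a)) fil_subset).trans (Nat.cast_le.2 (card_le_card ?_))
    intro x hx
    obtain ⟨_, hx1, hx2⟩ := mem_fil.1 hx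
    refine mem_fil.2 ⟨mem_univ _, (hS x).symm.trans hx1, fun a => ?_⟩
    refine (hx2 (w a) (hw a)).trans ?_
    rw [mem_fil]
    constructor
    · rintro ⟨_, a', h, hp⟩; rw [← hom.1 h]; exact hp
    · intro h; exact ⟨hw a, a, rfl, h⟩
  have hclose : ∀ v, ∃ u ∈ B, ∃ i, (#(fil univ (fun x => S x = i ∧ ¬ (G.Adj v x ↔ G.Adj u x))) : ℝ) < δ/2 * n := by
    intro v
    by_cases hv : v ∈ B
    · refine ⟨v, hv, S v, ?_⟩
      have : fil univ (fun x => S x = S v ∧ ¬ (G.Adj v x ↔ G.Adj v x)) = ∅ := by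
        ext x; simp [mem_fil]
      rw [this]; simp; positivity
    · by_contra hcon0
      have hcon : ∀ u ∈ B, ∀ i, δ/2 * n ≤ #(fil univ (fun x => S x = i ∧ ¬ (G.Adj v x ↔ G.Adj u x))) := by
        intro u hu i
        by_contra h
        exact hcon0 ⟨u, hu, i, not_le.1 h⟩
      have hins : insert v B ∈ fil (univ : Finset (Fin n)).powerset (fun B =>
          ∀ u ∈ B, ∀ v ∈ B, u ≠ v → ∀ i, δ/2 * n ≤ #(fil univ (fun x => S x = i ∧ ¬ (G.Adj u x ↔ G.Adj v x)))) := by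
        refine mem_fil.2 ⟨by simp, ?_⟩
        intro u hu u' hu' huu i
        rcases mem_insert.1 hu with h1 | h1
        · rcases mem_insert.1 hu' with h2 | h2
          · exact absurd (h1.trans h2.symm) huu
          · rw [h1]; exact hcon u' h2 i
        · rcases mem_insert.1 hu' with h2 | h2
          · rw [h2]
            refine (hcon u h1 i).trans (Nat.cast_le.2 (card_le_card ?_))
            intro x hx
            obtain ⟨a, b, c⟩ := mem_fil.1 hx
            exact mem_fil.2 ⟨a, b, fun h => c h.symm⟩
          · exact hBfar u h1 u' h2 huu i
      have := hBm _ hins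
      rw [card_insert_of_notMem hv] at this
      omega
  choose cl hclB ci hci using hclose
  obtain ⟨dv, hdv⟩ : ∃ dv : Fin n → Finset (Fin n), ∀ v, dv v = fil univ (fun x => S v = S x ∧ ¬ (G.Adj v x ↔ D (f v) (f x))) :=
    ⟨_, fun _ => rfl⟩
  have hmdv : ∀ v x, x ∈ dv v ↔ (S v = S x ∧ ¬ (G.Adj v x ↔ D (f v) (f x))) := by
    intro v x; rw [hdv, mem_fil]; simp
  obtain ⟨At, hAt⟩ : ∃ At : Finset (Fin n), At = fil univ (fun v => σ * n < #(dv v)) := ⟨_, rfl⟩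
  have hmAt : ∀ v, v ∈ At ↔ σ * n < #(dv v) := by intro v; rw [hAt, mem_fil]; simp
  have hAtc : (#At : ℝ) ≤ σ * n := by
    have e1 : ∑ v, (#(dv v) : ℝ) ≤ σ^2 * n^2 := by
      refine le_trans (le_of_eq ?_) hD
      rw [card_fil, Fintype.sum_prod_type]
      apply sum_congr rfl
      intro v _
      rw [hdv, card_fil]
      apply sum_congr rfl
      intro x _
      simp only [hS]
    have e2 : (#At : ℝ) * (σ * n) ≤ ∑ v, (#(dv v) : ℝ) := by
      calc (#At : ℝ) * (σ * n) = ∑ v ∈ At, σ * n := by rw [sum_const, nsmul_eq_mul]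
        _ ≤ ∑ v ∈ At, (#(dv v) : ℝ) := sum_le_sum (fun v hv => ((hmAt v).1 hv).le)
        _ ≤ _ := sum_le_sum_of_subset_of_nonneg (subset_univ _) (fun _ _ _ => Nat.cast_nonneg _)
    have e3 : (0:ℝ) < σ * n := by positivity
    by_contra hlt
    push Not at hlt
    nlinarith
  have hρ : ∀ a : Fin t, ∃ u : Fin n, (∃ v, v ∉ At ∧ f v = a) → (u ∉ At ∧ f u = a) := by
    intro a
    by_cases h : ∃ v, v ∉ At ∧ f v = a
    · obtain ⟨v, hv⟩ := h; exact ⟨v, fun _ => hv⟩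
    · exact ⟨hne.some, fun h' => absurd h' h⟩
  choose ρ hρ using hρ
  obtain ⟨β, hβ⟩ := cover_fin (B ∪ img ρ univ) (M + T) (by
    refine (card_union_le _ _).trans (Nat.add_le_add hBM.le ((card_img_le _ _).trans ?_))
    rw [card_univ, Fintype.card_fin]; exact htT)
  obtain ⟨S', hS'1, hS'2⟩ : ∃ S' : Fin n → Fin r, (∀ v, v ∈ At → S' v = ci v) ∧ ∀ v, v ∉ At → S' v = S v :=
    ⟨fun v => if v ∈ At then ci v else S v, fun v hv => if_pos hv, fun v hv => if_neg hv⟩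
  refine ⟨S', β, fun v => ?_, fun i => ?_⟩
  · by_cases hv : v ∈ At
    · obtain ⟨a, ha⟩ := hβ (cl v) (mem_union_left _ (hclB v))
      refine ⟨a, ?_⟩
      rw [ha]
      have e1 : #(fil univ (fun x => S' x = S' v ∧ ¬ (G.Adj v x ↔ G.Adj (cl v) x))) ≤
          #At + #(fil univ (fun x => S x = ci v ∧ ¬ (G.Adj v x ↔ G.Adj (cl v) x))) := by
        refine le_trans (card_le_card ?_) (card_union_le _ _)
        intro x hx
        obtain ⟨_, hx1, hx2⟩ := mem_fil.1 hx
        rw [mem_union]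
        by_cases hxA : x ∈ At
        · exact Or.inl hxA
        · right
          rw [hS'2 x hxA, hS'1 v hv] at hx1
          exact mem_fil.2 ⟨mem_univ _, hx1, hx2⟩
      have e2 : (#(fil univ (fun x => S' x = S' v ∧ ¬ (G.Adj v x ↔ G.Adj (cl v) x))) : ℝ) ≤
          #At + #(fil univ (fun x => S x = ci v ∧ ¬ (G.Adj v x ↔ G.Adj (cl v) x))) := by exact_mod_cast e1
      have e3 := hci v
      nlinarith
    · obtain ⟨hu1, hu2⟩ := hρ (f v) ⟨v, hv, rfl⟩
      obtain ⟨u, hu⟩ : ∃ u, u = ρ (f v) := ⟨_, rfl⟩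
      rw [← hu] at hu1 hu2
      obtain ⟨a, ha⟩ := hβ u (mem_union_right _ (mem_img.2 ⟨f v, mem_univ _, hu.symm⟩))
      refine ⟨a, ?_⟩
      rw [ha]
      have e1 : #(fil univ (fun x => S' x = S' v ∧ ¬ (G.Adj v x ↔ G.Adj u x))) ≤ #At + (#(dv v) + #(dv u)) := by
        refine le_trans (card_le_card ?_) ((card_union_le At (dv v ∪ dv u)).trans (Nat.add_le_add_left (card_union_le _ _) _))
        intro x hx
        obtain ⟨_, hx1, hx2⟩ := mem_fil.1 hx
        rw [mem_union, mem_union]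
        by_cases hxA : x ∈ At
        · exact Or.inl hxA
        · right
          rw [hS'2 x hxA, hS'2 v hv] at hx1
          by_contra hcon
          push Not at hcon
          obtain ⟨c1, c2⟩ := hcon
          rw [hmdv] at c1 c2
          have c3 : S u = S x := by rw [hx1, hS, hS, hu2]
          apply hx2
          rw [not_and, not_not] at c1 c2
          rw [c1 hx1.symm, c2 c3, hu2]
      have e2 : (#(fil univ (fun x => S' x = S' v ∧ ¬ (G.Adj v x ↔ G.Adj u x))) : ℝ) ≤ #At + (#(dv v) + #(dv u)) := by exact_mod_cast e1
      rw [hmAt, not_lt] at hv hu1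
      nlinarith
  · have e1 : #(fil univ (fun v => S v = i)) ≤ #(fil univ (fun v => S' v = i)) + #At := by
      refine le_trans (card_le_card ?_) (card_union_le _ _)
      intro x hx
      rw [mem_union]
      by_cases hxA : x ∈ At
      · exact Or.inr hxA
      · left; exact mem_fil.2 ⟨mem_univ _, (hS'2 x hxA).trans (mem_fil.1 hx).2⟩
    have e2 : (#(fil univ (fun v => S v = i)) : ℝ) ≤ #(fil univ (fun v => S' v = i)) + #At := by exact_mod_cast e1
    have e3 := hsize i
    have e4 : σ * n ≤ n / (4 * r) := by
      calc σ * n ≤ 1 / (4 * r) * n := mul_le_mul_of_nonneg_right hσr hnn.le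
        _ = _ := by ring
    have hrr : (0:ℝ) < r := by exact_mod_cast hr0
    have e5 : (n:ℝ) / (2 * r) = n / (4 * r) + n / (4 * r) := by field_simp; norm_num
    linarith

theorem partB {VH : Type} [Fintype VH] (H : SimpleGraph VH) (r : ℕ) (hr : IsWpn H r) (hr0 : 0 < r) (δ : ℝ) (hδ : 0 < δ)
    (hδ1 : δ < 1) : ∃ b, 0 < b ∧ Neg r (fun n G => IndFree H G ∧ ¬ ST r δ b G) := by
  obtain ⟨R, _, hR⟩ := ramsey_fam VH
  obtain ⟨RK, _, hRK⟩ := ramsey_homog (VH × (Fin r → Fin R → Bool))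
  obtain ⟨M, c, hc, hM⟩ := vc_iter (δ/2) (by linarith) (by linarith) r RK r
  obtain ⟨κ1, hκ1, h1⟩ := e1_negl r hr0
  obtain ⟨κ0, hκ0, h0⟩ := e0_negl H r hr hr0 R hR c hc
  have hrr : (0:ℝ) < r := by exact_mod_cast hr0
  obtain ⟨σ, hσ, s1, s2, s3, s4⟩ : ∃ σ : ℝ, 0 < σ ∧ σ ≤ δ/4 ∧ σ ≤ 1 / (4 * r) ∧ σ^2 ≤ κ1 ∧ σ^2 ≤ κ0 := by
    refine ⟨min (min (δ/4) (1/(4*r))) (min (Real.sqrt κ1) (Real.sqrt κ0)), by positivity, ?_, ?_, ?_, ?_⟩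
    · exact (min_le_left _ _).trans (min_le_left _ _)
    · exact (min_le_left _ _).trans (min_le_right _ _)
    · refine le_trans (pow_le_pow_left₀ ?_ ((min_le_right _ _).trans (min_le_left _ _)) 2) (Real.sq_sqrt hκ1.le).le
      positivity
    · refine le_trans (pow_le_pow_left₀ ?_ ((min_le_right _ _).trans (min_le_right _ _)) 2) (Real.sq_sqrt hκ0.le).le
      positivity
  obtain ⟨T, hT⟩ := ws_negl H r hr hr0 (σ^2) (by positivity)
  refine ⟨M + T + 1, by omega, ((hT.neg.or (h1 _ s3 T)).or (h0 _ s4 T)).mono 1 ?_⟩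
  rintro n hn G ⟨hfree, hST⟩
  by_contra hcon
  rw [not_or, not_or] at hcon
  obtain ⟨⟨a1, a2⟩, a3⟩ := hcon
  apply hST
  obtain ⟨S, β, hb1, hb2⟩ := partB_det H r hr0 δ hδ R RK M T n hn c σ hc hσ s1 s2 hRK hM G hfree (by
    by_contra h; exact a1 ⟨hfree, h⟩) a2 a3
  refine ⟨S, fun a => if h : a.1 < M + T then β ⟨a.1, h⟩ else ⟨0, hn⟩, fun v => ?_, hb2⟩
  obtain ⟨a, ha⟩ := hb1 v
  refine ⟨a.castSucc, ?_⟩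
  simp only [Fin.val_castSucc, a.2, dite_true]
  exact ha

end PartB
end WPN

namespace WPN
section VCcount
open Finset Classical

def Shat {n : ℕ} (G : SimpleGraph (Fin n)) (A : Finset (Fin n)) : Prop :=
  ∀ P ⊆ A, ∃ v, ∀ a ∈ A, (G.Adj v a ↔ a ∈ P)

def NoSh {n : ℕ} (d : ℕ) (G : SimpleGraph (Fin n)) : Prop := ∀ A, d ≤ #A → ¬ Shat G A

theorem vc_code {n q m s d : ℕ} (hq : 0 < q) (hm : n ≤ q * m) (hs : s = d * q ^ d)
    (G : SimpleGraph (Fin n)) (hG : NoSh d G) :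
    ∃ c : (Fin m → Fin s → Finset (Fin q)) × (Fin n → Fin m → Fin s),
      ∀ v x : Fin n, ∀ (j : Fin m) (y : Fin q), x.1 = j.1 * q + y.1 → (G.Adj v x ↔ y ∈ c.1 j (c.2 v j)) := by
  obtain ⟨tr, htr⟩ : ∃ tr : Fin m → Fin n → Finset (Fin q), ∀ j v y, y ∈ tr j v ↔ ∃ x : Fin n, x.1 = j.1 * q + y.1 ∧ G.Adj v x :=
    ⟨fun j v => fil univ (fun y => ∃ x : Fin n, x.1 = j.1 * q + y.1 ∧ G.Adj v x), fun j v y => by simp [mem_fil]⟩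
  have hA : ∀ j, #(img (tr j) univ) ≤ s := by
    intro j
    refine (card_le_card_shatterer _).trans ?_
    rw [hs]
    apply card_small_sets q d hq
    intro s0 hs0
    rw [mem_shatterer] at hs0
    by_contra hge
    push Not at hge
    have hx : ∀ y : s0, ∃ x : Fin n, x.1 = j.1 * q + y.1.1 := by
      rintro ⟨y, hy⟩
      obtain ⟨u, hu, he⟩ := hs0 (Subset.refl s0)
      obtain ⟨v, _, rfl⟩ := mem_img.1 hu
      have : y ∈ tr j v := by
        have h1 : y ∈ s0 ∩ tr j v := by rw [he]; exact hy
        exact (mem_inter.1 h1).2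
      obtain ⟨x, hx, _⟩ := (htr j v y).1 this
      exact ⟨x, hx⟩
    choose x hx using hx
    have hinj : Function.Injective x := by
      intro y y' h
      have h1 := hx y
      rw [h, hx y'] at h1
      apply Subtype.ext; apply Fin.ext; omega
    apply hG (univ.map ⟨x, hinj⟩)
    · rw [card_map, card_univ, Fintype.card_coe]; exact hge
    · intro P hP
      obtain ⟨u, hu, he⟩ := hs0 (t := fil s0 (fun y => ∃ h : y ∈ s0, x ⟨y, h⟩ ∈ P)) fil_subset
      obtain ⟨v, _, rfl⟩ := mem_img.1 hu
      refine ⟨v, ?_⟩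
      intro a ha
      obtain ⟨⟨y, hy⟩, _, rfl⟩ := mem_map.1 ha
      show G.Adj v (x ⟨y, hy⟩) ↔ x ⟨y, hy⟩ ∈ P
      have e1 : y ∈ tr j v ↔ G.Adj v (x ⟨y, hy⟩) := by
        rw [htr]
        constructor
        · rintro ⟨x', h1, h2⟩
          have : x' = x ⟨y, hy⟩ := Fin.ext (h1.trans (hx ⟨y, hy⟩).symm)
          rw [← this]; exact h2
        · intro h; exact ⟨_, hx ⟨y, hy⟩, h⟩
      rw [← e1]
      constructor
      · intro h
        have h1 : y ∈ s0 ∩ tr j v := mem_inter.2 ⟨hy, h⟩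
        rw [he] at h1
        obtain ⟨_, _, h2⟩ := mem_fil.1 h1
        exact h2
      · intro h
        have h1 : y ∈ s0 ∩ tr j v := by rw [he]; exact mem_fil.2 ⟨hy, hy, h⟩
        exact (mem_inter.1 h1).2
  choose e he using fun j => cover_fin (img (tr j) univ) s (hA j)
  choose ix hix using fun v j => he j (tr j v) (mem_img.2 ⟨v, mem_univ _, rfl⟩)
  refine ⟨(e, ix), ?_⟩
  intro v x j y hxy
  show _ ↔ y ∈ e j (ix v j)
  rw [hix, htr]
  constructor
  · intro h; exact ⟨x, hxy, h⟩
  · rintro ⟨x', h1, h2⟩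
    have : x' = x := Fin.ext (h1.trans hxy.symm)
    rw [← this]; exact h2

theorem vc_card {n q m s d : ℕ} (hq : 0 < q) (hm : n ≤ q * m) (hs : s = d * q ^ d) :
    #(gr n (NoSh d)) ≤ (2 ^ q) ^ (m * s) * s ^ (n * m) := by
  have h1 : ∀ G : SimpleGraph (Fin n), ∃ c : Option ((Fin m → Fin s → Finset (Fin q)) × (Fin n → Fin m → Fin s)),
      NoSh d G → ∃ c', c = some c' ∧ ∀ v x : Fin n, ∀ (j : Fin m) (y : Fin q), x.1 = j.1 * q + y.1 → (G.Adj v x ↔ y ∈ c'.1 j (c'.2 v j)) := by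
    intro G
    by_cases h : NoSh d G
    · obtain ⟨c, hc⟩ := vc_code hq hm hs G h
      exact ⟨some c, fun _ => ⟨c, rfl, hc⟩⟩
    · exact ⟨none, fun h' => absurd h' h⟩
  choose C hC using h1
  have h2 : #(gr n (NoSh d)) ≤ #((univ : Finset ((Fin m → Fin s → Finset (Fin q)) × (Fin n → Fin m → Fin s))).map ⟨some, Option.some_injective _⟩) := by
    apply card_le_card_of_injOn C
    · intro G hG
      obtain ⟨c, hc, _⟩ := hC G (mem_gr.1 (mem_coe.1 hG))
      rw [hc]; simp
    · intro G hG G' hG' h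
      obtain ⟨c, hc, h1⟩ := hC G (mem_gr.1 (mem_coe.1 hG))
      obtain ⟨c', hc', h2⟩ := hC G' (mem_gr.1 (mem_coe.1 hG'))
      have hcc : c = c' := Option.some_injective _ (hc.symm.trans (h.trans hc'))
      subst hcc
      ext v x
      have hx := x.2
      have e1 : x.1 / q < m := (Nat.div_lt_iff_lt_mul hq).2 (lt_of_lt_of_le hx (by rw [mul_comm]; exact hm))
      have e2 : x.1 = (⟨x.1 / q, e1⟩ : Fin m).1 * q + (⟨x.1 % q, Nat.mod_lt _ hq⟩ : Fin q).1 := (Nat.div_add_mod' x.1 q).symm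
      rw [h1 v x _ _ e2, h2 v x _ _ e2]
  refine h2.trans (le_of_eq ?_)
  rw [card_map, card_univ, Fintype.card_prod, Fintype.card_fun, Fintype.card_fun, Fintype.card_fun, Fintype.card_fun]
  simp only [Fintype.card_fin, Fintype.card_finset]
  rw [← pow_mul, ← pow_mul, ← pow_mul, ← pow_mul, mul_comm m n, mul_comm s m]

theorem vc_count (d : ℕ) (hd : 0 < d) (n : ℕ) (hn : 0 < n) :
    (#(gr n (NoSh d)) : ℝ) ≤ (2:ℝ) ^ ((14 * d : ℝ) * (n:ℝ) ^ (2 - 1 / (2 * d + 1 : ℝ))) := by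
  have hnn : (1:ℝ) ≤ n := by exact_mod_cast hn
  have hn0 : (0:ℝ) < n := by linarith
  have hd1 : (1:ℝ) ≤ d := by exact_mod_cast hd
  obtain ⟨ε, hε⟩ : ∃ ε : ℝ, ε = 1 / (2 * d + 1 : ℝ) := ⟨_, rfl⟩
  have hε0 : 0 < ε := by rw [hε]; positivity
  have hε1 : (2 * d + 1) * ε = 1 := by rw [hε]; field_simp
  rw [← hε]
  obtain ⟨p, hp⟩ : ∃ p, p = ⌊(n:ℝ) ^ ε⌋₊ := ⟨_, rfl⟩
  have h1 : (1:ℝ) ≤ (n:ℝ)^ε := Real.one_le_rpow hnn hε0.le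
  have hp1 : 1 ≤ p := by rw [hp]; exact Nat.le_floor (by simpa using h1)
  have hp1' : (1:ℝ) ≤ p := by exact_mod_cast hp1
  have hpu : (p:ℝ) ≤ (n:ℝ)^ε := by rw [hp]; exact Nat.floor_le (by linarith)
  have hpl : (n:ℝ)^ε ≤ 2 * p := by
    have := Nat.lt_floor_add_one ((n:ℝ)^ε)
    rw [← hp] at this
    linarith
  have hpd : (p:ℝ)^(2*d) ≤ (n:ℝ)^(1-ε) := by
    refine (pow_le_pow_left₀ (by linarith) hpu _).trans (le_of_eq ?_)
    rw [← Real.rpow_natCast, ← Real.rpow_mul hn0.le]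
    congr 1
    push_cast
    linarith
  have hp2 : (p:ℝ)^2 ≤ n := by
    have a1 : (p:ℝ)^2 ≤ (p:ℝ)^(2*d) := pow_le_pow_right₀ hp1' (by omega)
    have a2 : (n:ℝ)^(1-ε) ≤ n := by
      calc (n:ℝ)^(1-ε) ≤ (n:ℝ)^(1:ℝ) := Real.rpow_le_rpow_of_exponent_le hnn (by linarith)
        _ = n := Real.rpow_one _
    linarith
  have hp2' : p^2 ≤ n := by exact_mod_cast hp2
  obtain ⟨m, hm⟩ : ∃ m, m = n / p^2 + 1 := ⟨_, rfl⟩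
  have hpp : 0 < p^2 := by positivity
  have hm1 : n ≤ p^2 * m := by rw [hm]; exact (Nat.lt_mul_div_succ n hpp).le
  have hm2 : p^2 * m ≤ 2 * n := by
    rw [hm, mul_add, mul_one]
    have := Nat.mul_div_le n (p^2)
    omega
  have hcnt := vc_card (n := n) (d := d) hpp hm1 rfl
  have hs : d * (p^2)^d ≤ 2 ^ (3 * d * p) := by
    have b1 : d ≤ 2^(d*p) := (Nat.lt_two_pow_self).le.trans (Nat.pow_le_pow_right (by norm_num) (by nlinarith))
    have b2 : p ≤ 2^p := (Nat.lt_two_pow_self).le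
    calc d * (p^2)^d = d * p^(2*d) := by rw [← pow_mul]
      _ ≤ 2^(d*p) * (2^p)^(2*d) := Nat.mul_le_mul b1 (Nat.pow_le_pow_left b2 _)
      _ = 2 ^ (3 * d * p) := by rw [← pow_mul, ← pow_add]; congr 1; ring
  have hcnt2 : #(gr n (NoSh d)) ≤ 2 ^ (p^2 * m * (d * (p^2)^d) + 3 * d * p * (n * m)) := by
    refine hcnt.trans ?_
    rw [pow_add]
    refine Nat.mul_le_mul (le_of_eq ?_) ?_
    · rw [← pow_mul]; congr 1; ring
    · refine (Nat.pow_le_pow_left hs _).trans (le_of_eq ?_)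
      rw [← pow_mul]
  have hcnt3 : (#(gr n (NoSh d)) : ℝ) ≤ (2:ℝ) ^ ((p^2 * m * (d * (p^2)^d) + 3 * d * p * (n * m) : ℕ) : ℝ) := by
    rw [Real.rpow_natCast]; exact_mod_cast hcnt2
  refine hcnt3.trans (Real.rpow_le_rpow_of_exponent_le (by norm_num) ?_)
  have hm2' : (p:ℝ)^2 * m ≤ 2 * n := by exact_mod_cast hm2
  have c1 : (n:ℝ)^(2-ε) = n * (n:ℝ)^(1-ε) := by
    rw [show 2 - ε = 1 + (1 - ε) by ring, Real.rpow_add hn0, Real.rpow_one]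
  have c2 : (n:ℝ)^(1-ε) * (n:ℝ)^ε = n := by
    rw [← Real.rpow_add hn0]; simp
  have hX0 : 0 < (n:ℝ)^(1-ε) := Real.rpow_pos_of_pos hn0 _
  have c3 : (p:ℝ) * m ≤ 4 * (n:ℝ)^(1-ε) := by
    have d1 : (p:ℝ) * (p * m) ≤ 2 * n := by nlinarith
    have d2 : 2 * (n:ℝ) ≤ p * (4 * (n:ℝ)^(1-ε)) := by nlinarith
    by_contra hlt
    push Not at hlt
    have := mul_lt_mul_of_pos_left hlt (show (0:ℝ) < p by linarith)
    linarith
  push_cast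
  rw [c1, ← pow_mul]
  have f1 : (p:ℝ)^2 * m * (d * (p:ℝ)^(2*d)) ≤ 2 * n * (d * (n:ℝ)^(1-ε)) := by
    apply mul_le_mul hm2' (mul_le_mul_of_nonneg_left hpd (by linarith)) (by positivity) (by positivity)
  have f2 : 3 * (d:ℝ) * p * (n * m) ≤ 12 * d * (n * (n:ℝ)^(1-ε)) := by
    have : 3 * (d:ℝ) * n * (p * m) ≤ 3 * d * n * (4 * (n:ℝ)^(1-ε)) := mul_le_mul_of_nonneg_left c3 (by positivity)
    nlinarith
  nlinarith

end VCcount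
end WPN

namespace WPN
section Gen
open Finset Classical

theorem ev_pow (C α β : ℝ) (h : α < β) : ∃ N : ℕ, 0 < N ∧ ∀ n : ℕ, N ≤ n → C * (n:ℝ) ^ α ≤ (n:ℝ) ^ β := by
  have h1 : Tendsto (fun n : ℕ => (n:ℝ) ^ (β - α)) atTop atTop :=
    (tendsto_rpow_atTop (by linarith)).comp tendsto_natCast_atTop_atTop
  obtain ⟨N, hN⟩ := (h1.eventually_ge_atTop C).exists_forall_of_atTop
  refine ⟨N + 1, by omega, fun n hn => ?_⟩
  have hn0 : (0:ℝ) < n := by exact_mod_cast (show 0 < n by omega)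
  have h2 := hN n (by omega)
  calc C * (n:ℝ)^α ≤ (n:ℝ)^(β - α) * (n:ℝ)^α := mul_le_mul_of_nonneg_right h2 (Real.rpow_pos_of_pos hn0 _).le
    _ = (n:ℝ)^β := by rw [← Real.rpow_add hn0]; congr 1; ring

def restr {n r : ℕ} (G : SimpleGraph (Fin n)) (S : Fin n → Fin r) (Y : Finset (Fin n)) : SimpleGraph (Fin n) where
  Adj u v := G.Adj u v ∧ S u = S v ∧ u ∉ Y ∧ v ∉ Y
  symm := ⟨fun u v h => ⟨h.1.symm, h.2.1.symm, h.2.2.2, h.2.2.1⟩⟩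
  loopless := ⟨fun u h => G.loopless.irrefl u h.1⟩

theorem card_img_factor {X A B : Type} (φ : X → A) (ψ : X → B) (s : Finset X) (T : Finset B)
    (h1 : ∀ x ∈ s, ψ x ∈ T) (h2 : ∀ x ∈ s, ∀ x' ∈ s, ψ x = ψ x' → φ x = φ x') : #(img φ s) ≤ #T := by
  have hch : ∀ a : A, ∃ b : Option B, (a ∈ img φ s → ∃ x ∈ s, φ x = a ∧ b = some (ψ x)) := by
    intro a
    by_cases h : a ∈ img φ s
    · obtain ⟨x, hx, hxa⟩ := mem_img.1 h
      exact ⟨some (ψ x), fun _ => ⟨x, hx, hxa, rfl⟩⟩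
    · exact ⟨none, fun h' => absurd h' h⟩
  choose g hg using hch
  rw [← card_map ⟨some, Option.some_injective B⟩ (s := T)]
  apply card_le_card_of_injOn g
  · intro a ha
    obtain ⟨x, hx, _, he⟩ := hg a (mem_coe.1 ha)
    rw [he]
    simpa using h1 x hx
  · intro a ha a' ha' hh
    obtain ⟨x, hx, hxa, he⟩ := hg a (mem_coe.1 ha)
    obtain ⟨x', hx', hxa', he'⟩ := hg a' (mem_coe.1 ha')
    rw [he, he'] at hh
    rw [← hxa, ← hxa']
    exact h2 x hx x' hx' (Option.some_injective _ hh)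

theorem inside_count {n r b d : ℕ} (S : Fin n → Fin r) (Y : Finset (Fin n)) (ref : Fin b → Finset (Fin n)) (δ : ℝ)
    (𝒢 : Finset (SimpleGraph (Fin n)))
    (h1 : ∀ G ∈ 𝒢, ∀ v, ∃ a, (#(fil univ (fun x => S x = S v ∧ ¬ (G.Adj v x ↔ x ∈ ref a))) : ℝ) ≤ δ * n)
    (h2 : ∀ G ∈ 𝒢, NoSh d (restr G S Y)) :
    #(img (fun G => enc G \ CP S) 𝒢) ≤ #(gr n (NoSh d)) *
      (b * #(fil (univ : Finset (Fin n)).powerset (fun F => (#F : ℝ) ≤ δ * n))) ^ #Y := by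
  have hch : ∀ (G : SimpleGraph (Fin n)) (v : Fin n), ∃ aF : Option (Fin b) × Finset (Fin n), G ∈ 𝒢 → ∃ a, aF.1 = some a ∧
      aF.2 = fil univ (fun x => S x = S v ∧ ¬ (G.Adj v x ↔ x ∈ ref a)) ∧ (#aF.2 : ℝ) ≤ δ * n := by
    intro G v
    by_cases h : G ∈ 𝒢
    · obtain ⟨a, ha⟩ := h1 G h v
      exact ⟨(some a, _), fun _ => ⟨a, rfl, rfl, ha⟩⟩
    · exact ⟨(none, ∅), fun h' => absurd h' h⟩
  choose aF haF using hch
  have key := card_img_factor (fun G => enc G \ CP S) (fun G => (restr G S Y, fun y : Y => aF G y)) 𝒢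
    ((gr n (NoSh d)) ×ˢ Fintype.piFinset (fun y : Y => ((univ : Finset (Fin b)).map ⟨some, Option.some_injective _⟩) ×ˢ
      (fil (univ : Finset (Fin n)).powerset (fun F => (#F : ℝ) ≤ δ * n))))
    (by
      intro G hG
      rw [mem_product]
      refine ⟨mem_gr.2 (h2 G hG), ?_⟩
      rw [Fintype.mem_piFinset]
      intro y
      obtain ⟨a, e1, e2, e3⟩ := haF G y hG
      rw [mem_product]
      refine ⟨?_, mem_fil.2 ⟨by simp, e3⟩⟩
      rw [e1]; simp)
    (by
      intro G hG G' hG' hh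
      obtain ⟨hh1, hh2⟩ := Prod.ext_iff.1 hh
      dsimp only at hh1 hh2
      have hY : ∀ y ∈ Y, ∀ x, S x = S y → (G.Adj y x ↔ G'.Adj y x) := by
        intro y hy x hx
        obtain ⟨a, e1, e2, _⟩ := haF G y hG
        obtain ⟨a', e1', e2', _⟩ := haF G' y hG'
        have e : aF G y = aF G' y := congrFun hh2 ⟨y, hy⟩
        rw [e, e1'] at e1
        have haa : a' = a := Option.some_injective _ e1
        rw [e, e2', haa] at e2
        have e4 : x ∈ fil univ (fun x => S x = S y ∧ ¬ (G'.Adj y x ↔ x ∈ ref a)) ↔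
          x ∈ fil univ (fun x => S x = S y ∧ ¬ (G.Adj y x ↔ x ∈ ref a)) := by rw [e2]
        rw [mem_fil, mem_fil] at e4
        simp only [mem_univ, true_and, hx] at e4
        tauto
      have hall : ∀ u v, S u = S v → (G.Adj u v ↔ G'.Adj u v) := by
        intro u v huv
        by_cases hu : u ∈ Y
        · exact hY u hu v huv.symm
        · by_cases hv : v ∈ Y
          · rw [G.adj_comm, G'.adj_comm]; exact hY v hv u huv
          · have e : (restr G S Y).Adj u v ↔ (restr G' S Y).Adj u v := by rw [hh1]
            have e1 : ∀ K : SimpleGraph (Fin n), (restr K S Y).Adj u v ↔ K.Adj u v := fun K => ⟨fun h => h.1, fun h => ⟨h, huv, hu, hv⟩⟩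
            rw [e1, e1] at e
            exact e
      show enc G \ CP S = enc G' \ CP S
      ext ⟨u, v⟩
      simp only [Finset.mem_sdiff, enc, CP, mem_fil]
      constructor
      · rintro ⟨⟨a1, a2⟩, a3⟩
        have huv : S u = S v := by by_contra h; exact a3 ⟨a1, h⟩
        exact ⟨⟨a1, (hall u v huv).1 a2⟩, a3⟩
      · rintro ⟨⟨a1, a2⟩, a3⟩
        have huv : S u = S v := by by_contra h; exact a3 ⟨a1, h⟩
        exact ⟨⟨a1, (hall u v huv).2 a2⟩, a3⟩)
  refine key.trans (le_of_eq ?_)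
  rw [card_product, Fintype.card_piFinset, prod_const, card_product, card_map, card_univ, card_univ, Fintype.card_fin, Fintype.card_coe]

theorem gen_neg (r b d : ℕ) (hr0 : 0 < r) (hd : 0 < d) (c δ a ε1 : ℝ) (hc : 0 ≤ c) (hε1 : ε1 < 1 / (2 * d + 1)) (ha : 0 < a)
    (hV : ∀ n : ℕ, (#(fil (univ : Finset (Fin n)).powerset (fun F => (#F : ℝ) ≤ δ * n)) : ℝ) ≤ (2:ℝ) ^ (c * n))
    (p : ∀ n : ℕ, SimpleGraph (Fin n) → Prop)
    (Bp : ∀ n : ℕ, SimpleGraph (Fin n) → (Fin n → Fin r) → Finset (Fin n) → Prop) (N0 : ℕ)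
    (hp : ∀ n, N0 ≤ n → ∀ G : SimpleGraph (Fin n), p n G → ∃ (S : Fin n → Fin r) (β : Fin b → Fin n) (Y : Finset (Fin n)),
      STS r δ b G S β ∧ NoSh d (restr G S Y) ∧ Bp n G S Y)
    (hB : ∀ n, N0 ≤ n → ∀ (S : Fin n → Fin r) (Y : Finset (Fin n)) (G0 : SimpleGraph (Fin n)) (𝒢 : Finset (SimpleGraph (Fin n))),
      Bp n G0 S Y → (∀ G ∈ 𝒢, Bp n G S Y ∧ enc G \ CP S = enc G0 \ CP S) →
      (#𝒢 : ℝ) ≤ (2:ℝ) ^ ((1 - 1/(r:ℝ)) * n^2 / 2 - (c * n * #Y + a * (n:ℝ)^(2-ε1)))) : Neg r p := by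
  obtain ⟨N1, _, hN1⟩ := ev_pow (2 * (r + 1 + b + b + 2) / a) 1 (2 - ε1) (by
    have : 1 / (2 * (d:ℝ) + 1) ≤ 1 := by
      rw [div_le_one (by positivity)]
      have : (0:ℝ) ≤ d := Nat.cast_nonneg d
      linarith
    have h3 : ε1 < 1 := by linarith
    linarith)
  obtain ⟨N2, _, hN2⟩ := ev_pow (2 * (14 * d) / a) (2 - 1 / (2 * d + 1)) (2 - ε1) (by linarith)
  refine ⟨1, N0 + N1 + N2 + 1, by norm_num, fun n hn => ?_⟩
  rw [one_mul]
  have hn1 := hN1 n (by omega)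
  have hn2 := hN2 n (by omega)
  obtain ⟨W, hW⟩ : ∃ W : ℝ, W = (n:ℝ)^(2-ε1) := ⟨_, rfl⟩
  obtain ⟨W', hW'⟩ : ∃ W' : ℝ, W' = (n:ℝ) ^ (2 - 1 / (2 * d + 1 : ℝ)) := ⟨_, rfl⟩
  rw [← hW, Real.rpow_one] at hn1
  rw [← hW, ← hW'] at hn2
  have hn1' : 2 * (r + 1 + b + b + 2) * n ≤ a * W := by
    rw [div_mul_eq_mul_div, div_le_iff₀ ha] at hn1; linarith
  have hn2' : 2 * (14 * d) * W' ≤ a * W := by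
    rw [div_mul_eq_mul_div, div_le_iff₀ ha] at hn2; linarith
  obtain ⟨P, hP⟩ : ∃ P : ((Fin n → Fin r) × Finset (Fin n) × (Fin b → Finset (Fin n))) → SimpleGraph (Fin n) → Prop,
    ∀ l G, P l G ↔ ((∀ v, ∃ a, (#(fil univ (fun x => l.1 x = l.1 v ∧ ¬ (G.Adj v x ↔ x ∈ l.2.2 a))) : ℝ) ≤ δ * n) ∧
      NoSh d (restr G l.1 l.2.1) ∧ Bp n G l.1 l.2.1) := ⟨_, fun _ _ => Iff.rfl⟩
  have hfib : ∀ l, (#(fil (gr n (p n)) (P l)) : ℝ) ≤ (2:ℝ) ^ ((1 - 1/(r:ℝ)) * n^2 / 2 + (14 * d * W' + b * n - a * W)) := by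
    intro l
    have hA : (#(img (fun G => enc G \ CP l.1) (fil (gr n (p n)) (P l))) : ℝ) ≤ (2:ℝ) ^ (14 * d * W' + b * n + c * n * #l.2.1) := by
      have h1 := inside_count (d := d) l.1 l.2.1 l.2.2 δ (fil (gr n (p n)) (P l)) (fun G hG => ((hP l G).1 (mem_fil.1 hG).2).1)
        (fun G hG => ((hP l G).1 (mem_fil.1 hG).2).2.1)
      have h2 : (#(img (fun G => enc G \ CP l.1) (fil (gr n (p n)) (P l))) : ℝ) ≤ #(gr n (NoSh d)) *
        (b * #(fil (univ : Finset (Fin n)).powerset (fun F => (#F : ℝ) ≤ δ * n))) ^ #l.2.1 := by exact_mod_cast h1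
      refine h2.trans ?_
      have h3 := vc_count d hd n (by omega)
      rw [← hW'] at h3
      have hb2 : (b:ℝ) ≤ (2:ℝ)^(b:ℝ) := by
        rw [Real.rpow_natCast]; exact_mod_cast (Nat.lt_two_pow_self (n := b)).le
      have h4 : ((b:ℝ) * #(fil (univ : Finset (Fin n)).powerset (fun F => (#F : ℝ) ≤ δ * n))) ^ #l.2.1 ≤
          (2:ℝ) ^ ((b + c * n) * #l.2.1) := by
        rw [Real.rpow_mul (by norm_num), Real.rpow_natCast, Real.rpow_add (by norm_num)]
        exact pow_le_pow_left₀ (by positivity) (mul_le_mul hb2 (hV n) (Nat.cast_nonneg _) (by positivity)) _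
      refine (mul_le_mul h3 h4 (by positivity) (by positivity)).trans ?_
      rw [← Real.rpow_add (by norm_num)]
      apply Real.rpow_le_rpow_of_exponent_le (by norm_num)
      have h5 : (#l.2.1 : ℝ) ≤ n := by
        have := card_le_univ l.2.1
        rw [Fintype.card_fin] at this
        exact_mod_cast this
      have h6 : (b:ℝ) * #l.2.1 ≤ b * n := mul_le_mul_of_nonneg_left h5 (Nat.cast_nonneg _)
      linarith
    have h7 := count_cert (Λ := Unit) (fil (gr n (p n)) (P l)) (fun _ _ => True) (fun G _ => ⟨(), trivial⟩)
      (fun _ G => enc G \ CP l.1) ((2:ℝ) ^ (14 * d * W' + b * n + c * n * #l.2.1))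
      ((2:ℝ) ^ ((1 - 1/(r:ℝ)) * n^2 / 2 - (c * n * #l.2.1 + a * W))) (by positivity)
      (fun _ => le_trans (Nat.cast_le.2 (card_le_card (by
        intro x hx
        obtain ⟨G, hG, e⟩ := mem_img.1 hx
        exact mem_img.2 ⟨G, (mem_fil.1 hG).1, e⟩))) hA)
      (fun _ G0 hG0 _ => by
        rw [hW]
        apply hB n (by omega) l.1 l.2.1 G0 _ ((hP l G0).1 (mem_fil.1 hG0).2).2.2
        intro G hG
        obtain ⟨g1, _, g2⟩ := mem_fil.1 hG
        exact ⟨((hP l G).1 (mem_fil.1 g1).2).2.2, g2⟩)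
    refine h7.trans (le_of_eq ?_)
    rw [Fintype.card_unit, Nat.cast_one, one_mul, ← Real.rpow_add (by norm_num)]
    congr 1; ring
  have h8 := count_cert (gr n (p n)) P (by
      intro G hG
      obtain ⟨S, β, Y, s1, s2, s3⟩ := hp n (by omega) G (mem_gr.1 hG)
      refine ⟨(S, Y, fun a => fil univ (fun x => G.Adj (β a) x)), (hP _ _).2 ⟨?_, s2, s3⟩⟩
      intro v
      obtain ⟨a, ha⟩ := s1.1 v
      refine ⟨a, le_trans (le_of_eq ?_) ha.le⟩
      congr 2
      apply fil_congr
      intro x _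
      rw [mem_fil]; simp) (fun _ _ => ()) 1 ((2:ℝ) ^ ((1 - 1/(r:ℝ)) * n^2 / 2 + (14 * d * W' + b * n - a * W))) (by positivity)
      (fun l => by
        have : #(img (fun _ : SimpleGraph (Fin n) => ()) (fil (gr n (p n)) (P l))) ≤ 1 := by
          refine (card_le_univ _).trans ?_
          simp
        exact_mod_cast this)
      (fun l G0 _ _ => le_trans (Nat.cast_le.2 (card_le_card (by
        intro x hx
        obtain ⟨a1, a2, _⟩ := mem_fil.1 hx
        exact mem_fil.2 ⟨a1, a2⟩))) (hfib l))
  refine h8.trans ?_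
  rw [mul_one]
  have h9 : (Fintype.card ((Fin n → Fin r) × Finset (Fin n) × (Fin b → Finset (Fin n))) : ℝ) ≤ (2:ℝ) ^ ((r + 1 + b) * n : ℝ) := by
    rw [Fintype.card_prod, Fintype.card_prod, Fintype.card_fun, Fintype.card_fun]
    simp only [Fintype.card_fin, Fintype.card_finset]
    have e1 := pow_le_two_rpow r n
    have e2 : (2:ℝ) ^ ((r + 1 + b) * n : ℝ) = (2:ℝ)^(r * n : ℝ) * ((2^n : ℕ) * ((2^n)^b : ℕ) : ℝ) := by
      rw [← pow_mul]; push_cast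
      rw [← Real.rpow_natCast, ← Real.rpow_natCast, ← Real.rpow_add (by norm_num), ← Real.rpow_add (by norm_num)]
      congr 1; push_cast; ring
    rw [e2]
    push_cast at e1 ⊢
    exact mul_le_mul_of_nonneg_right e1 (by positivity)
  refine (mul_le_mul_of_nonneg_right h9 (by positivity)).trans ?_
  rw [← Real.rpow_add (by norm_num)]
  apply Real.rpow_le_rpow_of_exponent_le (by norm_num)
  nlinarith

end Gen
end WPN

namespace WPN
section Packs
open Finset Classical

def HasPack {V Q : Type} (A : (Q → V) → Prop) (s : Finset V) (m : ℕ) : Prop :=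
  ∃ z : ℕ → Q → V, (∀ k < m, A (z k) ∧ ∀ q, z k q ∈ s) ∧ ∀ k < m, ∀ k' < m, ∀ q q', z k q = z k' q' → k = k'

theorem pack_cover {V Q : Type} [Nonempty V] [Fintype Q] (A : (Q → V) → Prop) (s : Finset V) (m : ℕ) (h : ¬ HasPack A s m) :
    ∃ m' < m, HasPack A s m' ∧ ∃ Y ⊆ s, #Y ≤ Fintype.card Q * m' ∧ ∀ w, A w → (∀ q, w q ∈ s) → ∃ q, w q ∈ Y := by
  have hex : ∃ m, ¬ HasPack A s m := ⟨m, h⟩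
  obtain ⟨m0, hm0⟩ : ∃ m0, m0 = Nat.find hex := ⟨_, rfl⟩
  have h0 : ¬ HasPack A s m0 := by rw [hm0]; exact Nat.find_spec hex
  have hmin : ∀ k, k < m0 → HasPack A s k := fun k hk => by
    by_contra hh
    rw [hm0] at hk
    exact Nat.find_min hex hk hh
  have hle : m0 ≤ m := by rw [hm0]; exact Nat.find_min' hex h
  have hpos : 0 < m0 := by
    rcases Nat.eq_zero_or_pos m0 with h1 | h1
    · exfalso
      apply h0
      rw [h1]
      exact ⟨fun _ _ => Classical.arbitrary V, fun k hk => absurd hk (by omega), fun k hk => absurd hk (by omega)⟩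
    · exact h1
  refine ⟨m0 - 1, by omega, hmin _ (by omega), ?_⟩
  obtain ⟨z, hz1, hz2⟩ := hmin (m0 - 1) (by omega)
  refine ⟨img (fun p : ℕ × Q => z p.1 p.2) (range (m0 - 1) ×ˢ univ), ?_, ?_, ?_⟩
  · intro x hx
    obtain ⟨⟨k, q⟩, hp, rfl⟩ := mem_img.1 hx
    rw [mem_product, mem_range] at hp
    exact (hz1 k hp.1).2 q
  · refine (card_img_le _ _).trans ?_
    rw [card_product, card_range, card_univ, mul_comm]
  · intro w hw hws
    by_contra hcon
    push Not at hcon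
    apply h0
    have hav : ∀ k < m0 - 1, ∀ q q', z k q ≠ w q' := by
      intro k hk q q' he
      exact hcon q' (mem_img.2 ⟨(k, q), mem_product.2 ⟨mem_range.2 hk, mem_univ _⟩, he⟩)
    refine ⟨fun k => if k < m0 - 1 then z k else w, ?_, ?_⟩
    · intro k hk
      by_cases h1 : k < m0 - 1
      · simp only [h1, if_true]; exact hz1 k h1
      · simp only [h1, if_false]; exact ⟨hw, hws⟩
    · intro k hk k' hk' q q' he
      by_cases h1 : k < m0 - 1
      · by_cases h2 : k' < m0 - 1
        · simp only [h1, h2, if_true] at he; exact hz2 k h1 k' h2 q q' he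
        · simp only [h1, h2, if_true, if_false] at he
          exact absurd he (hav k h1 q q')
      · by_cases h2 : k' < m0 - 1
        · simp only [h1, h2, if_true, if_false] at he
          exact absurd he.symm (hav k' h2 q' q)
        · omega

theorem pack_bound {V Q : Type} (A : (Q → V) → Prop) (s : Finset V) (m : ℕ) (q : Q) (h : HasPack A s m) : m ≤ #s := by
  obtain ⟨z, h1, h2⟩ := h
  calc m = #(range m) := (card_range m).symm
    _ ≤ #s := by
      apply card_le_card_of_injOn (fun k => z k q)
      · intro k hk
        exact mem_coe.2 ((h1 k (mem_range.1 (mem_coe.1 hk))).2 q)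
      · intro k hk k' hk' he
        exact h2 k (mem_range.1 (mem_coe.1 hk)) k' (mem_range.1 (mem_coe.1 hk')) q q he

theorem homog_pack {VH V : Type} [Nonempty V] [Fintype VH] (R : ℕ)
    (hR : ∀ (V : Type) (G : SimpleGraph V) (s : Finset V), R ≤ #s → ∃ (τ : Prop) (z : VH → V), (∀ x, z x ∈ s) ∧ Homog G τ z)
    (G : SimpleGraph V) (s : Finset V) (m : ℕ) (h : Fintype.card VH * m + R ≤ #s) :
    HasPack (fun w : VH → V => ∃ τ, Homog G τ w) s m := by
  by_contra hcon
  obtain ⟨m', hm', _, Y, hY, hYc, hcov⟩ := pack_cover _ _ _ hcon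
  have h1 : R ≤ #(s \ Y) := by
    have := le_card_sdiff Y s
    have h3 : Fintype.card VH * m' ≤ Fintype.card VH * m := Nat.mul_le_mul_left _ hm'.le
    omega
  obtain ⟨τ, z, hz, hh⟩ := hR V G (s \ Y) h1
  obtain ⟨q, hq⟩ := hcov z ⟨τ, hh⟩ (fun q => (Finset.mem_sdiff.1 (hz q)).1)
  exact (Finset.mem_sdiff.1 (hz q)).2 hq

def UkCopy {V : Type} (k : ℕ) (G : SimpleGraph V) (w : Fin k ⊕ Finset (Fin k) → V) : Prop :=
  Function.Injective w ∧ ∀ (a : Fin k) (s : Finset (Fin k)), G.Adj (w (Sum.inl a)) (w (Sum.inr s)) ↔ a ∈ s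

theorem nosh_of_cover {n r k : ℕ} (G : SimpleGraph (Fin n)) (S : Fin n → Fin r) (Y : Finset (Fin n))
    (hcov : ∀ i, ∀ w, UkCopy k G w → (∀ q, S (w q) = i) → ∃ q, w q ∈ Y) : NoSh (2 * k + 1) (restr G S Y) := by
  intro A hA hsh
  obtain ⟨a0, ha0⟩ : ∃ a0, a0 ∈ A := card_pos.1 (by omega)
  obtain ⟨T, hT, hTc⟩ := exists_subset_card_eq (s := A.erase a0) (n := k) (by rw [card_erase_of_mem ha0]; omega)
  obtain ⟨T2, hT2⟩ : ∃ T2, T2 = (A.erase a0) \ T := ⟨_, rfl⟩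
  have hT2c : k ≤ #T2 := by
    rw [hT2, card_sdiff_of_subset hT, card_erase_of_mem ha0]; omega
  have hTA : ∀ x ∈ T, x ∈ A ∧ x ≠ a0 := fun x hx => ⟨(mem_erase.1 (hT hx)).2, (mem_erase.1 (hT hx)).1⟩
  have hT2A : ∀ x ∈ T2, x ∈ A ∧ x ≠ a0 ∧ x ∉ T := fun x hx => by
    rw [hT2, Finset.mem_sdiff] at hx
    exact ⟨(mem_erase.1 hx.1).2, (mem_erase.1 hx.1).1, hx.2⟩
  obtain ⟨v0, hv0⟩ := hsh A (Subset.refl A)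
  have hcls : ∀ a ∈ A, S a = S a0 ∧ a ∉ Y := by
    intro a ha
    have h1 := (hv0 a ha).2 ha
    have h2 := (hv0 a0 ha0).2 ha0
    exact ⟨h1.2.1.symm.trans h2.2.1, h1.2.2.2⟩
  have hfe : Nonempty (Fin k ≃ T) := ⟨(Fin.castOrderIso (by rw [← hTc])).toEquiv.trans T.equivFin.symm⟩
  obtain ⟨f⟩ := hfe
  have hv : ∀ s : Finset (Fin k), ∃ v, v ∉ T ∧ (restr G S Y).Adj v a0 ∧ ∀ a : Fin k, ((restr G S Y).Adj v (f a) ↔ a ∈ s) := by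
    intro s
    by_contra hcon
    obtain ⟨pt, hpt⟩ : ∃ pt : Finset (Fin n) → Finset (Fin n), ∀ Q x, x ∈ pt Q ↔ x ∈ A ∧ (x = a0 ∨ x ∈ Q ∨ ∃ a ∈ s, (f a : Fin n) = x) :=
      ⟨fun Q => fil A (fun x => x = a0 ∨ x ∈ Q ∨ ∃ a ∈ s, (f a : Fin n) = x), fun Q x => mem_fil⟩
    choose g hg using fun Q => hsh (pt Q) (fun x hx => ((hpt Q x).1 hx).1)
    have hgT : ∀ Q ⊆ T2, g Q ∈ T := by
      intro Q hQ
      by_contra hno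
      apply hcon
      refine ⟨g Q, hno, (hg Q a0 ha0).2 ((hpt _ _).2 ⟨ha0, Or.inl rfl⟩), fun a => ?_⟩
      have hfa := hTA _ (f a).2
      rw [hg Q _ hfa.1, hpt]
      constructor
      · rintro ⟨_, h1 | h1 | ⟨a', h1, h2⟩⟩
        · exact absurd h1 hfa.2
        · exact absurd (f a).2 (hT2A _ (hQ h1)).2.2
        · have : a' = a := f.injective (Subtype.ext h2)
          rw [← this]; exact h1
      · intro h; exact ⟨hfa.1, Or.inr (Or.inr ⟨a, h, rfl⟩)⟩
    have hle : #T2.powerset ≤ #T := by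
      apply card_le_card_of_injOn g
      · intro Q hQ; exact mem_coe.2 (hgT Q (mem_powerset.1 (mem_coe.1 hQ)))
      · intro Q hQ Q' hQ' he
        have hQ := mem_powerset.1 (mem_coe.1 hQ)
        have hQ' := mem_powerset.1 (mem_coe.1 hQ')
        have key : ∀ Q ⊆ T2, ∀ x ∈ T2, (x ∈ Q ↔ (restr G S Y).Adj (g Q) x) := by
          intro Q hQ x hx
          have hxx := hT2A x hx
          rw [hg Q x hxx.1, hpt]
          constructor
          · intro h; exact ⟨hxx.1, Or.inr (Or.inl h)⟩
          · rintro ⟨_, h1 | h1 | ⟨a', h1, h2⟩⟩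
            · exact absurd h1 hxx.2.1
            · exact h1
            · rw [← h2] at hxx; exact absurd (f a').2 hxx.2.2
        ext x
        constructor
        · intro h
          have hx := hQ h
          rw [key Q' hQ' x hx, ← he, ← key Q hQ x hx]; exact h
        · intro h
          have hx := hQ' h
          rw [key Q hQ x hx, he, ← key Q' hQ' x hx]; exact h
    rw [card_powerset, hTc] at hle
    have h1 : k < 2 ^ k := Nat.lt_two_pow_self
    have h2 : 2 ^ k ≤ 2 ^ #T2 := Nat.pow_le_pow_right (by norm_num) hT2c
    omega
  choose g hgT hga0 hgf using hv
  have hfA : ∀ a, (f a : Fin n) ∈ A := fun a => (hTA _ (f a).2).1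
  obtain ⟨q, hq⟩ := hcov (S a0) (Sum.elim (fun a => (f a : Fin n)) g) ⟨by
      rintro (a | s) (a' | s') he
      · exact congrArg Sum.inl (f.injective (Subtype.ext he))
      · have he : (f a : Fin n) = g s' := he
        exact absurd (f a).2 (by rw [he]; exact hgT s')
      · have he : g s = (f a' : Fin n) := he
        exact absurd (f a').2 (by rw [← he]; exact hgT s)
      · have he : g s = g s' := he
        congr 1
        ext a
        rw [← hgf s a, he, hgf s' a], by
      intro a s
      show G.Adj (f a : Fin n) (g s) ↔ a ∈ s
      rw [← hgf s a, G.adj_comm]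
      exact ⟨fun h => ⟨h, (hga0 s).2.1.trans (hcls _ (hfA a)).1.symm, (hga0 s).2.2.1, (hcls _ (hfA a)).2⟩, fun h => h.1⟩⟩ (by
      rintro (a | s)
      · exact (hcls _ (hfA a)).1
      · exact (hga0 s).2.1)
  rcases q with a | s
  · exact (hcls _ (hfA a)).2 hq
  · exact (hga0 s).2.2.1 hq

theorem adj_in {n r : ℕ} {S : Fin n → Fin r} {G G0 : SimpleGraph (Fin n)} (h : enc G \ CP S = enc G0 \ CP S)
    {u v : Fin n} (huv : S u = S v) : G.Adj u v ↔ G0.Adj u v := by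
  apply adj_of_enc h
  · intro hh; exact (mem_fil.1 hh).2 huv
  · intro hh; exact (mem_fil.1 hh).2 huv.symm

def cls (r : ℕ) (i0 : Fin r) : Option (Fin r) → Fin r := fun o => o.elim i0 id

theorem e3_fibre {VH : Type} [Fintype VH] (H : SimpleGraph VH) (r : ℕ) (hr : IsWpn H r) (k : ℕ)
    (hk : ∀ {V : Type} (G : SimpleGraph V) (f : Fin k ↪ V) (g : Finset (Fin k) ↪ V),
      (∀ (a : Fin k) (s : Finset (Fin k)), G.Adj (f a) (g s) ↔ a ∈ s) →
      ∃ (τa τb : Prop) (a b : VH → V), Homog G τa a ∧ Homog G τb b ∧ (∀ x, a x ∈ Set.range f) ∧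
        (∀ x, b x ∈ Set.range g) ∧ ∀ x y, G.Adj (a x) (b y) ↔ H.Adj x y) {n : ℕ} (S : Fin n → Fin r)
    (i0 : Fin r) (m L μ : ℕ) (hm : m ≤ μ) (G0 : SimpleGraph (Fin n))
    (hU : HasPack (UkCopy k G0) (fil univ (fun v => S v = i0)) μ)
    (hO : ∀ i, HasPack (fun w : VH → Fin n => ∃ τ, Homog G0 τ w) (fil univ (fun v => S v = i)) (L + r * m))
    (𝒢 : Finset (SimpleGraph (Fin n))) (h𝒢 : ∀ G ∈ 𝒢, IndFree H G ∧ enc G \ CP S = enc G0 \ CP S) :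
    (#𝒢 : ℝ) ≤ (2:ℝ) ^ ((#(CP S) : ℝ) - (1/2:ℝ)^(Fintype.card (Option (Fin r) × VH) ^2) * (m * L)) := by
  obtain ⟨u, hu1, hu2⟩ := hU
  have hab : ∀ j, ∃ ab : (VH → Fin n) × (VH → Fin n), j < μ → (∃ τ, Homog G0 τ ab.1) ∧ (∃ τ, Homog G0 τ ab.2) ∧
      (∀ x, ∃ a, u j (Sum.inl a) = ab.1 x) ∧ (∀ x, ∃ s, u j (Sum.inr s) = ab.2 x) ∧ ∀ x y, G0.Adj (ab.1 x) (ab.2 y) ↔ H.Adj x y := by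
    intro j
    by_cases hj : j < μ
    · have hc := (hu1 j hj).1
      obtain ⟨τa, τb, a, b, h1, h2, h3, h4, h5⟩ := hk G0 ⟨fun a => u j (Sum.inl a), fun a a' h => Sum.inl_injective (hc.1 h)⟩
        ⟨fun a => u j (Sum.inr a), fun a a' h => Sum.inr_injective (hc.1 h)⟩ hc.2
      exact ⟨(a, b), fun _ => ⟨⟨τa, h1⟩, ⟨τb, h2⟩, h3, h4, h5⟩⟩
    · exact ⟨(fun _ => u j (Sum.inr ∅), fun _ => u j (Sum.inr ∅)), fun h => absurd h hj⟩
  choose ab hab using hab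
  choose z hz1 hz2 using hO
  obtain ⟨len, hl0, hl1⟩ : ∃ len : Fin r → ℕ, len i0 = μ ∧ ∀ i, i ≠ i0 → len i = L + r * m :=
    ⟨fun i => if i = i0 then μ else L + r * m, if_pos rfl, fun i hi => if_neg hi⟩
  obtain ⟨zz, hzn, hz0, hzi⟩ : ∃ zz : Option (Fin r) → ℕ → VH → Fin n, (∀ j, zz none j = (ab j).2) ∧
      (∀ j, zz (some i0) j = (ab j).1) ∧ ∀ i, i ≠ i0 → ∀ j, zz (some i) j = z i j :=
    ⟨fun o j => o.elim (ab j).2 (fun i => if i = i0 then (ab j).1 else z i j), fun j => rfl, fun j => by simp,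
      fun i hi j => by simp [hi]⟩
  have hcn : cls r i0 none = i0 := rfl
  have hcs : ∀ i, cls r i0 (some i) = i := fun i => rfl
  have hhom : ∀ o j, j < len (cls r i0 o) → (∃ τ, Homog G0 τ (zz o j)) ∧ ∀ x, S (zz o j x) = cls r i0 o := by
    rintro (_ | i) j hj
    · rw [hcn, hl0] at hj
      rw [hzn]
      refine ⟨(hab j hj).2.1, fun x => ?_⟩
      obtain ⟨s, hs⟩ := (hab j hj).2.2.2.1 x
      rw [← hs]
      exact (mem_fil.1 ((hu1 j hj).2 _)).2
    · by_cases hi : i = i0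
      · rw [hi] at hj ⊢
        rw [hcs, hl0] at hj
        rw [hz0]
        refine ⟨(hab j hj).1, fun x => ?_⟩
        obtain ⟨s, hs⟩ := (hab j hj).2.2.1 x
        rw [← hs]
        exact (mem_fil.1 ((hu1 j hj).2 _)).2
      · rw [hcs, hl1 i hi] at hj
        rw [hzi i hi]
        exact ⟨(hz1 i j hj).1, fun x => (mem_fil.1 ((hz1 i j hj).2 x)).2⟩
  have hcross : ∀ j j' x x', j < μ → j' < μ → (ab j).1 x ≠ (ab j').2 x' := by
    intro j j' x x' hj hj' he
    obtain ⟨a, ha⟩ := (hab j hj).2.2.1 x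
    obtain ⟨s, hs⟩ := (hab j' hj').2.2.2.1 x'
    rw [← ha, ← hs] at he
    have hjj := hu2 j hj j' hj' _ _ he
    rw [← hjj] at he
    exact absurd ((hu1 j hj).1.1 he) (by simp)
  have hinj : ∀ o j x o' j' x', cls r i0 o = cls r i0 o' → j < len (cls r i0 o) → j' < len (cls r i0 o') →
      zz o j x = zz o' j' x' → o = o' ∧ x = x' ∧ j = j' := by
    have hsame : ∀ o j x x', j < len (cls r i0 o) → zz o j x = zz o j x' → x = x' := by
      intro o j x x' hj he
      obtain ⟨⟨τ, h⟩, _⟩ := hhom o j hj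
      exact h.1 he
    rintro (_ | i) j x (_ | i') j' x' hc hj hj' he
    · rw [hcn, hl0] at hj hj'
      have hjj : j = j' := by
        rw [hzn, hzn] at he
        obtain ⟨a, ha⟩ := (hab j hj).2.2.2.1 x
        obtain ⟨s, hs⟩ := (hab j' hj').2.2.2.1 x'
        rw [← ha, ← hs] at he
        exact hu2 j hj j' hj' _ _ he
      subst hjj
      exact ⟨rfl, hsame none j x x' (by rw [hcn, hl0]; exact hj) he, rfl⟩
    · rw [hcn, hcs] at hc
      rw [hcn, hl0] at hj
      rw [hcs, ← hc, hl0] at hj'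
      rw [hzn, ← hc, hz0] at he
      exact absurd he.symm (hcross j' j x' x hj' hj)
    · rw [hcn, hcs] at hc
      rw [hcn, hl0] at hj'
      rw [hcs, hc, hl0] at hj
      rw [hzn, hc, hz0] at he
      exact absurd he (hcross j j' x x' hj hj')
    · rw [hcs, hcs] at hc
      subst hc
      rw [hcs] at hj hj'
      have hjj : j = j' := by
        by_cases hi : i = i0
        · subst hi
          rw [hl0] at hj hj'
          rw [hz0, hz0] at he
          obtain ⟨a, ha⟩ := (hab j hj).2.2.1 x
          obtain ⟨s, hs⟩ := (hab j' hj').2.2.1 x'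
          rw [← ha, ← hs] at he
          exact hu2 j hj j' hj' _ _ he
        · rw [hl1 i hi] at hj hj'
          rw [hzi i hi, hzi i hi] at he
          exact hz2 i j hj j' hj' _ _ he
      subst hjj
      exact ⟨rfl, hsame (some i) j x x' hj he, rfl⟩
  apply lines S (fun q : Option (Fin r) × VH => cls r i0 q.1) i0 m L (fun q j => zz q.1 j q.2)
    (fun q q' => H.Adj q.2 q'.2) (fun q q' h => h.symm) len _ _ _ _ (CP S) (Subset.refl _) _ 𝒢 G0
    (fun G hG => (h𝒢 G hG).2)
  · intro G hG j hj hpat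
    obtain ⟨hGfree, hGenc⟩ := h𝒢 G hG
    have hh : ∀ o, ∃ τ, Homog G0 τ (zz o (j (cls r i0 o))) := fun o => (hhom o _ (hj _)).1
    have hSS : ∀ o x, S (zz o (j (cls r i0 o)) x) = cls r i0 o := fun o => (hhom o _ (hj _)).2
    choose τ hτ using hh
    refine template H r hr (Option (Fin r)) (by simp) τ G (fun o => zz o (j (cls r i0 o))) ?_ ?_ ?_ hGfree
    · intro o
      refine ⟨(hτ o).1, fun x y hxy => ?_⟩
      exact (adj_in hGenc ((hSS o x).trans (hSS o y).symm)).trans ((hτ o).2 x y hxy)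
    · intro o o' hoo x y he
      have hc : cls r i0 o = cls r i0 o' := by rw [← hSS o x, he, hSS]
      exact hoo (hinj o _ x o' _ y hc (hj _) (hj _) he).1
    · have h0 := hj i0
      rw [hl0] at h0
      rintro (_ | i) (_ | i') hoo x y hxy
      · exact absurd rfl hoo
      · by_cases hi : i' = i0
        · subst hi
          refine (adj_in hGenc ((hSS none x).trans (hSS (some i') y).symm)).trans ?_
          rw [hcn, hcs, hzn, hz0, G0.adj_comm, H.adj_comm]
          exact (hab _ h0).2.2.2.2 y x
        · exact hpat (none, x) (some i', y) (fun h => hi h.symm)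
      · by_cases hi : i = i0
        · subst hi
          refine (adj_in hGenc ((hSS (some i) x).trans (hSS none y).symm)).trans ?_
          rw [hcn, hcs, hzn, hz0]
          exact (hab _ h0).2.2.2.2 x y
        · exact hpat (some i, x) (none, y) (fun h => hi h)
      · exact hpat (some i, x) (some i', y) (fun h => hoo (congrArg some h))
  · rw [hl0]; exact hm
  · intro i hi; rw [hl1 i hi]
  · intro q j hj; exact (hhom q.1 j hj).2 q.2
  · rintro ⟨o, x⟩ j ⟨o', x'⟩ j' hc hj hj' he
    obtain ⟨a1, a2, a3⟩ := hinj o j x o' j' x' hc hj hj' he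
    exact ⟨Prod.ext a1 a2, a3⟩
  · intro q j q' j' _ _ h; exact h

def IndCopy {VH V : Type} (H : SimpleGraph VH) (s : Set VH) (G : SimpleGraph V) (w : s → V) : Prop :=
  Function.Injective w ∧ ∀ x y : s, G.Adj (w x) (w y) ↔ H.Adj x y

theorem e5_fibre {VH : Type} [Fintype VH] (H : SimpleGraph VH) (r : ℕ) {n : ℕ} (S : Fin n → Fin r) (P : VH → Fin r)
    (i0 : Fin r) (m L : ℕ) (G0 : SimpleGraph (Fin n))
    (hU : ∀ i, HasPack (IndCopy H {x | P x = i} G0) (fil univ (fun v => S v = i)) (L + r * m + m))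
    (𝒢 : Finset (SimpleGraph (Fin n))) (h𝒢 : ∀ G ∈ 𝒢, IndFree H G ∧ enc G \ CP S = enc G0 \ CP S) :
    (#𝒢 : ℝ) ≤ (2:ℝ) ^ ((#(CP S) : ℝ) - (1/2:ℝ)^(Fintype.card VH ^2) * (m * L)) := by
  choose z hz1 hz2 using hU
  have hSS : ∀ (x : VH) j, j < L + r * m + m → S (z (P x) j ⟨x, rfl⟩) = P x := fun x j hj => (mem_fil.1 ((hz1 (P x) j hj).2 _)).2
  have hinj0 : ∀ i (x x' : {x | P x = i}) j j', j < L + r * m + m → j' < L + r * m + m → z i j x = z i j' x' → x = x' ∧ j = j' := by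
    intro i x x' j j' hj hj' he
    have hjj := hz2 i j hj j' hj' _ _ he
    subst hjj
    exact ⟨(hz1 i j hj).1.1 he, rfl⟩
  have htr : ∀ i i' (h : i = i') (x : VH) (hx : P x = i) (hx' : P x = i') j, z i j ⟨x, hx⟩ = z i' j ⟨x, hx'⟩ := by
    intro i i' h x hx hx' j
    subst h; rfl
  have hinj : ∀ x j x' j', P x = P x' → j < L + r * m + m → j' < L + r * m + m →
      z (P x) j ⟨x, rfl⟩ = z (P x') j' ⟨x', rfl⟩ → x = x' ∧ j = j' := by
    intro x j x' j' hc hj hj' he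
    rw [htr (P x') (P x) hc.symm x' rfl hc.symm] at he
    obtain ⟨h1, h2⟩ := hinj0 _ _ _ _ _ hj hj' he
    exact ⟨congrArg Subtype.val h1, h2⟩
  apply lines S P i0 m L (fun x j => z (P x) j ⟨x, rfl⟩)
    (fun x y => H.Adj x y) (fun q q' h => h.symm) (fun _ => L + r * m + m) _ _ _ _ (CP S) (Subset.refl _) _ 𝒢 G0
    (fun G hG => (h𝒢 G hG).2)
  · intro G hG j hj hpat
    obtain ⟨hGfree, hGenc⟩ := h𝒢 G hG
    refine hGfree ⟨⟨⟨fun x => z (P x) (j (P x)) ⟨x, rfl⟩, ?_⟩, ?_⟩⟩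
    · intro x y he
      dsimp only at he
      have hc : P x = P y := by rw [← hSS x _ (hj _), he, hSS y _ (hj _)]
      exact (hinj x _ y _ hc (hj _) (hj _) he).1
    · intro x y
      show G.Adj (z (P x) (j (P x)) ⟨x, rfl⟩) (z (P y) (j (P y)) ⟨y, rfl⟩) ↔ H.Adj x y
      by_cases hc : P x = P y
      · refine (adj_in hGenc (by rw [hSS x _ (hj _), hSS y _ (hj _), hc])).trans ?_
        have hjj : j (P y) = j (P x) := by rw [hc]
        rw [htr (P y) (P x) hc.symm y rfl hc.symm, hjj]
        exact (hz1 (P x) _ (hj _)).1.2 _ _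
      · exact hpat x y hc
  · exact Nat.le_add_left _ _
  · intro i hi; exact Nat.le_add_right _ _
  · intro x j hj; exact hSS x j hj
  · intro x j x' j' hc hj hj' he
    exact hinj x j x' j' hc hj hj' he
  · intro q j q' j' _ _ h; exact h

end Packs
end WPN

namespace WPN
section Events
open Finset Classical

theorem HasPack.mono {V Q : Type} {A : (Q → V) → Prop} {s : Finset V} {m m' : ℕ} (h : HasPack A s m) (hm : m' ≤ m) :
    HasPack A s m' := by
  obtain ⟨z, h1, h2⟩ := h
  exact ⟨z, fun k hk => h1 k (lt_of_lt_of_le hk hm), fun k hk k' hk' => h2 k (lt_of_lt_of_le hk hm) k' (lt_of_lt_of_le hk' hm)⟩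

theorem half_div (a D : ℕ) (hD : 0 < D) (h : D ≤ a) : (a:ℝ) / (2 * D) ≤ ((a / D : ℕ) : ℝ) := by
  have h1 : a < D * (a / D + 1) := Nat.lt_mul_div_succ a hD
  have h2 : 1 ≤ a / D := (Nat.one_le_div_iff hD).2 h
  have h3 : (a:ℝ) ≤ D * ((a / D : ℕ) + 1) := by exact_mod_cast h1.le
  have h4 : (1:ℝ) ≤ ((a / D : ℕ) : ℝ) := by exact_mod_cast h2
  have hD' : (0:ℝ) < D := by exact_mod_cast hD
  rw [div_le_iff₀ (by linarith)]
  nlinarith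

theorem cover_all {n r k : ℕ} [Nonempty (Fin n)] (hr0 : 0 < r) (G : SimpleGraph (Fin n)) (S : Fin n → Fin r) :
    ∃ (Y : Finset (Fin n)) (i0 : Fin r) (μ : ℕ), HasPack (UkCopy k G) (fil univ (fun v => S v = i0)) μ ∧ μ ≤ n ∧
      #Y ≤ r * Fintype.card (Fin k ⊕ Finset (Fin k)) * μ ∧
      ∀ i, ∀ w, UkCopy k G w → (∀ q, S (w q) = i) → ∃ q, w q ∈ Y := by
  have hb : ∀ i m, HasPack (UkCopy k G) (fil univ (fun v => S v = i)) m → m ≤ n := by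
    intro i m h
    refine (pack_bound _ _ _ (Sum.inr ∅) h).trans ?_
    exact (card_le_univ _).trans (by simp)
  have h1 : ∀ i, ∃ m' : ℕ, HasPack (UkCopy k G) (fil univ (fun v => S v = i)) m' ∧ ∃ Y : Finset (Fin n),
      #Y ≤ Fintype.card (Fin k ⊕ Finset (Fin k)) * m' ∧ ∀ w, UkCopy k G w → (∀ q, w q ∈ fil univ (fun v => S v = i)) → ∃ q, w q ∈ Y := by
    intro i
    obtain ⟨m', _, h2, Y, _, h3, h4⟩ := pack_cover (UkCopy k G) (fil univ (fun v => S v = i)) (n+1)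
      (fun h => by have := hb i _ h; omega)
    exact ⟨m', h2, Y, h3, h4⟩
  choose μ hμ Y hY hcov using h1
  obtain ⟨i0, _, hi0⟩ := exists_max_image (univ : Finset (Fin r)) μ ⟨⟨0, hr0⟩, mem_univ _⟩
  refine ⟨univ.biUnion Y, i0, μ i0, hμ i0, hb _ _ (hμ i0), ?_, ?_⟩
  · refine card_biUnion_le.trans ?_
    calc ∑ i, #(Y i) ≤ ∑ i : Fin r, Fintype.card (Fin k ⊕ Finset (Fin k)) * μ i0 :=
          sum_le_sum (fun i _ => (hY i).trans (Nat.mul_le_mul_left _ (hi0 i (mem_univ _))))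
      _ = _ := by rw [sum_const, card_univ, Fintype.card_fin, smul_eq_mul, mul_assoc]
  · intro i w hw hS
    obtain ⟨q, hq⟩ := hcov i w hw (fun q => mem_fil.2 ⟨mem_univ _, hS q⟩)
    exact ⟨q, mem_biUnion.2 ⟨i, mem_univ _, hq⟩⟩

theorem e3_neg {VH : Type} [Fintype VH] (H : SimpleGraph VH) (r : ℕ) (hr : IsWpn H r) (hr0 : 0 < r) (k : ℕ)
    (hk : ∀ {V : Type} (G : SimpleGraph V) (f : Fin k ↪ V) (g : Finset (Fin k) ↪ V),
      (∀ (a : Fin k) (s : Finset (Fin k)), G.Adj (f a) (g s) ↔ a ∈ s) →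
      ∃ (τa τb : Prop) (a b : VH → V), Homog G τa a ∧ Homog G τb b ∧ (∀ x, a x ∈ Set.range f) ∧
        (∀ x, b x ∈ Set.range g) ∧ ∀ x y, G.Adj (a x) (b y) ↔ H.Adj x y) :
    ∃ c0 : ℝ, 0 < c0 ∧ ∀ (b : ℕ) (c δ γ1 : ℝ), 0 ≤ c → c * (r * Fintype.card (Fin k ⊕ Finset (Fin k))) ≤ c0 / 2 →
      γ1 < 1 / (2 * ((2*k+1 : ℕ):ℝ) + 1) → γ1 < 1 →
      (∀ n : ℕ, (#(fil (univ : Finset (Fin n)).powerset (fun F => (#F : ℝ) ≤ δ * n)) : ℝ) ≤ (2:ℝ) ^ (c * n)) →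
      Neg r (fun n G => IndFree H G ∧ ∃ (S : Fin n → Fin r) (β : Fin b → Fin n) (Y : Finset (Fin n)), STS r δ b G S β ∧
        NoSh (2*k+1) (restr G S Y) ∧ ∃ (i0 : Fin r) (μ : ℕ), (n:ℝ)^(1-γ1) ≤ μ ∧ μ ≤ n ∧
        #Y ≤ r * Fintype.card (Fin k ⊕ Finset (Fin k)) * μ ∧ HasPack (UkCopy k G) (fil univ (fun v => S v = i0)) μ) := by
  obtain ⟨R, hR0, hR⟩ := ramsey_homog VH
  obtain ⟨D, hD⟩ : ∃ D, D = 16 * r^2 * (Fintype.card VH + 1) := ⟨_, rfl⟩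
  have hD0 : 0 < D := by rw [hD]; positivity
  have hD0' : (0:ℝ) < D := by exact_mod_cast hD0
  obtain ⟨q, hq⟩ : ∃ q : ℝ, q = (1/2:ℝ)^(Fintype.card (Option (Fin r) × VH) ^2) := ⟨_, rfl⟩
  have hq0 : 0 < q := by rw [hq]; exact pow_pos (by norm_num) _
  refine ⟨q / (4 * D^2), by positivity, ?_⟩
  intro b c δ γ1 hc hcc hγ hγ1 hV
  obtain ⟨c0, hc0⟩ : ∃ c0, c0 = q / (4 * D^2) := ⟨_, rfl⟩
  have hc00 : 0 < c0 := by rw [hc0]; positivity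
  rw [← hc0] at hcc
  obtain ⟨K, hK⟩ : ∃ K, K = Fintype.card (Fin k ⊕ Finset (Fin k)) := ⟨_, rfl⟩
  rw [← hK] at hcc ⊢
  obtain ⟨N1, hN10, hN1⟩ := ev_pow D 0 (1-γ1) (by linarith)
  obtain ⟨N2, hN2⟩ := ev_lin (1/(8*r)) R (by positivity)
  refine gen_neg r b (2*k+1) hr0 (by omega) c δ (c0/2) γ1 hc hγ (by linarith) hV _
    (fun n G S Y => IndFree H G ∧ (∀ i, (n:ℝ)/(4*r) ≤ #(fil univ (fun v => S v = i))) ∧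
      ∃ (i0 : Fin r) (μ : ℕ), (n:ℝ)^(1-γ1) ≤ μ ∧ μ ≤ n ∧
        #Y ≤ r * K * μ ∧ HasPack (UkCopy k G) (fil univ (fun v => S v = i0)) μ) (max N1 (max N2 1)) ?_ ?_
  · rintro n hn G ⟨hG, S, β, Y, h1, h2, h3⟩
    exact ⟨S, β, Y, h1, h2, hG, h1.2, h3⟩
  · rintro n hn S Y G0 𝒢 ⟨_, hsz, i0, μ, hμ, hμn, hYc, hP⟩ h𝒢
    have hn1 : N1 ≤ n := (le_max_left _ _).trans hn
    have hn2 : N2 ≤ n := (le_max_left _ _).trans ((le_max_right _ _).trans hn)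
    have hn3 : 1 ≤ n := (le_max_right _ _).trans ((le_max_right _ _).trans hn)
    haveI : Nonempty (Fin n) := ⟨⟨0, hn3⟩⟩
    have hn0 : (0:ℝ) < n := by exact_mod_cast hn3
    have h1 := hN1 n hn1
    have h2 := hN2 n hn2
    rw [Real.rpow_zero, mul_one] at h1
    have hDμ : D ≤ μ := by exact_mod_cast h1.trans hμ
    have hr0' : (1:ℝ) ≤ r := by exact_mod_cast hr0
    have hDL : ((n / D : ℕ):ℝ) ≤ n / D := Nat.cast_div_le
    have hDm : ((μ / D : ℕ):ℝ) ≤ n / D := Nat.cast_div_le.trans (by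
      apply div_le_div_of_nonneg_right _ hD0'.le; exact_mod_cast hμn)
    have hpk : ∀ i, Fintype.card VH * (n / D + r * (μ / D)) + R ≤ #(fil univ (fun v => S v = i)) := by
      intro i
      have h5 := hsz i
      have h6 : (Fintype.card VH : ℝ) * ((n/D : ℕ) + r * (μ/D : ℕ)) ≤ n / (8 * r) := by
        have hh0 : (0:ℝ) ≤ Fintype.card VH := Nat.cast_nonneg _
        have e1 : ((n/D : ℕ) + r * (μ/D : ℕ) : ℝ) ≤ 2 * r * (n / D) := by
          have : (0:ℝ) ≤ n / D := by positivity
          nlinarith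
        have e2 : (2 * r * (n / D) : ℝ) * (Fintype.card VH + 1) = n / (8 * r) := by
          rw [hD]; push_cast; field_simp; norm_num
        have e3 : (0:ℝ) ≤ 2 * r * (n/D) := by positivity
        nlinarith
      have h7 : (n:ℝ) / (4 * r) = n / (8 * r) + 1 / (8 * r) * n := by field_simp; norm_num
      have : ((Fintype.card VH * (n / D + r * (μ / D)) + R : ℕ):ℝ) ≤ #(fil univ (fun v => S v = i)) := by
        push_cast at h6 ⊢
        linarith
      exact_mod_cast this
    have h3 := e3_fibre H r hr k hk S i0 (μ / D) (n / D) μ (Nat.div_le_self _ _) G0 hP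
      (fun i => homog_pack R hR G0 _ _ (hpk i)) 𝒢 (fun G hG => ⟨(h𝒢 G hG).1.1, (h𝒢 G hG).2⟩)
    refine h3.trans (Real.rpow_le_rpow_of_exponent_le (by norm_num) ?_)
    rw [← hq]
    have h8 := card_CP_le hr0 S
    have h9 := half_div μ D hD0 hDμ
    have h10 := half_div n D hD0 (hDμ.trans hμn)
    have h11 : q * ((μ:ℝ) / (2 * D) * (n / (2 * D))) ≤ q * (((μ / D : ℕ):ℝ) * ((n / D : ℕ):ℝ)) := by
      apply mul_le_mul_of_nonneg_left _ hq0.le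
      apply mul_le_mul h9 h10 (by positivity) (Nat.cast_nonneg _)
    have h12 : q * ((μ:ℝ) / (2 * D) * (n / (2 * D))) = c0 * μ * n := by
      rw [hc0]; field_simp; norm_num
    have h13 : c * n * #Y ≤ c0 / 2 * μ * n := by
      have : (#Y:ℝ) ≤ r * K * μ := by exact_mod_cast hYc
      calc c * n * #Y ≤ c * n * (r * K * μ) := mul_le_mul_of_nonneg_left this (mul_nonneg hc hn0.le)
        _ = (c * (r * K)) * (μ * n) := by ring
        _ ≤ c0 / 2 * (μ * n) := mul_le_mul_of_nonneg_right hcc (by positivity)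
        _ = _ := by ring
    have h14 : c0 / 2 * (n:ℝ)^(2-γ1) ≤ c0 / 2 * μ * n := by
      have : (n:ℝ)^(2-γ1) = (n:ℝ)^(1-γ1) * n := by
        rw [← Real.rpow_add_one hn0.ne']; congr 1; ring
      rw [this, mul_assoc]
      exact mul_le_mul_of_nonneg_left (mul_le_mul_of_nonneg_right hμ hn0.le) (by linarith)
    have e8 : c0 * μ * n = c0/2*μ*n + c0/2*μ*n := by ring
    linarith

theorem e4_neg {VH : Type} [Fintype VH] (H : SimpleGraph VH) (r : ℕ) (hr0 : 0 < r) (k b K : ℕ) (c δ γ1 θ : ℝ)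
    (hc : 0 ≤ c) (hγ : γ1 < 1 / (2 * ((2*k+1 : ℕ):ℝ) + 1)) (hθ : 2 * θ < γ1)
    (hV : ∀ n : ℕ, (#(fil (univ : Finset (Fin n)).powerset (fun F => (#F : ℝ) ≤ δ * n)) : ℝ) ≤ (2:ℝ) ^ (c * n)) :
    Neg r (fun n G => IndFree H G ∧ ∃ (S : Fin n → Fin r) (β : Fin b → Fin n) (Y : Finset (Fin n)), STS r δ b G S β ∧
        NoSh (2*k+1) (restr G S Y) ∧ (#Y : ℝ) ≤ r * K * (n:ℝ)^(1-γ1) ∧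
        ∃ i, (n:ℝ)^(1-θ) < |(#(fil univ (fun v => S v = i)) : ℝ) - n / r|) := by
  obtain ⟨N1, hN10, hN1⟩ := ev_pow (2 * (c * r * K + 1)) (2-γ1) (2-2*θ) (by linarith)
  refine gen_neg r b (2*k+1) hr0 (by omega) c δ 1 γ1 hc hγ (by norm_num) hV _
    (fun n G S Y => (#Y : ℝ) ≤ r * K * (n:ℝ)^(1-γ1) ∧
        ∃ i, (n:ℝ)^(1-θ) < |(#(fil univ (fun v => S v = i)) : ℝ) - n / r|) N1 ?_ ?_
  · rintro n hn G ⟨hG, S, β, Y, h1, h2, h3⟩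
    exact ⟨S, β, Y, h1, h2, h3⟩
  · rintro n hn S Y G0 𝒢 ⟨hY, i, hi⟩ h𝒢
    have hn0 : (0:ℝ) < n := by exact_mod_cast (show 0 < n by omega)
    have h1 := hN1 n hn
    refine (fibre_card (CP S) 𝒢 G0 (fun G hG => (h𝒢 G hG).2)).trans (Real.rpow_le_rpow_of_exponent_le (by norm_num) ?_)
    rw [card_CP hr0 S]
    have h2 : ((#(fil univ (fun v => S v = i)) : ℝ) - n / r)^2 ≤ ∑ i, ((#(fil univ (fun v => S v = i)) : ℝ) - n / r)^2 :=
      single_le_sum (f := fun i => ((#(fil univ (fun v => S v = i)) : ℝ) - n / r)^2) (fun j _ => sq_nonneg _) (mem_univ i)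
    have h3 : (n:ℝ)^(2-2*θ) ≤ ((#(fil univ (fun v => S v = i)) : ℝ) - n / r)^2 := by
      have e : (n:ℝ)^(2-2*θ) = ((n:ℝ)^(1-θ))^2 := by
        rw [← Real.rpow_natCast, ← Real.rpow_mul hn0.le]; congr 1; push_cast; ring
      rw [e, ← sq_abs (_ - _)]
      exact pow_le_pow_left₀ (Real.rpow_nonneg hn0.le _) hi.le 2
    have h4 : (n:ℝ)^(2-γ1) = (n:ℝ)^(1-γ1) * n := by
      rw [← Real.rpow_add_one hn0.ne']; congr 1; ring
    have h5 : c * n * #Y ≤ c * r * K * (n:ℝ)^(2-γ1) := by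
      rw [h4]
      calc c * n * #Y ≤ c * n * (r * K * (n:ℝ)^(1-γ1)) := mul_le_mul_of_nonneg_left hY (mul_nonneg hc hn0.le)
        _ = _ := by ring
    linarith

theorem e5_neg {VH : Type} [Fintype VH] (H : SimpleGraph VH) (r : ℕ) (hr0 : 0 < r) (k b K : ℕ) (c δ γ1 θ : ℝ)
    (hc : 0 ≤ c) (hγ : γ1 < 1 / (2 * ((2*k+1 : ℕ):ℝ) + 1)) (hθ : 2 * θ < γ1) (hθ1 : θ < 1)
    (hV : ∀ n : ℕ, (#(fil (univ : Finset (Fin n)).powerset (fun F => (#F : ℝ) ≤ δ * n)) : ℝ) ≤ (2:ℝ) ^ (c * n)) :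
    Neg r (fun n G => IndFree H G ∧ ∃ (S : Fin n → Fin r) (β : Fin b → Fin n) (Y : Finset (Fin n)), STS r δ b G S β ∧
        NoSh (2*k+1) (restr G S Y) ∧ (#Y : ℝ) ≤ r * K * (n:ℝ)^(1-γ1) ∧
        ∃ P : VH → Fin r, ∀ i, HasPack (IndCopy H {x | P x = i} G) (fil univ (fun v => S v = i)) ⌈(n:ℝ)^(1-θ)⌉₊) := by
  obtain ⟨q, hq⟩ : ∃ q : ℝ, q = (1/2:ℝ)^(Fintype.card VH ^2) := ⟨_, rfl⟩
  have hq0 : 0 < q := by rw [hq]; exact pow_pos (by norm_num) _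
  obtain ⟨N1, hN10, hN1⟩ := ev_pow (4 * (r + 2)^2 / q * (c * r * K + 1)) (2-γ1) (2-2*θ) (by linarith)
  obtain ⟨N2, hN20, hN2⟩ := ev_pow (r + 2) 0 (1-θ) (by linarith)
  refine gen_neg r b (2*k+1) hr0 (by omega) c δ 1 γ1 hc hγ (by norm_num) hV _
    (fun n G S Y => IndFree H G ∧ (#Y : ℝ) ≤ r * K * (n:ℝ)^(1-γ1) ∧
        ∃ P : VH → Fin r, ∀ i, HasPack (IndCopy H {x | P x = i} G) (fil univ (fun v => S v = i)) ⌈(n:ℝ)^(1-θ)⌉₊) (max N1 N2) ?_ ?_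
  · rintro n hn G ⟨hG, S, β, Y, h1, h2, h3⟩
    exact ⟨S, β, Y, h1, h2, hG, h3⟩
  · rintro n hn S Y G0 𝒢 ⟨_, hY, P, hP⟩ h𝒢
    have hn0 : (0:ℝ) < n := by exact_mod_cast (show 0 < n by omega)
    have h1 := hN1 n (by omega)
    have h2 := hN2 n (by omega)
    rw [Real.rpow_zero, mul_one] at h2
    obtain ⟨m5, hm5⟩ : ∃ m5, m5 = ⌈(n:ℝ)^(1-θ)⌉₊ := ⟨_, rfl⟩
    have hm : (n:ℝ)^(1-θ) ≤ m5 := by rw [hm5]; exact Nat.le_ceil _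
    rw [← hm5] at hP
    have hrm : r + 2 ≤ m5 := by exact_mod_cast h2.trans hm
    have hdm : (r + 2) * (m5 / (r+2)) ≤ m5 := Nat.mul_div_le _ _
    obtain ⟨m, hmd⟩ : ∃ m, m = m5 / (r+2) := ⟨_, rfl⟩
    have h9 := half_div m5 (r+2) (by omega) hrm
    rw [← hmd] at hdm h9
    have h3 := e5_fibre H r S P ⟨0, hr0⟩ m m G0
      (fun i => (hP i).mono (by rw [add_mul] at hdm; omega)) 𝒢 (fun G hG => ⟨(h𝒢 G hG).1.1, (h𝒢 G hG).2⟩)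
    refine h3.trans (Real.rpow_le_rpow_of_exponent_le (by norm_num) ?_)
    rw [← hq]
    have h8 := card_CP_le hr0 S
    have h4 : (n:ℝ)^(2-γ1) = (n:ℝ)^(1-γ1) * n := by
      rw [← Real.rpow_add_one hn0.ne']; congr 1; ring
    have h5 : c * n * #Y ≤ c * r * K * (n:ℝ)^(2-γ1) := by
      rw [h4]
      calc c * n * #Y ≤ c * n * (r * K * (n:ℝ)^(1-γ1)) := mul_le_mul_of_nonneg_left hY (mul_nonneg hc hn0.le)
        _ = _ := by ring
    have h6 : (n:ℝ)^(1-θ) / (2 * (r+2)) ≤ m := by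
      refine le_trans ?_ h9
      push_cast
      exact div_le_div_of_nonneg_right hm (by positivity)
    have e : (n:ℝ)^(2-2*θ) = ((n:ℝ)^(1-θ))^2 := by
      rw [← Real.rpow_natCast, ← Real.rpow_mul hn0.le]; congr 1; push_cast; ring
    have h7 : (n:ℝ)^(2-2*θ) / (4 * (r+2)^2) ≤ m * m := by
      have hx : 0 ≤ (n:ℝ)^(1-θ) / (2 * (r+2)) := div_nonneg (Real.rpow_nonneg hn0.le _) (by positivity)
      have := mul_le_mul h6 h6 hx (hx.trans h6)
      refine le_trans (le_of_eq ?_) this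
      rw [e]; field_simp; norm_num
    have h10 : (c * r * K + 1) * (n:ℝ)^(2-γ1) ≤ q * (m * m) := by
      have h11 : q / (4 * (r+2)^2) * (4 * (r + 2)^2 / q * (c * r * K + 1) * (n:ℝ)^(2-γ1)) = (c * r * K + 1) * (n:ℝ)^(2-γ1) := by
        field_simp
      rw [← h11]
      calc _ ≤ q / (4 * (r+2)^2) * (n:ℝ)^(2-2*θ) := mul_le_mul_of_nonneg_left h1 (by positivity)
        _ = q * ((n:ℝ)^(2-2*θ) / (4 * (r+2)^2)) := by ring
        _ ≤ _ := mul_le_mul_of_nonneg_left h7 hq0.le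
    linarith

end Events
end WPN

namespace WPN
section Assembly
open Finset Classical

def Good {VH : Type} (H : SimpleGraph VH) (r k b K : ℕ) (δ γ1 θ : ℝ) {n : ℕ} (G : SimpleGraph (Fin n)) : Prop :=
  ∃ (S : Fin n → Fin r) (β : Fin b → Fin n) (Y : Finset (Fin n)), STS r δ b G S β ∧
    (∀ i, ∀ w, UkCopy k G w → (∀ q, S (w q) = i) → ∃ q, w q ∈ Y) ∧
    (#Y : ℝ) ≤ r * K * (n:ℝ)^(1-γ1) ∧
    (∀ i, |(#(fil univ (fun v => S v = i)) : ℝ) - n / r| ≤ (n:ℝ)^(1-θ)) ∧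
    ∀ P : VH → Fin r, ∃ i, ¬ HasPack (IndCopy H {x | P x = i} G) (fil univ (fun v => S v = i)) ⌈(n:ℝ)^(1-θ)⌉₊

theorem good_neg {VH : Type} [Fintype VH] (H : SimpleGraph VH) (r : ℕ) (hr : IsWpn H r) (hr0 : 0 < r) (k : ℕ)
    (hk : ∀ {V : Type} (G : SimpleGraph V) (f : Fin k ↪ V) (g : Finset (Fin k) ↪ V),
      (∀ (a : Fin k) (s : Finset (Fin k)), G.Adj (f a) (g s) ↔ a ∈ s) →
      ∃ (τa τb : Prop) (a b : VH → V), Homog G τa a ∧ Homog G τb b ∧ (∀ x, a x ∈ Set.range f) ∧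
        (∀ x, b x ∈ Set.range g) ∧ ∀ x y, G.Adj (a x) (b y) ↔ H.Adj x y) :
    ∃ δ0 : ℝ, 0 < δ0 ∧ ∀ δ : ℝ, 0 < δ → δ < δ0 → ∀ (γ1 θ : ℝ), γ1 < 1 / (2 * ((2*k+1 : ℕ):ℝ) + 1) → γ1 < 1 →
      2 * θ < γ1 → θ < 1 → ∃ b : ℕ, 0 < b ∧
      Neg r (fun n G => IndFree H G ∧ ¬ Good H r k b (Fintype.card (Fin k ⊕ Finset (Fin k))) δ γ1 θ G) := by
  obtain ⟨c0, hc0, hE3⟩ := e3_neg H r hr hr0 k hk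
  obtain ⟨K, hK⟩ : ∃ K, K = Fintype.card (Fin k ⊕ Finset (Fin k)) := ⟨_, rfl⟩
  have hK0 : 0 < K := by rw [hK]; exact Fintype.card_pos_iff.2 ⟨Sum.inr ∅⟩
  rw [← hK] at hE3 ⊢
  have hK0' : (0:ℝ) < K := by exact_mod_cast hK0
  have hr0' : (0:ℝ) < r := by exact_mod_cast hr0
  obtain ⟨c, hc⟩ : ∃ c, c = c0 / 2 / (r * K) := ⟨_, rfl⟩
  have hcp : 0 < c := by rw [hc]; positivity
  obtain ⟨κ, hκ, hvol⟩ := vol c hcp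
  refine ⟨min κ 1, lt_min hκ one_pos, fun δ hδ hδ0 γ1 θ hγ hγ1 hθ hθ1 => ?_⟩
  have hδκ : δ < κ := lt_of_lt_of_le hδ0 (min_le_left _ _)
  have hδ1 : δ < 1 := lt_of_lt_of_le hδ0 (min_le_right _ _)
  obtain ⟨b, hb, hB⟩ := partB H r hr hr0 δ hδ hδ1
  have hV : ∀ n : ℕ, (#(fil (univ : Finset (Fin n)).powerset (fun F => (#F : ℝ) ≤ δ * n)) : ℝ) ≤ (2:ℝ) ^ (c * n) := by
    intro n
    refine le_trans (Nat.cast_le.2 (card_le_card ?_)) (hvol (Fin n) univ n (by simp))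
    intro F hF
    rw [mem_fil] at hF ⊢
    exact ⟨hF.1, hF.2.trans (mul_le_mul_of_nonneg_right hδκ.le (Nat.cast_nonneg _))⟩
  refine ⟨b, hb, ?_⟩
  have h3 := hE3 b c δ γ1 hcp.le (by rw [hc]; apply le_of_eq; field_simp) hγ hγ1 hV
  have h4 := e4_neg H r hr0 k b K c δ γ1 θ hcp.le hγ hθ hV
  have h5 := e5_neg H r hr0 k b K c δ γ1 θ hcp.le hγ hθ hθ1 hV
  refine (hB.or (h3.or (h4.or h5))).mono 1 (fun n hn G => ?_)
  rintro ⟨hG, hbad⟩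
  by_contra hcon
  rw [not_or, not_or, not_or] at hcon
  obtain ⟨c1, c3, c4, c5⟩ := hcon
  have hST : ST r δ b G := by
    by_contra h; exact c1 ⟨hG, h⟩
  obtain ⟨S, β, hS⟩ := hST
  have : Nonempty (Fin n) := ⟨⟨0, hn⟩⟩
  obtain ⟨Y, i0, μ, hμ, hμn, hY, hcov⟩ := cover_all (k := k) hr0 G S
  rw [← hK] at hY
  have hns := nosh_of_cover G S Y hcov
  have hμ2 : (μ:ℝ) ≤ (n:ℝ)^(1-γ1) := by
    by_contra h
    exact c3 ⟨hG, S, β, Y, hS, hns, i0, μ, (not_le.1 h).le, hμn, hY, hμ⟩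
  have hY2 : (#Y : ℝ) ≤ r * K * (n:ℝ)^(1-γ1) := by
    have : (#Y : ℝ) ≤ r * K * μ := by exact_mod_cast hY
    exact this.trans (mul_le_mul_of_nonneg_left hμ2 (by positivity))
  apply hbad
  refine ⟨S, β, Y, hS, hcov, hY2, ?_, ?_⟩
  · intro i
    by_contra h
    exact c4 ⟨hG, S, β, Y, hS, hns, hY2, i, not_le.1 h⟩
  · intro P
    by_contra h
    rw [not_exists] at h
    exact c5 ⟨hG, S, β, Y, hS, hns, hY2, P, fun i => not_not.1 (h i)⟩

/-- the class of graphs avoiding every induced subgraph of H that G avoids -/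
def FF {VH U : Type} (H : SimpleGraph VH) (G : SimpleGraph U) : GraphClass :=
  fun V _ G' => ∀ (W : Type) [Finite W] (L : SimpleGraph W), (Nonempty (L ↪g H) ∧ IndFree L G) → IndFree L G'

theorem FF_her {VH U : Type} (H : SimpleGraph VH) (G : SimpleGraph U) : (FF H G).Hereditary := by
  intro V W _ _ G' L' ⟨φ⟩ h W' _ L hL ⟨ψ⟩
  exact h W' L hL ⟨φ.comp ψ⟩

theorem FF_canon {VH U : Type} [Finite VH] (H : SimpleGraph VH) (G : SimpleGraph U) : IsCanonicalFor H (FF H G) :=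
  ⟨fun W _ L => Nonempty (L ↪g H) ∧ IndFree L G, fun W _ L h => h.1, fun V _ G' => Iff.rfl⟩

theorem FF_homog {VH U : Type} (H : SimpleGraph VH) (G : SimpleGraph U) (τ : Prop) (z : VH → U) (hz : Homog G τ z) :
    (FF H G).ContainsAllCliques ∨ (FF H G).ContainsAllStables := by
  by_cases hτ : τ
  · left
    intro V _ W _ L ⟨⟨φ⟩, hL⟩ ⟨ψ⟩
    refine hL ⟨⟨⟨fun x => z (φ x), hz.1.comp φ.injective⟩, ?_⟩⟩
    intro x y
    show G.Adj (z (φ x)) (z (φ y)) ↔ L.Adj x y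
    by_cases hxy : x = y
    · subst hxy; simp
    · rw [hz.2 _ _ (fun h => hxy (φ.injective h)), ← ψ.map_adj_iff]
      simp [hτ, hxy]
  · right
    intro V _ W _ L ⟨⟨φ⟩, hL⟩ ⟨ψ⟩
    refine hL ⟨⟨⟨fun x => z (φ x), hz.1.comp φ.injective⟩, ?_⟩⟩
    intro x y
    show G.Adj (z (φ x)) (z (φ y)) ↔ L.Adj x y
    by_cases hxy : x = y
    · subst hxy; simp
    · rw [hz.2 _ _ (fun h => hxy (φ.injective h)), ← ψ.map_adj_iff]
      simp [hτ, hxy]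

theorem assemble {VH : Type} [Fintype VH] (H : SimpleGraph VH) (r : ℕ) (hr0 : 0 < r) (k b K : ℕ) (δ γ1 θ γ : ℝ)
    (hγ0 : 0 < γ) (hγθ : γ < θ) (hθγ : θ ≤ γ1) (hθ1 : θ ≤ 1) : ∃ N : ℕ, ∀ n, N ≤ n → ∀ G : SimpleGraph (Fin n), Good H r k b K δ γ1 θ G →
    ∃ (X Z : Fin r → Set (Fin n)) (B : Set (Fin n)),
                    B.ncard ≤ b ∧
                    (∀ p q : Fin r ⊕ Fin r, p ≠ q →
                      Disjoint (Sum.elim X Z p) (Sum.elim X Z q)) ∧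
                    (⋃ p : Fin r ⊕ Fin r, Sum.elim X Z p) = Set.univ ∧
                    (∀ i, UkFree k (G.induce (X i))) ∧
                    (∃ F : Fin r → GraphClass, IsReallyCanonicalSeq H r F ∧
                      ∀ i, F i ↥(X i) (G.induce (X i))) ∧
                    (((⋃ i, Z i).ncard : ℝ) ≤ (n : ℝ) ^ ((1 : ℝ) - γ)) ∧
                    (∀ i, ∀ v ∈ X i ∪ Z i, ∃ a ∈ B,
                      (((symmDiff (G.neighborSet v) (G.neighborSet a)) ∩
                          (X i ∪ Z i)).ncard : ℝ) < δ * n) ∧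
                    (∀ i, |((X i ∪ Z i).ncard : ℝ) - (n : ℝ) / r| ≤
                      (n : ℝ) ^ ((1 : ℝ) - γ / 4)) := by
  obtain ⟨R, hR0, hR⟩ := ramsey_homog VH
  have hr0' : (0:ℝ) < r := by exact_mod_cast hr0
  obtain ⟨N1, hN10, hN1⟩ := ev_pow (r * K + r * Fintype.card (Set VH) * Fintype.card VH * 2) (1-θ) (1-γ) (by linarith)
  obtain ⟨N2, hN20, hN2⟩ := ev_pow (8 * r) (1-γ) 1 (by linarith)
  obtain ⟨N3, hN3⟩ := ev_lin (1/(8*r)) R (by positivity)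
  refine ⟨max N1 (max N2 N3), fun n hn G => ?_⟩
  have h1 := hN1 n (by omega)
  have h2 := hN2 n (by omega)
  have h3 := hN3 n (by omega)
  have hnpos : 0 < n := by omega
  have hn1 : (1:ℝ) ≤ n := by exact_mod_cast hnpos
  have : Nonempty (Fin n) := ⟨⟨0, hnpos⟩⟩
  rintro ⟨S, β, Y, ⟨hS1, hS2⟩, hcov, hYc, hbal, hpoor⟩
  obtain ⟨m5, hm5⟩ : ∃ m5, m5 = ⌈(n:ℝ)^(1-θ)⌉₊ := ⟨_, rfl⟩
  rw [← hm5] at hpoor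
  have hm5' : (m5:ℝ) ≤ 2 * (n:ℝ)^(1-θ) := by
    have e1 : (1:ℝ) ≤ (n:ℝ)^(1-θ) := Real.one_le_rpow hn1 (by linarith)
    have e2 : (m5:ℝ) < (n:ℝ)^(1-θ) + 1 := by rw [hm5]; exact Nat.ceil_lt_add_one (by linarith)
    linarith
  have hYex : ∀ (i : Fin r) (s : Set VH), ∃ T : Finset (Fin n), #T ≤ Fintype.card VH * m5 ∧
      (¬ HasPack (IndCopy H s G) (fil univ (fun v => S v = i)) m5 → ∀ w, IndCopy H s G w → (∀ q, S (w q) = i) → ∃ q, w q ∈ T) := by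
    intro i s
    by_cases h : HasPack (IndCopy H s G) (fil univ (fun v => S v = i)) m5
    · exact ⟨∅, by simp, fun h' => absurd h h'⟩
    · obtain ⟨m', hm', _, T, _, hT, hTc⟩ := pack_cover _ _ _ h
      refine ⟨T, hT.trans (Nat.mul_le_mul ?_ hm'.le), fun _ w hw hS => hTc w hw (fun q => mem_fil.2 ⟨mem_univ _, hS q⟩)⟩
      exact Fintype.card_le_of_injective (fun x : s => (x : VH)) Subtype.val_injective
  choose T hTc hT using hYex
  obtain ⟨ZZ, hZZ⟩ : ∃ ZZ, ZZ = Y ∪ univ.biUnion (fun p : Fin r × Set VH => T p.1 p.2) := ⟨_, rfl⟩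
  have hYZ : Y ⊆ ZZ := by rw [hZZ]; exact subset_union_left
  have hTZ : ∀ i s, T i s ⊆ ZZ := by
    intro i s x hx
    rw [hZZ, mem_union]
    exact Or.inr (mem_biUnion.2 ⟨(i, s), mem_univ _, hx⟩)
  have hZc : (#ZZ : ℝ) ≤ (n:ℝ)^(1-γ) := by
    have e1 : #ZZ ≤ #Y + r * Fintype.card (Set VH) * (Fintype.card VH * m5) := by
      rw [hZZ]
      refine (card_union_le _ _).trans (Nat.add_le_add_left (card_biUnion_le.trans ?_) _)
      refine (sum_le_sum (fun p _ => hTc p.1 p.2)).trans (le_of_eq ?_)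
      rw [sum_const, card_univ, Fintype.card_prod, Fintype.card_fin, smul_eq_mul]
    have e2 : (#ZZ:ℝ) ≤ #Y + r * Fintype.card (Set VH) * (Fintype.card VH * m5) := by exact_mod_cast e1
    have e3 : (n:ℝ)^(1-γ1) ≤ (n:ℝ)^(1-θ) := Real.rpow_le_rpow_of_exponent_le hn1 (by linarith)
    have e4 : (r * K : ℝ) * (n:ℝ)^(1-γ1) ≤ r * K * (n:ℝ)^(1-θ) := mul_le_mul_of_nonneg_left e3 (by positivity)
    have e5 : (r * Fintype.card (Set VH) * (Fintype.card VH * m5) : ℝ) ≤ r * Fintype.card (Set VH) * (Fintype.card VH * (2 * (n:ℝ)^(1-θ))) :=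
      mul_le_mul_of_nonneg_left (mul_le_mul_of_nonneg_left hm5' (Nat.cast_nonneg _)) (by positivity)
    have e6 : (r * K + r * Fintype.card (Set VH) * Fintype.card VH * 2 : ℝ) * (n:ℝ)^(1-θ) =
      r * K * (n:ℝ)^(1-θ) + r * Fintype.card (Set VH) * (Fintype.card VH * (2 * (n:ℝ)^(1-θ))) := by ring
    linarith
  have hXZ : ∀ i, {v | S v = i ∧ v ∉ ZZ} ∪ {v | S v = i ∧ v ∈ ZZ} = {v | S v = i} := by
    intro i; ext v
    simp only [Set.mem_union, Set.mem_setOf_eq]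
    tauto
  refine ⟨fun i => {v | S v = i ∧ v ∉ ZZ}, fun i => {v | S v = i ∧ v ∈ ZZ}, Set.range β, ?_, ?_, ?_, ?_, ?_, ?_, ?_, ?_⟩
  · rw [← Set.image_univ]
    refine (Set.ncard_image_le (Set.toFinite _)).trans ?_
    rw [Set.ncard_univ]; simp
  · intro p q hpq
    rw [Set.disjoint_left]
    rcases p with i | i <;> rcases q with j | j <;> simp only [Sum.elim_inl, Sum.elim_inr, Set.mem_setOf_eq]
    · rintro v ⟨h, _⟩ ⟨h', _⟩; exact hpq (by rw [← h, ← h'])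
    · rintro v ⟨h, h1⟩ ⟨h', h2⟩; exact h1 h2
    · rintro v ⟨h, h1⟩ ⟨h', h2⟩; exact h2 h1
    · rintro v ⟨h, _⟩ ⟨h', _⟩; exact hpq (by rw [← h, ← h'])
  · rw [Set.eq_univ_iff_forall]
    intro v
    rw [Set.mem_iUnion]
    by_cases h : v ∈ ZZ
    · exact ⟨Sum.inr (S v), rfl, h⟩
    · exact ⟨Sum.inl (S v), rfl, h⟩
  · rintro i ⟨f, g, hfg, hadj⟩
    have hw : UkCopy k G (Sum.elim (fun a => (f a : Fin n)) (fun s => (g s : Fin n))) := by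
      refine ⟨?_, fun a s => hadj a s⟩
      rintro (a | s) (a' | s') h
      · rw [f.injective (Subtype.ext h)]
      · exact absurd (Subtype.ext h) (hfg a s')
      · exact absurd (Subtype.ext h.symm) (hfg a' s)
      · rw [g.injective (Subtype.ext h)]
    have hwS : ∀ q, S (Sum.elim (fun a => (f a : Fin n)) (fun s => (g s : Fin n)) q) = i := by
      rintro (a | s)
      · exact (f a).2.1
      · exact (g s).2.1
    obtain ⟨q, hq⟩ := hcov i _ hw hwS
    rcases q with a | s
    · exact (f a).2.2 (hYZ hq)
    · exact (g s).2.2 (hYZ hq)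
  · refine ⟨fun i => FF H (G.induce {v | S v = i ∧ v ∉ ZZ}), ⟨⟨fun i => FF_her _ _, ?_⟩, fun i => ⟨FF_canon _ _, ?_⟩⟩, ?_⟩
    · intro P
      by_contra hcon
      rw [not_exists] at hcon
      obtain ⟨i, hi⟩ := hpoor P
      have hF := not_not.1 (hcon i)
      have hex : Nonempty (H.induce {v | P v = i} ↪g G.induce {v | S v = i ∧ v ∉ ZZ}) := by
        by_contra hne
        exact hF _ (H.induce {v | P v = i}) ⟨⟨Embedding.induce _⟩, hne⟩ ⟨Embedding.refl⟩
      obtain ⟨φ⟩ := hex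
      have hw : IndCopy H {v | P v = i} G (fun x => (φ x : Fin n)) := by
        refine ⟨fun x y h => φ.injective (Subtype.ext h), fun x y => ?_⟩
        exact φ.map_adj_iff
      obtain ⟨q, hq⟩ := hT i _ hi _ hw (fun q => (φ q).2.1)
      exact (φ q).2.2 (hTZ _ _ hq)
    · have hX : R ≤ #(fil univ (fun v => S v = i ∧ v ∉ ZZ)) := by
        have e1 : #(fil univ (fun v => S v = i)) ≤ #(fil univ (fun v => S v = i ∧ v ∉ ZZ)) + #ZZ := by
          refine le_trans (card_le_card ?_) (card_union_le _ _)
          intro v hv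
          rw [mem_union, mem_fil]
          by_cases h : v ∈ ZZ
          · exact Or.inr h
          · exact Or.inl ⟨mem_univ _, (mem_fil.1 hv).2, h⟩
        have e2 : (#(fil univ (fun v => S v = i)):ℝ) ≤ #(fil univ (fun v => S v = i ∧ v ∉ ZZ)) + #ZZ := by exact_mod_cast e1
        have e3 := hS2 i
        rw [Real.rpow_one] at h2
        have e4 : (n:ℝ)^(1-γ) ≤ 1 / (8*r) * n := by
          rw [one_div, inv_mul_eq_div, le_div_iff₀ (by positivity)]; linarith
        have e5 : (n:ℝ) / (4 * r) = 1 / (8 * r) * n + 1 / (8 * r) * n := by field_simp; norm_num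
        have : (R:ℝ) ≤ #(fil univ (fun v => S v = i ∧ v ∉ ZZ)) := by linarith
        exact_mod_cast this
      obtain ⟨τ, z, hz, hh⟩ := hR _ G _ hX
      refine FF_homog H _ τ (fun x => ⟨z x, (mem_fil.1 (hz x)).2⟩) ⟨?_, ?_⟩
      · intro x y h; exact hh.1 (congrArg Subtype.val h)
      · intro x y h; exact hh.2 x y h
    · intro i W _ L hL
      exact hL.2
  · have : (⋃ i, {v | S v = i ∧ v ∈ ZZ}) = (ZZ : Set (Fin n)) := by
      ext v; simp
    rw [this, Set.ncard_coe_finset]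
    exact hZc
  · intro i v hv
    obtain ⟨a, ha⟩ := hS1 v
    refine ⟨β a, ⟨a, rfl⟩, lt_of_le_of_lt ?_ ha⟩
    dsimp only at hv ⊢
    rw [hXZ i] at hv ⊢
    have hv' : S v = i := hv
    rw [← Set.ncard_coe_finset]
    refine Nat.cast_le.2 (Set.ncard_le_ncard ?_ (Set.toFinite _))
    rintro x ⟨hx, hxi⟩
    rw [mem_coe, mem_fil]
    refine ⟨mem_univ _, hxi.trans hv'.symm, fun hiff => ?_⟩
    rcases hx with ⟨hx1, hx2⟩ | ⟨hx1, hx2⟩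
    · exact hx2 (hiff.1 hx1)
    · exact hx2 (hiff.2 hx1)
  · intro i
    dsimp only
    rw [hXZ i]
    have e : {v | S v = i} = ((fil univ (fun v => S v = i) : Finset (Fin n)) : Set (Fin n)) := by
      ext v; rw [mem_coe, mem_fil]; simp
    rw [e, Set.ncard_coe_finset]
    exact (hbal i).trans (Real.rpow_le_rpow_of_exponent_le hn1 (by linarith))

end Assembly
end WPN

namespace WPN
section Final
open Finset Classical

theorem ratio_tendsto {VH : Type} (H : SimpleGraph VH) (r : ℕ) (hr : IsWpn H r) (hr0 : 0 < r)
    (Q : ∀ n : ℕ, SimpleGraph (Fin n) → Prop) (hQ : Neg r (fun n G => IndFree H G ∧ ¬ Q n G)) :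
    Tendsto (fun n : ℕ => (({G : SimpleGraph (Fin n) | IndFree H G ∧ Q n G}.ncard : ℝ) /
      ({G : SimpleGraph (Fin n) | IndFree H G}.ncard : ℝ))) atTop (nhds 1) := by
  obtain ⟨C, N, hC, hN⟩ := hQ
  have conv : ∀ (n : ℕ) (p : SimpleGraph (Fin n) → Prop), {G : SimpleGraph (Fin n) | p G}.ncard = #(gr n p) := by
    intro n p
    rw [← Set.ncard_coe_finset]
    congr 1
    ext G; rw [mem_coe, mem_gr]; rfl
  simp_rw [conv]
  have hlim : Tendsto (fun n : ℕ => 1 - C * (2:ℝ)^(r:ℝ) * (1/4:ℝ)^n) atTop (nhds 1) := by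
    have := (tendsto_pow_atTop_nhds_zero_of_lt_one (r := (1/4:ℝ)) (by norm_num) (by norm_num)).const_mul (C * (2:ℝ)^(r:ℝ))
    simpa using this.const_sub 1
  refine tendsto_of_tendsto_of_tendsto_of_le_of_le' hlim tendsto_const_nhds ?_ ?_
  · filter_upwards [eventually_ge_atTop N] with n hn
    have h1 := lower_bound H r hr hr0 n
    have h2 := hN n hn
    have hpos : (0:ℝ) < #(gr n (fun G => IndFree H G)) := lt_of_lt_of_le (Real.rpow_pos_of_pos (by norm_num) _) h1
    have h3 : #(gr n (fun G => IndFree H G ∧ Q n G)) + #(gr n (fun G => IndFree H G ∧ ¬ Q n G)) = #(gr n (fun G => IndFree H G)) := by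
      rw [← card_union_of_disjoint]
      · congr 1; ext G; rw [mem_union, mem_gr, mem_gr, mem_gr]; tauto
      · rw [Finset.disjoint_left]; intro G h h'; exact (mem_gr.1 h').2 (mem_gr.1 h).2
    have h4 : (#(gr n (fun G => IndFree H G ∧ Q n G)) : ℝ) + #(gr n (fun G => IndFree H G ∧ ¬ Q n G)) = #(gr n (fun G => IndFree H G)) := by
      exact_mod_cast h3
    have h5 : C * (2:ℝ) ^ ((1 - 1/(r:ℝ)) * n^2 / 2 - 2 * n) = C * (2:ℝ)^(r:ℝ) * (1/4:ℝ)^n * (2:ℝ) ^ ((1 - 1/(r:ℝ)) * n^2 / 2 - r) := by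
      have e : (1/4:ℝ)^n = (2:ℝ)^(-(2 * (n:ℝ))) := by
        have : (1/4:ℝ) = (2:ℝ)^(-(2:ℝ)) := by
          rw [Real.rpow_neg (by norm_num), show (2:ℝ)^(2:ℝ) = (2:ℝ)^(2:ℕ) from Real.rpow_natCast 2 2]; norm_num
        rw [this, ← Real.rpow_natCast, ← Real.rpow_mul (by norm_num)]; congr 1; ring
      rw [e, mul_assoc C, ← Real.rpow_add (by norm_num), mul_assoc, ← Real.rpow_add (by norm_num)]
      congr 2; ring
    have h6 : C * (2:ℝ)^(r:ℝ) * (1/4:ℝ)^n * (2:ℝ) ^ ((1 - 1/(r:ℝ)) * n^2 / 2 - r) ≤ C * (2:ℝ)^(r:ℝ) * (1/4:ℝ)^n * #(gr n (fun G => IndFree H G)) :=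
      mul_le_mul_of_nonneg_left h1 (by positivity)
    rw [le_div_iff₀ hpos]
    linarith
  · filter_upwards with n
    apply div_le_one_of_le₀ _ (Nat.cast_nonneg _)
    refine Nat.cast_le.2 (card_le_card ?_)
    intro G hG
    exact mem_gr.2 (mem_gr.1 hG).1

end Final
end WPN

/-- For every `H` with `wpn H = r ≥ 2` and every sufficiently small `δ > 0` there are
`γ > 0` and positive integers `b`, `k` such that almost every `H`-free graph on
`{1,…,n}` admits a partition into `X 0,…,X (r-1), Z 0,…,Z (r-1)` and has a set `B` of
at most `b` vertices satisfying: each `G[X i]` is `U(k)`-free, (I) some really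
canonical `H`-freeness witnessing `r`-sequence contains each `G[X i]`,
(II) `|⋃ Z i| ≤ n^{1-γ}`, (III) every `v ∈ X i ∪ Z i` has a vertex `a ∈ B` with
`|(N(v) ∆ N(a)) ∩ (X i ∪ Z i)| < δn`, and (IV) `||X i ∪ Z i| - n/r| ≤ n^{1-γ/4}`. -/
theorem stmt_4 {VH : Type} [Finite VH] (H : SimpleGraph VH) (r : ℕ)
    (hr : IsWpn H r) (hr2 : 2 ≤ r) :
    ∃ δ0 : ℝ, 0 < δ0 ∧
      ∀ δ : ℝ, 0 < δ → δ < δ0 →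
        ∃ (γ : ℝ) (b k : ℕ), 0 < γ ∧ 0 < b ∧ 0 < k ∧
          Tendsto
            (fun n : ℕ =>
              (({G : SimpleGraph (Fin n) |
                  IndFree H G ∧
                  ∃ (X Z : Fin r → Set (Fin n)) (B : Set (Fin n)),
                    B.ncard ≤ b ∧
                    (∀ p q : Fin r ⊕ Fin r, p ≠ q →
                      Disjoint (Sum.elim X Z p) (Sum.elim X Z q)) ∧
                    (⋃ p : Fin r ⊕ Fin r, Sum.elim X Z p) = Set.univ ∧
                    (∀ i, UkFree k (G.induce (X i))) ∧
                    (∃ F : Fin r → GraphClass, IsReallyCanonicalSeq H r F ∧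
                      ∀ i, F i ↥(X i) (G.induce (X i))) ∧
                    (((⋃ i, Z i).ncard : ℝ) ≤ (n : ℝ) ^ ((1 : ℝ) - γ)) ∧
                    (∀ i, ∀ v ∈ X i ∪ Z i, ∃ a ∈ B,
                      (((symmDiff (G.neighborSet v) (G.neighborSet a)) ∩
                          (X i ∪ Z i)).ncard : ℝ) < δ * n) ∧
                    (∀ i, |((X i ∪ Z i).ncard : ℝ) - (n : ℝ) / r| ≤
                      (n : ℝ) ^ ((1 : ℝ) - γ / 4))}.ncard : ℝ) /
                ({G : SimpleGraph (Fin n) | IndFree H G}.ncard : ℝ)))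
            atTop (nhds 1) := by
  have hr0 : 0 < r := by omega
  letI : Fintype VH := Fintype.ofFinite VH
  obtain ⟨k, hk0, hk⟩ := WPN.uk_pattern H
  obtain ⟨δ0, hδ0, hG⟩ := WPN.good_neg H r hr hr0 k hk
  refine ⟨δ0, hδ0, fun δ hδ hδ1 => ?_⟩
  obtain ⟨ε, hε⟩ : ∃ ε : ℝ, ε = 1 / (2 * ((2*k+1 : ℕ):ℝ) + 1) := ⟨_, rfl⟩
  have hε0 : 0 < ε := by rw [hε]; positivity
  have hε1 : ε ≤ 1 := by
    rw [hε, div_le_one (by positivity)]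
    have : (0:ℝ) ≤ ((2*k+1 : ℕ):ℝ) := Nat.cast_nonneg _
    linarith
  obtain ⟨b, hb, hN⟩ := hG δ hδ hδ1 (ε/2) (ε/8) (by rw [← hε]; linarith) (by linarith) (by linarith) (by linarith)
  obtain ⟨N, hA⟩ := WPN.assemble H r hr0 k b _ δ (ε/2) (ε/8) (ε/16) (by linarith) (by linarith) (by linarith) (by linarith)
  refine ⟨ε/16, b, k, by linarith, hb, hk0, ?_⟩
  refine WPN.ratio_tendsto H r hr hr0 _ (hN.mono N ?_)
  intro n hn G h
  exact ⟨h.1, fun hg => h.2 (hA n hn G hg)⟩
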